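/- arXiv:math/9204241 — 3 statements merged into one kernel-verified Lean document; each statement's English description precedes it below -/
import Mathlib

section
/- (Theorem 1, sufficiency.) Let d ≥ 2, ε ∈ (0,1], and let S : Σ_d^dual → Simp_{2d−2} be continuous (product topology) and C^ε with respect to ρ_S, i.e. there exists K > 0 with |S(j) − S(j')|_∞ ≤ K · ρ_S(j,j')^ε for all j ≠ j' (Lipschitz when ε = 1). Then there exists a C^{1+ε} Cantor system on [0,1] with d branches whose scaling function equals S. -/
open Set Filter

noncomputable section

/-- The unit interval `[0,1] ⊆ ℝ`. -/
abbrev I01 : Set ℝ := Set.Icc (0:ℝ) 1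

/-- `ψ` satisfies an `ε`-Hölder bound with constant `H` on `[0,1]`. -/
def HolderBoundOn01 (ε H : ℝ) (ψ : ℝ → ℝ) : Prop :=
  ∀ x ∈ I01, ∀ y ∈ I01, |ψ x - ψ y| ≤ H * |x - y| ^ ε

/-- A `C^{k+ε}` Cantor system on `[0,1]` with `d` branches: each branch `g i` is a
`C^k` increasing contraction of `[0,1]` with `ε`-Hölder `k`-th derivative, the images
`g i ([0,1])` are disjoint closed intervals in increasing order, `g 0 0 = 0` and
`g (d-1) 1 = 1`. -/
structure IsCantorSystem {d : ℕ} (k : ℕ) (ε : ℝ) (g : Fin d → ℝ → ℝ) : Prop where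
  maps : ∀ i, Set.MapsTo (g i) I01 I01
  smooth : ∀ i, ContDiffOn ℝ k (g i) I01
  holder : ∀ i, ∃ H > 0, HolderBoundOn01 ε H (iteratedDerivWithin k (g i) I01)
  deriv_pos : ∀ i, ∀ x ∈ I01, 0 < derivWithin (g i) I01 x
  deriv_lt_one : ∀ i, ∀ x ∈ I01, derivWithin (g i) I01 x < 1
  ordered : ∀ i j : Fin d, i < j → g i 1 < g j 0
  first : ∀ i : Fin d, (i : ℕ) = 0 → g i 0 = 0
  last : ∀ i : Fin d, (i : ℕ) = d - 1 → g i 1 = 1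

/-- For a finite word `w = [w₁,…,wₙ]`, `wordMap g w = g_{wₙ} ∘ ⋯ ∘ g_{w₁}` (i.e. `G_w`). -/
def wordMap {d : ℕ} (g : Fin d → ℝ → ℝ) : List (Fin d) → ℝ → ℝ
  | [] => id
  | i :: w => fun x => wordMap g w (g i x)

/-- `|I_w|`, the length of the interval `I_w = G_w([0,1]) = [G_w 0, G_w 1]`. -/
def wordLen {d : ℕ} (g : Fin d → ℝ → ℝ) (w : List (Fin d)) : ℝ :=
  wordMap g w 1 - wordMap g w 0

/-- The scaling data of the word `w`: the first `d` coordinates are the ratios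
`|I_{i·w}|/|I_w|`, the last `d-1` coordinates are the `d-1` gap lengths between the
consecutive children `I_{1·w},…,I_{d·w}` divided by `|I_w|`. -/
def scalingData {d : ℕ} (g : Fin d → ℝ → ℝ) (w : List (Fin d)) : Fin (2*d-1) → ℝ :=
  fun m =>
    if h : (m : ℕ) < d then
      wordLen g ((⟨(m : ℕ), h⟩ : Fin d) :: w) / wordLen g w
    else
      (wordMap g w (g ⟨(m : ℕ) - d + 1, by have := m.isLt; omega⟩ 0)
        - wordMap g w (g ⟨(m : ℕ) - d, by have := m.isLt; omega⟩ 1)) / wordLen g w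

/-- The open simplex `Simp_{2d-2} ⊆ (0,1)^{2d-1}` of vectors with coordinate sum `1`. -/
def Simp (d : ℕ) : Set (Fin (2*d-1) → ℝ) :=
  {s | (∀ m, s m ∈ Set.Ioo (0:ℝ) 1) ∧ ∑ m, s m = 1}

/-- The initial word `j|_n = (j_1,…,j_n)` of a sequence `j ∈ Σ_d^dual = {1,…,d}^ℕ`. -/
def dword {d : ℕ} (j : ℕ → Fin d) (n : ℕ) : List (Fin d) :=
  List.ofFn (fun i : Fin n => j i)

/-- `S` is the scaling function of the system `g`:
`S(j) = lim_{n→∞} S_n(j|_n)` for every `j ∈ Σ_d^dual`. -/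
def HasScalingFunction {d : ℕ} (g : Fin d → ℝ → ℝ) (S : (ℕ → Fin d) → Fin (2*d-1) → ℝ) : Prop :=
  ∀ j : ℕ → Fin d,
    Filter.Tendsto (fun n => scalingData g (dword j n)) Filter.atTop (nhds (S j))

/-- `ρ_S(j,j')` where `n = #(j∩j')`:
`ρ_S(j,j') = sup_w ∏_{t=1}^{n} S((j_{t+1},…,j_n)·w)_{j_t}` (depends only on `j` and `n`). -/
def rhoS {d : ℕ} (S : (ℕ → Fin d) → Fin (2*d-1) → ℝ) (j : ℕ → Fin d) (n : ℕ) : ℝ :=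
  ⨆ w : ℕ → Fin d, ∏ t ∈ Finset.range n,
    S (fun m => if t + 1 + m < n then j (t + 1 + m) else w (t + 1 + m - n))
      ⟨((j t) : ℕ), by have := (j t).isLt; omega⟩

/-- Given a scaling vector `s ∈ Simp_{2d-2}`, the partition of `[0,1]` it determines has
`i`-th child interval starting at `childLeft s i = ∑_{m<i} (s_m + s_{d+m})`. -/
def childLeft {d : ℕ} (s : Fin (2*d-1) → ℝ) (i : Fin d) : ℝ :=
  ∑ m ∈ (Finset.range (i : ℕ)).attach,
    (s ⟨(m : ℕ), by have h := Finset.mem_range.mp m.2; have := i.isLt; omega⟩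
      + s ⟨d + (m : ℕ), by have h := Finset.mem_range.mp m.2; have := i.isLt; omega⟩)

/-- The right endpoint of the `i`-th child interval of the partition determined by `s`. -/
def childRight {d : ℕ} (s : Fin (2*d-1) → ℝ) (i : Fin d) : ℝ :=
  childLeft s i + s ⟨(i : ℕ), by have := i.isLt; omega⟩

/-- `A(j)`: the set of `2d` endpoints of the `d` child intervals of the partition of `[0,1]`
determined by the scaling vector `s = S(j)`. -/
def Apts {d : ℕ} (s : Fin (2*d-1) → ℝ) : Set ℝ :=
  ⋃ i : Fin d, {childLeft s i, childRight s i}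

/-- An increasing `C^k` diffeomorphism of `[0,1]`. -/
structure IsDiffeo01 (k : ℕ) (φ : ℝ → ℝ) : Prop where
  smooth : ContDiffOn ℝ k φ I01
  mono : StrictMonoOn φ I01
  deriv_pos : ∀ x ∈ I01, 0 < derivWithin φ I01 x
  bij : Set.BijOn φ I01 I01

/-- `D^k(A₁,A₂)`: increasing `C^k` diffeomorphisms of `[0,1]` mapping `A₁` onto `A₂`. -/
def Dk (k : ℕ) (A₁ A₂ : Set ℝ) : Set (ℝ → ℝ) :=
  {φ | IsDiffeo01 k φ ∧ φ '' A₁ = A₂}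

/-- `D^k_var(M)(A₁,A₂)`: members of `D^k(A₁,A₂)` whose `k`-th derivative has variation `< M`. -/
def DkVar (k : ℕ) (M : ℝ) (A₁ A₂ : Set ℝ) : Set (ℝ → ℝ) :=
  {φ | φ ∈ Dk k A₁ A₂ ∧ ∀ x ∈ I01, ∀ y ∈ I01,
    |iteratedDerivWithin k φ I01 x - iteratedDerivWithin k φ I01 y| < M}

/-- The renormalization `(L')⁻¹ ∘ φ ∘ L` of `φ`, where `L, L'` are the increasing affine
bijections from `[0,1]` onto `[a,b]` and `[a',b']` respectively. -/
def renorm (a b a' b' : ℝ) (φ : ℝ → ℝ) : ℝ → ℝ :=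
  fun x => (φ (a + (b - a) * x) - a') / (b' - a')

/-- `R_{j₀} φ`: restrict `φ` to the `j₀`-th child interval of the partition determined by `s`
(mapped to the `j₀`-th child interval of the partition determined by `s'`) and renormalize. -/
def Rmap {d : ℕ} (s s' : Fin (2*d-1) → ℝ) (j₀ : Fin d) (φ : ℝ → ℝ) : ℝ → ℝ :=
  renorm (childLeft s j₀) (childRight s j₀) (childLeft s' j₀) (childRight s' j₀) φ

/-- `j₀·j = (j₀, j_1, j_2, …)`. -/
def consSeq {d : ℕ} (j₀ : Fin d) (j : ℕ → Fin d) : ℕ → Fin d :=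
  fun m => if m = 0 then j₀ else j (m - 1)

/-- The Cantor set of the system: `C = ⋂_{n ≥ 1} ⋃_{w of length n} I_w`. -/
def systemCantorSet {d : ℕ} (g : Fin d → ℝ → ℝ) : Set ℝ :=
  ⋂ n : ℕ, ⋃ w ∈ {w : List (Fin d) | w.length = n + 1}, wordMap g w '' I01

end

noncomputable section

/-- A function on `[0,1]` with end values `α`, `β` and mean `q`. -/
def bridge (N : ℕ) (α β q u : ℝ) : ℝ :=
  (q * (N + 1) - (α + β)) / (N - 1) + (α - (q * (N + 1) - (α + β)) / (N - 1)) * (1 - u) ^ N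
    + (β - (q * (N + 1) - (α + β)) / (N - 1)) * u ^ N

section Bridge

variable {N : ℕ} {α β q : ℝ}

lemma bridge_zero (hN : 3 ≤ N) : bridge N α β q 0 = α := by
  simp [bridge, zero_pow (show N ≠ 0 by omega)]

lemma bridge_one (hN : 3 ≤ N) : bridge N α β q 1 = β := by
  simp [bridge, zero_pow (show N ≠ 0 by omega)]

lemma integral_bridge (hN : 3 ≤ N) : ∫ u in (0:ℝ)..1, bridge N α β q u = q := by
  have hN' : (3:ℝ) ≤ N := by exact_mod_cast hN
  have h1 : ∫ u in (0:ℝ)..1, (1 - u) ^ N = 1 / (N + 1) := by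
    rw [intervalIntegral.integral_comp_sub_left (fun x => x ^ N)]
    simp [integral_pow]
  unfold bridge
  rw [intervalIntegral.integral_add, intervalIntegral.integral_add,
    intervalIntegral.integral_const_mul, intervalIntegral.integral_const_mul, h1, integral_pow]
  · have : (N:ℝ) - 1 ≠ 0 := by linarith
    have : (N:ℝ) + 1 ≠ 0 := by linarith
    simp
    field_simp
    ring
  all_goals exact Continuous.intervalIntegrable (by fun_prop) _ _

lemma integral_bridge_comp (hN : 3 ≤ N) {x y : ℝ} (hxy : x < y) :
    ∫ t in x..y, bridge N α β q ((t - x) / (y - x)) = q * (y - x) := by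
  have h : y - x ≠ 0 := by linarith
  have e : ∀ t, (t - x) / (y - x) = t / (y - x) - x / (y - x) := fun t => by ring
  simp_rw [e]
  rw [intervalIntegral.integral_comp_div_sub _ h]
  have e1 : y / (y - x) - x / (y - x) = 1 := by field_simp
  rw [sub_self, e1, integral_bridge hN, smul_eq_mul, mul_comm]

lemma pow_add_pow_le_one (hN : 3 ≤ N) {u : ℝ} (hu : u ∈ I01) : (1 - u) ^ N + u ^ N ≤ 1 := by
  have h1 : (1 - u) ^ N ≤ 1 - u :=
    pow_le_of_le_one (by linarith [hu.2]) (by linarith [hu.1]) (by omega)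
  have h2 : u ^ N ≤ u := pow_le_of_le_one hu.1 hu.2 (by omega)
  linarith

lemma add_combo_pos {p r x y w : ℝ} (hp : 0 ≤ p) (hr : 0 ≤ r) (h : p + r ≤ 1) (hx : 0 < x)
    (hy : 0 < y) (hw : 0 < w) : 0 < w + (x - w) * p + (y - w) * r := by
  have e : w + (x - w) * p + (y - w) * r = w * (1 - (p + r)) + x * p + y * r := by ring
  have h1 := mul_nonneg hw.le (sub_nonneg.mpr h)
  have h2 := mul_nonneg hx.le hp
  have h3 := mul_nonneg hy.le hr
  rw [e]
  rcases h.lt_or_eq with h | h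
  · have := mul_pos hw (sub_pos.mpr h)
    linarith
  · rcases hp.lt_or_eq with hp | hp
    · have := mul_pos hx hp
      linarith
    · have : r = 1 := by linarith
      subst this
      linarith

lemma bridge_mem {s t : ℝ} (hN : 3 ≤ N) (hα : α ∈ Ioo s t) (hβ : β ∈ Ioo s t)
    (hm : (q * (N + 1) - (α + β)) / (N - 1) ∈ Ioo s t) {u : ℝ} (hu : u ∈ I01) :
    bridge N α β q u ∈ Ioo s t := by
  unfold bridge
  set m := (q * (N + 1) - (α + β)) / (N - 1)
  have h := pow_add_pow_le_one hN hu
  have h1 : 0 ≤ (1 - u) ^ N := pow_nonneg (by linarith [hu.2]) _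
  have h2 : 0 ≤ u ^ N := pow_nonneg hu.1 _
  constructor
  · have := add_combo_pos h1 h2 h (x := α - s) (y := β - s) (w := m - s) (by linarith [hα.1]) (by linarith [hβ.1])
      (by linarith [hm.1])
    linarith
  · have := add_combo_pos h1 h2 h (x := t - α) (y := t - β) (w := t - m) (by linarith [hα.2]) (by linarith [hβ.2])
      (by linarith [hm.2])
    linarith

lemma bridge_mem_unit {b θ : ℝ} (hN : 3 ≤ N) (hb : 0 < b) (hθ : θ < 1) (hNb : 3 < N * b)
    (hNθ : 3 < N * (1 - θ)) (hα : α ∈ Icc b θ) (hβ : β ∈ Icc b θ) (hq : q ∈ Icc b θ) {u : ℝ}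
    (hu : u ∈ I01) : bridge N α β q u ∈ Ioo (0:ℝ) 1 := by
  have hN' : (3:ℝ) ≤ N := by exact_mod_cast hN
  refine bridge_mem hN ⟨by linarith [hα.1], by linarith [hα.2]⟩
    ⟨by linarith [hβ.1], by linarith [hβ.2]⟩ ⟨?_, ?_⟩ hu
  · apply div_pos _ (by linarith)
    nlinarith [hα.2, hβ.2, hq.1]
  · rw [div_lt_one (by linarith)]
    nlinarith [hα.1, hβ.1, hq.2]

lemma abs_mid_sub_le {s δ : ℝ} (hN : 3 ≤ N) (hα : |α - s| ≤ δ) (hβ : |β - s| ≤ δ)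
    (hq : |q - s| ≤ δ) : |(q * (N + 1) - (α + β)) / (N - 1) - s| ≤ 3 * δ := by
  have hN' : (3:ℝ) ≤ N := by exact_mod_cast hN
  have h0 : (0:ℝ) < N - 1 := by linarith
  have e : (q * (N + 1) - (α + β)) / (N - 1) - s
      = ((q - s) * (N + 1) - (α - s) - (β - s)) / (N - 1) := by
    field_simp
    ring
  have hδ := (abs_nonneg _).trans hα
  rw [abs_le] at *
  rw [e, le_div_iff₀ h0, div_le_iff₀ h0]
  constructor <;> nlinarith

lemma abs_bridge_sub_le {s δ : ℝ} (hN : 3 ≤ N) (hα : |α - s| ≤ δ) (hβ : |β - s| ≤ δ)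
    (hq : |q - s| ≤ δ) {u : ℝ} (hu : u ∈ I01) : |bridge N α β q u - s| ≤ 7 * δ := by
  have hm := abs_mid_sub_le hN hα hβ hq
  have h := pow_add_pow_le_one hN hu
  have h1 : 0 ≤ (1 - u) ^ N := pow_nonneg (by linarith [hu.2]) _
  have h2 : 0 ≤ u ^ N := pow_nonneg hu.1 _
  unfold bridge
  set m := (q * (N + 1) - (α + β)) / (N - 1)
  have hδ := (abs_nonneg _).trans hα
  have e : m + (α - m) * (1 - u) ^ N + (β - m) * u ^ N - s
      = (m - s) * (1 - ((1 - u) ^ N + u ^ N)) + (α - s) * (1 - u) ^ N + (β - s) * u ^ N := by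
    ring
  rw [e]
  rw [abs_le] at *
  constructor <;> nlinarith

lemma abs_bridge_sub_bridge_le {s δ : ℝ} (hN : 3 ≤ N) (hα : |α - s| ≤ δ) (hβ : |β - s| ≤ δ)
    (hq : |q - s| ≤ δ) {u v : ℝ} (hu : u ∈ I01) (hv : v ∈ I01) :
    |bridge N α β q u - bridge N α β q v| ≤ 8 * δ * N * |u - v| := by
  have hm := abs_mid_sub_le hN hα hβ hq
  have hp : ∀ {x y : ℝ}, x ∈ I01 → y ∈ I01 → |x ^ N - y ^ N| ≤ N * |x - y| := by
    intro x y hx hy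
    refine (abs_pow_sub_pow_le x y N).trans ?_
    have : max |x| |y| ^ (N - 1) ≤ 1 := by
      apply pow_le_one₀ (by positivity)
      rw [abs_of_nonneg hx.1, abs_of_nonneg hy.1]
      exact max_le hx.2 hy.2
    nlinarith [mul_nonneg (abs_nonneg (x - y)) (Nat.cast_nonneg (α := ℝ) N)]
  have h1 : |(1 - u) ^ N - (1 - v) ^ N| ≤ N * |u - v| := by
    have := hp (x := 1 - u) (y := 1 - v) ⟨by linarith [hu.2], by linarith [hu.1]⟩
      ⟨by linarith [hv.2], by linarith [hv.1]⟩
    have e : (1 - u) - (1 - v) = -(u - v) := by ring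
    rwa [e, abs_neg] at this
  have h2 := hp hu hv
  unfold bridge
  set m := (q * (N + 1) - (α + β)) / (N - 1)
  have e : m + (α - m) * (1 - u) ^ N + (β - m) * u ^ N
        - (m + (α - m) * (1 - v) ^ N + (β - m) * v ^ N)
      = (α - m) * ((1 - u) ^ N - (1 - v) ^ N) + (β - m) * (u ^ N - v ^ N) := by ring
  have hαm : |α - m| ≤ 4 * δ := by
    rw [abs_le] at *; constructor <;> linarith
  have hβm : |β - m| ≤ 4 * δ := by
    rw [abs_le] at *; constructor <;> linarith
  rw [e]
  refine (abs_add_le _ _).trans ?_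
  rw [abs_mul, abs_mul]
  have h3 := mul_le_mul hαm h1 (abs_nonneg _) ((abs_nonneg _).trans hαm)
  have h4 := mul_le_mul hβm h2 (abs_nonneg _) ((abs_nonneg _).trans hβm)
  linarith

end Bridge

/-- Left endpoints `a w` and lengths `L w` of a nested family of intervals indexed by finite words,
with uniform bounds on the ratios between consecutive levels and a Hölder control on the
ratios `L (w ++ [i]) / L w` that determine the derivatives of the branches. -/
structure CantorGeometry (d : ℕ) (ε : ℝ) where
  a : List (Fin d) → ℝ
  L : List (Fin d) → ℝ
  c : ℝ
  b : ℝ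
  θ : ℝ
  C : ℝ
  two_le : 2 ≤ d
  ε_pos : 0 < ε
  ε_le : ε ≤ 1
  a_nil : a [] = 0
  L_nil : L [] = 1
  L_pos : ∀ w, 0 < L w
  a_first : ∀ w, a (⟨0, by omega⟩ :: w) = a w
  right_last : ∀ w, a (⟨d - 1, by omega⟩ :: w) + L (⟨d - 1, by omega⟩ :: w) = a w + L w
  c_pos : 0 < c
  le_child : ∀ w j, c * L w ≤ L (j :: w)
  child_le : ∀ w j, L (j :: w) ≤ (1 - c) * L w
  le_gap : ∀ w (k : Fin (d - 1)), c * L w ≤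
    a (⟨k + 1, by omega⟩ :: w) - (a (⟨k, by omega⟩ :: w) + L (⟨k, by omega⟩ :: w))
  b_pos : 0 < b
  θ_lt : θ < 1
  C_pos : 0 < C
  le_ratio : ∀ w i, b ≤ L (w ++ [i]) / L w
  ratio_le : ∀ w i, L (w ++ [i]) / L w ≤ θ
  le_gapRatio : ∀ w i (k : Fin (d - 1)), b ≤
    (a (⟨k + 1, by omega⟩ :: (w ++ [i]))
        - (a (⟨k, by omega⟩ :: (w ++ [i])) + L (⟨k, by omega⟩ :: (w ++ [i])))) /
      (a (⟨k + 1, by omega⟩ :: w) - (a (⟨k, by omega⟩ :: w) + L (⟨k, by omega⟩ :: w)))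
  gapRatio_le : ∀ w i (k : Fin (d - 1)),
    (a (⟨k + 1, by omega⟩ :: (w ++ [i]))
        - (a (⟨k, by omega⟩ :: (w ++ [i])) + L (⟨k, by omega⟩ :: (w ++ [i])))) /
      (a (⟨k + 1, by omega⟩ :: w) - (a (⟨k, by omega⟩ :: w) + L (⟨k, by omega⟩ :: w))) ≤ θ
  ratio_holder : ∀ w i j,
    |L (j :: (w ++ [i])) / L (j :: w) - L (w ++ [i]) / L w| ≤ C * L w ^ ε
  gapRatio_holder : ∀ w i (k : Fin (d - 1)),
    |(a (⟨k + 1, by omega⟩ :: (w ++ [i]))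
        - (a (⟨k, by omega⟩ :: (w ++ [i])) + L (⟨k, by omega⟩ :: (w ++ [i])))) /
      (a (⟨k + 1, by omega⟩ :: w) - (a (⟨k, by omega⟩ :: w) + L (⟨k, by omega⟩ :: w)))
      - L (w ++ [i]) / L w| ≤ C * L w ^ ε

namespace CantorGeometry

variable {d : ℕ} {ε : ℝ} (G : CantorGeometry d ε)

/-- The right endpoint of the interval of the word `w`. -/
def right (w : List (Fin d)) : ℝ := G.a w + G.L w

/-- The interval of the word `w`. -/
def interval (w : List (Fin d)) : Set ℝ := Icc (G.a w) (G.right w)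

/-- The left endpoint of the `k`-th gap in the interval of `w`. -/
def lo (w : List (Fin d)) (k : Fin (d - 1)) : ℝ := G.right (⟨k, by omega⟩ :: w)

/-- The right endpoint of the `k`-th gap in the interval of `w`. -/
def hi (w : List (Fin d)) (k : Fin (d - 1)) : ℝ := G.a (⟨k + 1, by omega⟩ :: w)

lemma le_hi_sub_lo (w : List (Fin d)) (k : Fin (d - 1)) : G.c * G.L w ≤ G.hi w k - G.lo w k :=
  G.le_gap w k

lemma lo_lt_hi (w : List (Fin d)) (k : Fin (d - 1)) : G.lo w k < G.hi w k := by
  have h1 := G.le_hi_sub_lo w k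
  have h2 := mul_pos G.c_pos (G.L_pos w)
  linarith

lemma a_lt_right (w : List (Fin d)) : G.a w < G.right w := by
  have := G.L_pos w
  unfold right; linarith

lemma right_lt_a (w : List (Fin d)) {j j' : Fin d} (h : j < j') :
    G.right (j :: w) < G.a (j' :: w) := by
  obtain ⟨n, hn⟩ := j'
  induction n with
  | zero => exact absurd h (by simp [Fin.lt_def])
  | succ n ih =>
    have hgap : G.right (⟨n, by omega⟩ :: w) < G.a (⟨n + 1, hn⟩ :: w) :=
      G.lo_lt_hi w ⟨n, by omega⟩
    rcases (Nat.lt_succ_iff.mp (Fin.lt_def.mp h)).lt_or_eq with h' | h'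
    · exact (ih (by omega) h').trans ((G.a_lt_right _).trans hgap)
    · obtain ⟨j, hj⟩ := j
      simp only at h'
      subst h'
      exact hgap

lemma a_le_a_cons (w : List (Fin d)) (j : Fin d) : G.a w ≤ G.a (j :: w) := by
  have h2 := G.two_le
  rcases Nat.eq_zero_or_pos j with h | h
  · have : j = ⟨0, by omega⟩ := Fin.ext h
    rw [this, G.a_first]
  · rw [← G.a_first w]
    exact ((G.a_lt_right _).trans (G.right_lt_a w (Fin.lt_def.mpr h))).le

lemma right_cons_le (w : List (Fin d)) (j : Fin d) : G.right (j :: w) ≤ G.right w := by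
  have h2 := G.two_le
  have hl : G.right (⟨d - 1, by omega⟩ :: w) = G.right w := G.right_last w
  rcases (Nat.le_sub_one_of_lt j.isLt).eq_or_lt with h | h
  · have : j = ⟨d - 1, by omega⟩ := Fin.ext h
    rw [this, hl]
  · rw [← hl]
    exact ((G.right_lt_a w (Fin.lt_def.mpr h)).trans (G.a_lt_right _)).le

lemma interval_cons_subset (w : List (Fin d)) (j : Fin d) :
    G.interval (j :: w) ⊆ G.interval w :=
  Icc_subset_Icc (G.a_le_a_cons w j) (G.right_cons_le w j)

lemma a_le_append (v w : List (Fin d)) : G.a w ≤ G.a (v ++ w) := by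
  induction v with
  | nil => exact le_rfl
  | cons j v ih => exact ih.trans (G.a_le_a_cons _ _)

lemma right_append_le (v w : List (Fin d)) : G.right (v ++ w) ≤ G.right w := by
  induction v with
  | nil => exact le_rfl
  | cons j v ih => exact (G.right_cons_le _ _).trans ih

lemma interval_append_subset (v w : List (Fin d)) : G.interval (v ++ w) ⊆ G.interval w :=
  Icc_subset_Icc (G.a_le_append v w) (G.right_append_le v w)

lemma interval_nil : G.interval [] = I01 := by
  simp [interval, right, G.a_nil, G.L_nil]

lemma interval_subset (w : List (Fin d)) : G.interval w ⊆ I01 := by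
  have := G.interval_append_subset w []
  rwa [List.append_nil, G.interval_nil] at this

lemma a_mem (w : List (Fin d)) : G.a w ∈ G.interval w := ⟨le_rfl, (G.a_lt_right w).le⟩

lemma right_mem (w : List (Fin d)) : G.right w ∈ G.interval w := ⟨(G.a_lt_right w).le, le_rfl⟩

lemma lo_mem (w : List (Fin d)) (k : Fin (d - 1)) : G.lo w k ∈ G.interval w :=
  G.interval_cons_subset _ _ (G.right_mem _)

lemma hi_mem (w : List (Fin d)) (k : Fin (d - 1)) : G.hi w k ∈ G.interval w :=
  G.interval_cons_subset _ _ (G.a_mem _)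

lemma gap_subset (w : List (Fin d)) (k : Fin (d - 1)) :
    Icc (G.lo w k) (G.hi w k) ⊆ G.interval w :=
  Icc_subset_Icc (G.lo_mem w k).1 (G.hi_mem w k).2

lemma a_lt_lo (w : List (Fin d)) (k : Fin (d - 1)) : G.a w < G.lo w k :=
  (G.a_le_a_cons _ _).trans_lt (G.a_lt_right _)

lemma hi_lt_right (w : List (Fin d)) (k : Fin (d - 1)) : G.hi w k < G.right w :=
  (G.a_lt_right _).trans_le (G.right_cons_le _ _)

lemma mem_child_or_gap {w : List (Fin d)} {x : ℝ} (hx : x ∈ G.interval w) :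
    (∃ j, x ∈ G.interval (j :: w)) ∨ ∃ k, x ∈ Ioo (G.lo w k) (G.hi w k) := by
  have h2 := G.two_le
  by_contra! h
  obtain ⟨h, h'⟩ := h
  have key : ∀ (k : ℕ) (hk : k < d), G.right (⟨k, hk⟩ :: w) < x := by
    intro k
    induction k with
    | zero =>
      intro hk
      by_contra! hle
      exact h ⟨0, hk⟩ ⟨by rw [G.a_first]; exact hx.1, hle⟩
    | succ k ih =>
      intro hk
      by_contra! hle
      have h1 := ih (by omega)
      refine h ⟨k + 1, hk⟩ ⟨?_, hle⟩
      by_contra! h3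
      exact h' ⟨k, by omega⟩ ⟨h1, h3⟩
  have h3 := key (d - 1) (by omega)
  have hl : G.right (⟨d - 1, by omega⟩ :: w) = G.right w := G.right_last w
  rw [hl] at h3
  exact absurd hx.2 (not_le.mpr h3)

lemma child_unique {w : List (Fin d)} {x : ℝ} {j j' : Fin d} (h : x ∈ G.interval (j :: w))
    (h' : x ∈ G.interval (j' :: w)) : j = j' := by
  rcases lt_trichotomy j j' with hl | hl | hl
  · exact absurd (h'.1.trans h.2) (not_le.mpr (G.right_lt_a w hl))
  · exact hl
  · exact absurd (h.1.trans h'.2) (not_le.mpr (G.right_lt_a w hl))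

lemma not_mem_child_of_mem_gap {w : List (Fin d)} {x : ℝ} {k : Fin (d - 1)} {j : Fin d}
    (h : x ∈ Ioo (G.lo w k) (G.hi w k)) (h' : x ∈ G.interval (j :: w)) : False := by
  rcases le_or_gt (j : ℕ) k with hl | hl
  · have : G.right (j :: w) ≤ G.lo w k := by
      rcases hl.eq_or_lt with he | hl
      · have : j = ⟨k, by omega⟩ := Fin.ext he
        rw [this]; exact le_rfl
      · exact ((G.right_lt_a w (j' := ⟨k, by omega⟩) hl).trans (G.a_lt_right _)).le
    exact absurd (h'.2.trans this) (not_le.mpr h.1)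
  · have : G.hi w k ≤ G.a (j :: w) := by
      rcases (Nat.succ_le_of_lt hl).eq_or_lt with he | hl
      · have : j = ⟨k + 1, by omega⟩ := Fin.ext he.symm
        rw [this]; exact le_rfl
      · exact ((G.a_lt_right _).trans (G.right_lt_a w (j := ⟨k + 1, by omega⟩) hl)).le
    exact absurd (this.trans h'.1) (not_le.mpr h.2)

lemma gap_index_unique {w : List (Fin d)} {x : ℝ} {k k' : Fin (d - 1)}
    (h : x ∈ Ioo (G.lo w k) (G.hi w k)) (h' : x ∈ Ioo (G.lo w k') (G.hi w k')) : k = k' := by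
  have key : ∀ {k k' : Fin (d - 1)}, x ∈ Ioo (G.lo w k) (G.hi w k) →
      x ∈ Ioo (G.lo w k') (G.hi w k') → ¬ k < k' := by
    intro k k' h h' hl
    have : G.hi w k ≤ G.lo w k' := by
      rcases (Nat.succ_le_of_lt (Fin.lt_def.mp hl)).eq_or_lt with he | hl
      · have : (⟨k + 1, by omega⟩ : Fin d) = ⟨k', by omega⟩ := Fin.ext he
        unfold hi lo
        rw [this]; exact (G.a_lt_right _).le
      · exact ((G.a_lt_right _).trans ((G.right_lt_a w (j := ⟨k + 1, by omega⟩)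
          (j' := ⟨k', by omega⟩) hl).trans (G.a_lt_right _))).le
    exact absurd (h'.1.trans (h.2.trans_le this)) (lt_irrefl _)
  exact le_antisymm (not_lt.mp (key h' h)) (not_lt.mp (key h h'))

lemma suffix_of_mem {w w' : List (Fin d)} {x : ℝ} (h : x ∈ G.interval w)
    (h' : x ∈ G.interval w') (hlen : w.length ≤ w'.length) : w <:+ w' := by
  induction w with
  | nil => exact List.nil_suffix
  | cons j w ih =>
    obtain ⟨v, rfl⟩ := ih (G.interval_cons_subset _ _ h) (by simp at hlen; omega)
    rcases List.eq_nil_or_concat v with rfl | ⟨v, j', rfl⟩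
    · simp at hlen
    · have h3 : x ∈ G.interval (j' :: w) := by
        apply G.interval_append_subset v
        simpa using h'
      rw [G.child_unique h h3]
      exact ⟨v, by simp⟩

lemma suffix_of_mem_gap {w w' : List (Fin d)} {x : ℝ} {k : Fin (d - 1)} (h : x ∈ G.interval w)
    (h' : x ∈ Ioo (G.lo w' k) (G.hi w' k)) : w <:+ w' := by
  have h3 : x ∈ G.interval w' := G.gap_subset _ _ (Ioo_subset_Icc_self h')
  rcases le_or_gt w.length w'.length with hl | hl
  · exact G.suffix_of_mem h h3 hl
  · exfalso
    obtain ⟨v, rfl⟩ := G.suffix_of_mem h3 h hl.le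
    rcases List.eq_nil_or_concat v with rfl | ⟨v, j', rfl⟩
    · simp at hl
    · refine G.not_mem_child_of_mem_gap h' (j := j') ?_
      apply G.interval_append_subset v
      simpa using h

lemma gap_unique {w w' : List (Fin d)} {x : ℝ} {k k' : Fin (d - 1)}
    (h : x ∈ Ioo (G.lo w k) (G.hi w k)) (h' : x ∈ Ioo (G.lo w' k') (G.hi w' k')) :
    w = w' ∧ k = k' := by
  have e : w = w' := by
    have h1 := G.suffix_of_mem_gap (G.gap_subset _ _ (Ioo_subset_Icc_self h)) h'
    have h2 := G.suffix_of_mem_gap (G.gap_subset _ _ (Ioo_subset_Icc_self h')) h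
    exact h1.eq_of_length (le_antisymm h1.length_le h2.length_le)
  subst e
  exact ⟨rfl, G.gap_index_unique h h'⟩

lemma endpoint_not_mem_gap {v w : List (Fin d)} {k : Fin (d - 1)} {x : ℝ}
    (hx : x = G.a v ∨ x = G.right v) : x ∉ Ioo (G.lo w k) (G.hi w k) := by
  intro h
  have hm : x ∈ G.interval v := by
    rcases hx with rfl | rfl
    exacts [G.a_mem v, G.right_mem v]
  obtain ⟨u, rfl⟩ := G.suffix_of_mem_gap hm h
  have h1 := (G.a_le_append u v).trans_lt ((G.a_lt_lo _ k).trans h.1)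
  have h2 := (h.2.trans (G.hi_lt_right _ k)).trans_le (G.right_append_le u v)
  rcases hx with rfl | rfl
  exacts [lt_irrefl _ h1, lt_irrefl _ h2]

lemma c_lt_one : G.c < 1 := by
  have h := (G.L_pos _).trans_le (G.child_le [] ⟨0, by have := G.two_le; omega⟩)
  rw [G.L_nil] at h
  linarith

lemma L_le_pow (w : List (Fin d)) : G.L w ≤ (1 - G.c) ^ w.length := by
  induction w with
  | nil => simp [G.L_nil]
  | cons j w ih =>
    rw [List.length_cons, pow_succ']
    exact (G.child_le w j).trans (mul_le_mul_of_nonneg_left ih (by linarith [G.c_lt_one]))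

lemma L_cons_le (w : List (Fin d)) (j : Fin d) : G.L (j :: w) ≤ G.L w := by
  have := G.child_le w j
  have := mul_pos G.c_pos (G.L_pos w)
  linarith

lemma L_append_le (v w : List (Fin d)) : G.L (v ++ w) ≤ G.L w := by
  induction v with
  | nil => exact le_rfl
  | cons j v ih => exact (G.L_cons_le _ _).trans ih

lemma exists_pow_lt {x : ℝ} (hx : 0 < x) : ∃ n : ℕ, ∀ w : List (Fin d), n ≤ w.length →
    G.L w < x := by
  obtain ⟨n, hn⟩ := exists_pow_lt_of_lt_one hx (show 1 - G.c < 1 by linarith [G.c_pos])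
  refine ⟨n, fun w hw => (G.L_le_pow w).trans_lt (lt_of_le_of_lt ?_ hn)⟩
  exact pow_le_pow_of_le_one (by linarith [G.c_lt_one]) (by linarith [G.c_pos]) hw

lemma abs_sub_le_L {w : List (Fin d)} {x y : ℝ} (hx : x ∈ G.interval w)
    (hy : y ∈ G.interval w) : |x - y| ≤ G.L w := by
  have : G.right w = G.a w + G.L w := rfl
  rw [abs_le]
  constructor <;> linarith [hx.1, hx.2, hy.1, hy.2]

/-- The Hölder constant of the ratios along nested intervals. -/
def A : ℝ := G.C / (1 - (1 - G.c) ^ ε)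

lemma rpow_lt_one' : (1 - G.c) ^ ε < 1 :=
  Real.rpow_lt_one (by linarith [G.c_lt_one]) (by linarith [G.c_pos]) G.ε_pos

lemma A_pos : 0 < G.A := div_pos G.C_pos (by linarith [G.rpow_lt_one'])

lemma C_mul_le (w : List (Fin d)) (j : Fin d) :
    G.C * G.L w ^ ε ≤ G.A * (G.L w ^ ε - G.L (j :: w) ^ ε) := by
  have hκ : 0 < 1 - (1 - G.c) ^ ε := by linarith [G.rpow_lt_one']
  have h1 : G.L (j :: w) ^ ε ≤ (1 - G.c) ^ ε * G.L w ^ ε := by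
    rw [← Real.mul_rpow (by linarith [G.c_lt_one]) (G.L_pos w).le]
    exact Real.rpow_le_rpow (G.L_pos _).le (G.child_le w j) G.ε_pos.le
  have e : G.C = G.A * (1 - (1 - G.c) ^ ε) := by
    unfold A; field_simp
  rw [e, mul_assoc]
  apply mul_le_mul_of_nonneg_left _ G.A_pos.le
  linarith

lemma C_le_A : G.C ≤ G.A := by
  unfold A
  rw [le_div_iff₀ (by linarith [G.rpow_lt_one'])]
  have : 0 ≤ (1 - G.c) ^ ε := Real.rpow_nonneg (by linarith [G.c_lt_one]) _
  nlinarith [G.C_pos]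

variable (i : Fin d)

/-- The ratio between the lengths of the intervals of `w ++ [i]` and of `w`. -/
def ratio (w : List (Fin d)) : ℝ := G.L (w ++ [i]) / G.L w

/-- The ratio between the lengths of the `k`-th gaps of `w ++ [i]` and of `w`. -/
def gapRatio (w : List (Fin d)) (k : Fin (d - 1)) : ℝ :=
  (G.hi (w ++ [i]) k - G.lo (w ++ [i]) k) / (G.hi w k - G.lo w k)

lemma gapRatio_mem (w : List (Fin d)) (k : Fin (d - 1)) : G.gapRatio i w k ∈ Icc G.b G.θ :=
  ⟨G.le_gapRatio w i k, G.gapRatio_le w i k⟩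

lemma ratio_append_sub_le (v w : List (Fin d)) :
    |G.ratio i (v ++ w) - G.ratio i w| ≤ G.A * (G.L w ^ ε - G.L (v ++ w) ^ ε) := by
  induction v with
  | nil => simp
  | cons j v ih =>
    have h1 : |G.ratio i (j :: (v ++ w)) - G.ratio i (v ++ w)| ≤ G.C * G.L (v ++ w) ^ ε :=
      G.ratio_holder (v ++ w) i j
    have h2 := G.C_mul_le (v ++ w) j
    have h3 := abs_sub_le (G.ratio i (j :: (v ++ w))) (G.ratio i (v ++ w)) (G.ratio i w)
    rw [List.cons_append]
    linarith

/-- The derivative of the `i`-th branch at the points outside the gaps. -/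
def cantorDeriv (x : ℝ) : ℝ :=
  sSup ((fun w => max G.b (G.ratio i w - G.A * G.L w ^ ε)) '' {w | x ∈ G.interval w})

lemma max_le_ratio_add {x : ℝ} {w w' : List (Fin d)} (h : x ∈ G.interval w)
    (h' : x ∈ G.interval w') :
    max G.b (G.ratio i w' - G.A * G.L w' ^ ε) ≤ G.ratio i w + G.A * G.L w ^ ε := by
  have hA := G.A_pos
  have p1 : 0 < G.L w ^ ε := Real.rpow_pos_of_pos (G.L_pos _) _
  have p2 : 0 < G.L w' ^ ε := Real.rpow_pos_of_pos (G.L_pos _) _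
  have q1 := mul_pos hA p1
  have q2 := mul_pos hA p2
  have hb : G.b ≤ G.ratio i w := G.le_ratio w i
  apply max_le
  · linarith
  · rcases le_total w.length w'.length with hl | hl
    · obtain ⟨v, rfl⟩ := G.suffix_of_mem h h' hl
      have := (abs_le.mp (G.ratio_append_sub_le i v w)).2
      linarith
    · obtain ⟨v, rfl⟩ := G.suffix_of_mem h' h hl
      have := (abs_le.mp (G.ratio_append_sub_le i v w')).1
      linarith

lemma bddAbove_cantorDeriv {x : ℝ} {w : List (Fin d)} (h : x ∈ G.interval w) :
    BddAbove ((fun w => max G.b (G.ratio i w - G.A * G.L w ^ ε)) '' {w | x ∈ G.interval w}) := by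
  refine ⟨G.ratio i w + G.A * G.L w ^ ε, ?_⟩
  rintro _ ⟨w', hw', rfl⟩
  exact G.max_le_ratio_add i h hw'

lemma cantorDeriv_sub_le {x : ℝ} {w : List (Fin d)} (h : x ∈ G.interval w) :
    |G.cantorDeriv i x - G.ratio i w| ≤ G.A * G.L w ^ ε := by
  have h1 : max G.b (G.ratio i w - G.A * G.L w ^ ε) ≤ G.cantorDeriv i x :=
    le_csSup (G.bddAbove_cantorDeriv i h) ⟨w, h, rfl⟩
  have h2 : G.cantorDeriv i x ≤ G.ratio i w + G.A * G.L w ^ ε := by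
    apply csSup_le (Set.Nonempty.image _ ⟨w, h⟩)
    rintro _ ⟨w', hw', rfl⟩
    exact G.max_le_ratio_add i h hw'
  have h3 := (le_max_right _ _).trans h1
  rw [abs_le]
  constructor <;> linarith

lemma cantorDeriv_mem {x : ℝ} {w : List (Fin d)} (h : x ∈ G.interval w) :
    G.cantorDeriv i x ∈ Icc G.b G.θ := by
  constructor
  · exact (le_max_left _ _).trans (le_csSup (G.bddAbove_cantorDeriv i h) ⟨w, h, rfl⟩)
  · apply csSup_le (Set.Nonempty.image _ ⟨w, h⟩)
    rintro _ ⟨w', hw', rfl⟩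
    have h1 : G.ratio i w' ≤ G.θ := G.ratio_le w' i
    have h2 : G.b ≤ G.ratio i w' := G.le_ratio w' i
    have h3 := mul_pos G.A_pos (Real.rpow_pos_of_pos (G.L_pos w') ε)
    exact max_le (by linarith) (by linarith)

/-- The degree of the bridges used in the gaps. -/
def N : ℕ := ⌈3 / G.b⌉₊ + ⌈3 / (1 - G.θ)⌉₊ + 3

lemma three_le_N : 3 ≤ G.N := Nat.le_add_left _ _

lemma three_lt_N_mul {x : ℝ} (hx : 0 < x) (h : ⌈3 / x⌉₊ + 1 ≤ G.N) : 3 < G.N * x := by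
  have h1 : 3 / x ≤ ⌈3 / x⌉₊ := Nat.le_ceil _
  have h2 : (⌈3 / x⌉₊ : ℝ) + 1 ≤ G.N := by exact_mod_cast h
  rw [div_le_iff₀ hx] at h1
  nlinarith

/-- The derivative of the `i`-th branch in the `k`-th gap of `w`. -/
def gapDeriv (w : List (Fin d)) (k : Fin (d - 1)) (x : ℝ) : ℝ :=
  bridge G.N (G.cantorDeriv i (G.lo w k)) (G.cantorDeriv i (G.hi w k)) (G.gapRatio i w k)
    ((x - G.lo w k) / (G.hi w k - G.lo w k))

variable {i}

lemma div_mem {w : List (Fin d)} {k : Fin (d - 1)} {x : ℝ}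
    (hx : x ∈ Icc (G.lo w k) (G.hi w k)) :
    (x - G.lo w k) / (G.hi w k - G.lo w k) ∈ I01 := by
  have h := G.lo_lt_hi w k
  constructor
  · exact div_nonneg (by linarith [hx.1]) (by linarith)
  · rw [div_le_one (by linarith)]
    linarith [hx.2]

lemma gapDeriv_mem {w : List (Fin d)} {k : Fin (d - 1)} {x : ℝ}
    (hx : x ∈ Icc (G.lo w k) (G.hi w k)) : G.gapDeriv i w k x ∈ Ioo (0:ℝ) 1 :=
  bridge_mem_unit G.three_le_N G.b_pos G.θ_lt
    (G.three_lt_N_mul G.b_pos (by unfold N; omega))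
    (G.three_lt_N_mul (by linarith [G.θ_lt]) (by unfold N; omega))
    (G.cantorDeriv_mem i (G.lo_mem w k)) (G.cantorDeriv_mem i (G.hi_mem w k))
    (G.gapRatio_mem i w k) (G.div_mem hx)

lemma gapRatio_sub_le (w : List (Fin d)) (k : Fin (d - 1)) :
    |G.gapRatio i w k - G.ratio i w| ≤ G.A * G.L w ^ ε := by
  have h : |G.gapRatio i w k - G.ratio i w| ≤ G.C * G.L w ^ ε := G.gapRatio_holder w i k
  exact h.trans (mul_le_mul_of_nonneg_right G.C_le_A (Real.rpow_nonneg (G.L_pos w).le _))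

lemma gapDeriv_sub_le {w : List (Fin d)} {k : Fin (d - 1)} {x : ℝ}
    (hx : x ∈ Icc (G.lo w k) (G.hi w k)) :
    |G.gapDeriv i w k x - G.ratio i w| ≤ 7 * (G.A * G.L w ^ ε) :=
  abs_bridge_sub_le G.three_le_N (G.cantorDeriv_sub_le i (G.lo_mem w k))
    (G.cantorDeriv_sub_le i (G.hi_mem w k)) (G.gapRatio_sub_le w k) (G.div_mem hx)

lemma gapDeriv_lipschitz {w : List (Fin d)} {k : Fin (d - 1)} {x y : ℝ}
    (hx : x ∈ Icc (G.lo w k) (G.hi w k)) (hy : y ∈ Icc (G.lo w k) (G.hi w k)) :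
    |G.gapDeriv i w k x - G.gapDeriv i w k y| ≤ 8 * G.A * G.N / G.c * |x - y| ^ ε := by
  have h := abs_bridge_sub_bridge_le G.three_le_N (G.cantorDeriv_sub_le i (G.lo_mem w k))
    (G.cantorDeriv_sub_le i (G.hi_mem w k)) (G.gapRatio_sub_le w k) (G.div_mem hx) (G.div_mem hy)
  refine h.trans ?_
  have hl := G.le_hi_sub_lo w k
  have hL := G.L_pos w
  have hc := G.c_pos
  have hM : 0 < G.hi w k - G.lo w k := by linarith [G.lo_lt_hi w k]
  have hd : |x - y| ≤ G.L w := G.abs_sub_le_L (G.gap_subset w k hx) (G.gap_subset w k hy)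
  have e : (x - G.lo w k) / (G.hi w k - G.lo w k) - (y - G.lo w k) / (G.hi w k - G.lo w k)
      = (x - y) / (G.hi w k - G.lo w k) := by ring
  rw [e, abs_div, abs_of_pos hM]
  have h1 : |x - y| / (G.hi w k - G.lo w k) ≤ (|x - y| / G.L w) / G.c := by
    rw [div_div]
    exact div_le_div_of_nonneg_left (abs_nonneg _) (by positivity) (by linarith)
  have h2 : |x - y| / G.L w ≤ (|x - y| / G.L w) ^ ε :=
    Real.self_le_rpow_of_le_one (by positivity) (by rwa [div_le_one hL]) G.ε_le
  rw [Real.div_rpow (abs_nonneg _) hL.le] at h2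
  have hA := G.A_pos
  have hLe : 0 < G.L w ^ ε := Real.rpow_pos_of_pos hL _
  calc 8 * (G.A * G.L w ^ ε) * G.N * (|x - y| / (G.hi w k - G.lo w k))
      ≤ 8 * (G.A * G.L w ^ ε) * G.N * ((|x - y| ^ ε / G.L w ^ ε) / G.c) := by
        apply mul_le_mul_of_nonneg_left _ (by positivity)
        exact h1.trans (div_le_div_of_nonneg_right h2 hc.le)
    _ = _ := by field_simp

lemma gapDeriv_lo (w : List (Fin d)) (k : Fin (d - 1)) :
    G.gapDeriv i w k (G.lo w k) = G.cantorDeriv i (G.lo w k) := by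
  unfold gapDeriv
  rw [sub_self, zero_div, bridge_zero G.three_le_N]

lemma gapDeriv_hi (w : List (Fin d)) (k : Fin (d - 1)) :
    G.gapDeriv i w k (G.hi w k) = G.cantorDeriv i (G.hi w k) := by
  unfold gapDeriv
  rw [div_self (by linarith [G.lo_lt_hi w k]), bridge_one G.three_le_N]

lemma integral_gapDeriv (w : List (Fin d)) (k : Fin (d - 1)) :
    ∫ x in (G.lo w k)..(G.hi w k), G.gapDeriv i w k x
      = G.hi (w ++ [i]) k - G.lo (w ++ [i]) k := by
  have h := G.lo_lt_hi w k
  have h' : G.hi w k - G.lo w k ≠ 0 := by linarith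
  unfold gapDeriv
  rw [integral_bridge_comp G.three_le_N h, gapRatio, div_mul_cancel₀ _ h']

variable (i)

open Classical in
/-- The derivative of the `i`-th branch. -/
def branchDeriv (x : ℝ) : ℝ :=
  if h : ∃ p : List (Fin d) × Fin (d - 1), x ∈ Ioo (G.lo p.1 p.2) (G.hi p.1 p.2) then
    G.gapDeriv i h.choose.1 h.choose.2 x
  else G.cantorDeriv i x

variable {i}

lemma branchDeriv_of_gap {w : List (Fin d)} {k : Fin (d - 1)} {x : ℝ}
    (hx : x ∈ Ioo (G.lo w k) (G.hi w k)) : G.branchDeriv i x = G.gapDeriv i w k x := by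
  have h : ∃ p : List (Fin d) × Fin (d - 1), x ∈ Ioo (G.lo p.1 p.2) (G.hi p.1 p.2) :=
    ⟨(w, k), hx⟩
  obtain ⟨e1, e2⟩ := G.gap_unique h.choose_spec hx
  rw [branchDeriv, dif_pos h, e1, e2]

lemma branchDeriv_of_not_gap {x : ℝ}
    (hx : ∀ w k, x ∉ Ioo (G.lo w k) (G.hi w k)) : G.branchDeriv i x = G.cantorDeriv i x := by
  rw [branchDeriv, dif_neg]
  rintro ⟨p, hp⟩
  exact hx _ _ hp

lemma branchDeriv_of_gap_closed {w : List (Fin d)} {k : Fin (d - 1)} {x : ℝ}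
    (hx : x ∈ Icc (G.lo w k) (G.hi w k)) : G.branchDeriv i x = G.gapDeriv i w k x := by
  rcases hx.1.eq_or_lt with h1 | h1
  · rw [← h1, gapDeriv_lo]
    exact G.branchDeriv_of_not_gap fun _ _ => G.endpoint_not_mem_gap (Or.inr rfl)
  rcases hx.2.eq_or_lt with h2 | h2
  · rw [h2, gapDeriv_hi]
    exact G.branchDeriv_of_not_gap fun _ _ => G.endpoint_not_mem_gap (Or.inl rfl)
  exact G.branchDeriv_of_gap ⟨h1, h2⟩

lemma branchDeriv_mem {x : ℝ} (hx : x ∈ I01) : G.branchDeriv i x ∈ Ioo (0:ℝ) 1 := by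
  by_cases h : ∃ w k, x ∈ Ioo (G.lo w k) (G.hi w k)
  · obtain ⟨w, k, h⟩ := h
    rw [G.branchDeriv_of_gap h]
    exact G.gapDeriv_mem (Ioo_subset_Icc_self h)
  · push Not at h
    rw [G.branchDeriv_of_not_gap h]
    rw [← G.interval_nil] at hx
    have h1 := G.cantorDeriv_mem i hx
    exact ⟨G.b_pos.trans_le h1.1, h1.2.trans_lt G.θ_lt⟩

lemma branchDeriv_sub_ratio_le {w : List (Fin d)} {x : ℝ} (hx : x ∈ G.interval w) :
    |G.branchDeriv i x - G.ratio i w| ≤ 8 * G.A * G.L w ^ ε := by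
  have hA := G.A_pos
  have hL := Real.rpow_pos_of_pos (G.L_pos w) ε
  have hAL := mul_pos hA hL
  by_cases h : ∃ w k, x ∈ Ioo (G.lo w k) (G.hi w k)
  · obtain ⟨w', k, h⟩ := h
    rw [G.branchDeriv_of_gap h]
    obtain ⟨v, rfl⟩ := G.suffix_of_mem_gap hx h
    have h1 := G.gapDeriv_sub_le (i := i) (Ioo_subset_Icc_self h)
    have h2 := G.ratio_append_sub_le i v w
    have h3 := abs_sub_le (G.gapDeriv i (v ++ w) k x) (G.ratio i (v ++ w)) (G.ratio i w)
    have h4 : G.L (v ++ w) ^ ε ≤ G.L w ^ ε :=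
      Real.rpow_le_rpow (G.L_pos _).le (G.L_append_le v w) G.ε_pos.le
    have h5 := mul_le_mul_of_nonneg_left h4 hA.le
    linarith
  · push Not at h
    rw [G.branchDeriv_of_not_gap h]
    have := G.cantorDeriv_sub_le i hx
    linarith

lemma branchDeriv_osc {w : List (Fin d)} {x y : ℝ} (hx : x ∈ G.interval w)
    (hy : y ∈ G.interval w) :
    |G.branchDeriv i x - G.branchDeriv i y| ≤ 16 * G.A * G.L w ^ ε := by
  have h1 := G.branchDeriv_sub_ratio_le (i := i) hx
  have h2 := G.branchDeriv_sub_ratio_le (i := i) hy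
  have h3 := abs_sub_le (G.branchDeriv i x) (G.ratio i w) (G.branchDeriv i y)
  rw [abs_sub_comm (G.ratio i w)] at h3
  linarith

/-- Half of the Hölder constant of the derivatives of the branches. -/
def H : ℝ := 16 * G.A / G.c + 8 * G.A * G.N / G.c

lemma le_H₁ : 16 * G.A / G.c ≤ G.H := by
  have := G.A_pos
  have := G.c_pos
  have : 0 ≤ 8 * G.A * G.N / G.c := by positivity
  unfold H; linarith

lemma le_H₂ : 8 * G.A * G.N / G.c ≤ G.H := by
  have := G.A_pos
  have := G.c_pos
  have : 0 ≤ 16 * G.A / G.c := by positivity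
  unfold H; linarith

lemma H_pos : 0 < G.H := by
  have := G.A_pos
  have := G.c_pos
  have : 0 < 16 * G.A / G.c := by positivity
  linarith [G.le_H₁]

lemma branchDeriv_far {w : List (Fin d)} {x y : ℝ} (hx : x ∈ G.interval w)
    (hy : y ∈ G.interval w) (hxy : G.c * G.L w ≤ |x - y|) :
    |G.branchDeriv i x - G.branchDeriv i y| ≤ G.H * |x - y| ^ ε := by
  have hc := G.c_pos
  have hA := G.A_pos
  have hL := G.L_pos w
  have h0 := G.branchDeriv_osc (i := i) hx hy
  have h1 : (G.c * G.L w) ^ ε ≤ |x - y| ^ ε :=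
    Real.rpow_le_rpow (by positivity) hxy G.ε_pos.le
  rw [Real.mul_rpow hc.le hL.le] at h1
  have h2 : G.c ≤ G.c ^ ε := Real.self_le_rpow_of_le_one hc.le G.c_lt_one.le G.ε_le
  have h3 : 0 < G.L w ^ ε := Real.rpow_pos_of_pos hL _
  have h4 : G.c * G.L w ^ ε ≤ |x - y| ^ ε := (mul_le_mul_of_nonneg_right h2 h3.le).trans h1
  have h5 : G.L w ^ ε ≤ |x - y| ^ ε / G.c := by
    rw [le_div_iff₀ hc]; linarith
  calc _ ≤ 16 * G.A * G.L w ^ ε := h0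
    _ ≤ 16 * G.A * (|x - y| ^ ε / G.c) := mul_le_mul_of_nonneg_left h5 (by positivity)
    _ = 16 * G.A / G.c * |x - y| ^ ε := by ring
    _ ≤ _ := mul_le_mul_of_nonneg_right G.le_H₁ (Real.rpow_nonneg (abs_nonneg _) _)

lemma branchDeriv_gap_holder {w : List (Fin d)} {k : Fin (d - 1)} {x y : ℝ}
    (hx : x ∈ Icc (G.lo w k) (G.hi w k)) (hy : y ∈ Icc (G.lo w k) (G.hi w k)) :
    |G.branchDeriv i x - G.branchDeriv i y| ≤ G.H * |x - y| ^ ε := by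
  rw [G.branchDeriv_of_gap_closed hx, G.branchDeriv_of_gap_closed hy]
  exact (G.gapDeriv_lipschitz hx hy).trans
    (mul_le_mul_of_nonneg_right G.le_H₂ (Real.rpow_nonneg (abs_nonneg _) _))

lemma exists_maximal_word {x y : ℝ} (w₀ : List (Fin d)) (hxy : x ≠ y) (P : List (Fin d) → Prop)
    (hP : ∀ w, P w → x ∈ G.interval w ∧ y ∈ G.interval w) (h₀ : P w₀) :
    ∃ w, P w ∧ ∀ j, ¬ P (j :: w) := by
  by_contra! h
  obtain ⟨n, hn⟩ := G.exists_pow_lt (abs_pos.mpr (sub_ne_zero.mpr hxy))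
  have key : ∀ m : ℕ, ∃ w, P w ∧ m ≤ w.length := by
    intro m
    induction m with
    | zero => exact ⟨w₀, h₀, Nat.zero_le _⟩
    | succ m ih =>
      obtain ⟨w, hw, hm⟩ := ih
      obtain ⟨j, hj⟩ := h w hw
      exact ⟨j :: w, hj, by simpa using hm⟩
  obtain ⟨w, hw, hlen⟩ := key n
  have h1 := hn w hlen
  have h2 := G.abs_sub_le_L (hP w hw).1 (hP w hw).2
  linarith

lemma branchDeriv_holder_left {w : List (Fin d)} {x : ℝ} (hx : x ∈ G.interval w) :
    |G.branchDeriv i x - G.branchDeriv i (G.a w)| ≤ G.H * |x - G.a w| ^ ε := by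
  by_cases hxa : x = G.a w
  · subst hxa
    simpa using mul_nonneg G.H_pos.le (Real.rpow_nonneg le_rfl _)
  obtain ⟨w', ⟨h1, h2⟩, h3⟩ := G.exists_maximal_word w hxa
    (fun w' => x ∈ G.interval w' ∧ G.a w' = G.a w)
    (fun w' h => ⟨h.1, h.2 ▸ G.a_mem w'⟩) ⟨hx, rfl⟩
  have hd := G.two_le
  have h4 := h3 ⟨0, by omega⟩
  rw [G.a_first, not_and'] at h4
  have h5 := h4 h2
  have h6 : G.right (⟨0, by omega⟩ :: w') < x := by
    by_contra! h
    exact h5 ⟨by rw [G.a_first]; exact h1.1, h⟩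
  have e : G.right (⟨0, by omega⟩ :: w') = G.a w' + G.L (⟨0, by omega⟩ :: w') := by
    rw [right, G.a_first]
  rw [← h2]
  apply G.branchDeriv_far h1 (G.a_mem w')
  have := G.le_child w' ⟨0, by omega⟩
  exact le_trans (by linarith) (le_abs_self _)

lemma branchDeriv_holder_right {w : List (Fin d)} {x : ℝ} (hx : x ∈ G.interval w) :
    |G.branchDeriv i x - G.branchDeriv i (G.right w)| ≤ G.H * |x - G.right w| ^ ε := by
  by_cases hxa : x = G.right w
  · subst hxa
    simpa using mul_nonneg G.H_pos.le (Real.rpow_nonneg le_rfl _)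
  obtain ⟨w', ⟨h1, h2⟩, h3⟩ := G.exists_maximal_word w hxa
    (fun w' => x ∈ G.interval w' ∧ G.right w' = G.right w)
    (fun w' h => ⟨h.1, h.2 ▸ G.right_mem w'⟩) ⟨hx, rfl⟩
  have hd := G.two_le
  have hl : G.right (⟨d - 1, by omega⟩ :: w') = G.right w' := G.right_last w'
  have h4 := h3 ⟨d - 1, by omega⟩
  rw [hl, not_and'] at h4
  have h5 := h4 h2
  have h6 : x < G.a (⟨d - 1, by omega⟩ :: w') := by
    by_contra! h
    exact h5 ⟨h, by rw [hl]; exact h1.2⟩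
  have e : G.right w' = G.a (⟨d - 1, by omega⟩ :: w') + G.L (⟨d - 1, by omega⟩ :: w') := by
    rw [← hl, right]
  rw [← h2]
  apply G.branchDeriv_far h1 (G.right_mem w')
  have := G.le_child w' ⟨d - 1, by omega⟩
  rw [abs_sub_comm]
  exact le_trans (by linarith) (le_abs_self _)

lemma holder_trans {x e y : ℝ} (hxe : x ≤ e) (hey : e ≤ y)
    (h1 : |G.branchDeriv i x - G.branchDeriv i e| ≤ G.H * |x - e| ^ ε)
    (h2 : |G.branchDeriv i e - G.branchDeriv i y| ≤ G.H * |e - y| ^ ε) :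
    |G.branchDeriv i x - G.branchDeriv i y| ≤ 2 * G.H * |x - y| ^ ε := by
  have hH := G.H_pos
  have e1 : |x - e| ≤ |x - y| := by
    rw [abs_of_nonpos (by linarith), abs_of_nonpos (by linarith)]; linarith
  have e2 : |e - y| ≤ |x - y| := by
    rw [abs_of_nonpos (by linarith), abs_of_nonpos (by linarith)]; linarith
  have f1 := mul_le_mul_of_nonneg_left
    (Real.rpow_le_rpow (abs_nonneg _) e1 G.ε_pos.le) hH.le
  have f2 := mul_le_mul_of_nonneg_left
    (Real.rpow_le_rpow (abs_nonneg _) e2 G.ε_pos.le) hH.le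
  have := abs_sub_le (G.branchDeriv i x) (G.branchDeriv i e) (G.branchDeriv i y)
  linarith

lemma branchDeriv_holder_of_lt {x y : ℝ} (hx : x ∈ I01) (hy : y ∈ I01) (hxy : x < y) :
    |G.branchDeriv i x - G.branchDeriv i y| ≤ 2 * G.H * |x - y| ^ ε := by
  have hH := G.H_pos
  have hp : 0 ≤ |x - y| ^ ε := Real.rpow_nonneg (abs_nonneg _) _
  rw [← G.interval_nil] at hx hy
  obtain ⟨w, ⟨hx, hy⟩, hmax⟩ := G.exists_maximal_word [] hxy.ne
    (fun w => x ∈ G.interval w ∧ y ∈ G.interval w) (fun _ h => h) ⟨hx, hy⟩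
  have weaken : ∀ {z : ℝ}, z ≤ G.H * |x - y| ^ ε → z ≤ 2 * G.H * |x - y| ^ ε := by
    intro z hz
    nlinarith [mul_nonneg hH.le hp]
  have hab : |x - y| = y - x := by rw [abs_of_neg (by linarith)]; ring
  rcases G.mem_child_or_gap hx with ⟨j, hj⟩ | ⟨k, hk⟩
  · have hyj : G.right (j :: w) < y := by
      by_contra! h
      exact hmax j ⟨hj, hj.1.trans hxy.le, h⟩
    by_cases hjd : (j : ℕ) < d - 1
    · have ej : G.lo w ⟨j, hjd⟩ = G.right (j :: w) := rfl
      rcases le_or_gt y (G.hi w ⟨j, hjd⟩) with hyh | hyh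
      · refine G.holder_trans hj.2 hyj.le (G.branchDeriv_holder_right hj) ?_
        rw [← ej]
        exact G.branchDeriv_gap_holder (k := ⟨j, hjd⟩)
          ⟨le_rfl, (G.lo_lt_hi _ _).le⟩ ⟨ej ▸ hyj.le, hyh⟩
      · apply weaken
        apply G.branchDeriv_far hx hy
        have := G.le_hi_sub_lo w ⟨j, hjd⟩
        rw [hab]
        linarith [hj.2]
    · exfalso
      have : j = ⟨d - 1, by omega⟩ := Fin.ext (by simp; omega)
      have hl : G.right (⟨d - 1, by omega⟩ :: w) = G.right w := G.right_last w
      rw [this, hl] at hyj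
      exact absurd hy.2 (not_le.mpr hyj)
  · rcases le_or_gt y (G.hi w k) with hyh | hyh
    · apply weaken
      exact G.branchDeriv_gap_holder (Ioo_subset_Icc_self hk) ⟨(hk.1.trans hxy).le, hyh⟩
    · rcases le_or_gt y (G.right (⟨k + 1, by omega⟩ :: w)) with hyr | hyr
      · refine G.holder_trans (e := G.hi w k) hk.2.le hyh.le
          (G.branchDeriv_gap_holder (Ioo_subset_Icc_self hk) ⟨(G.lo_lt_hi _ _).le, le_rfl⟩) ?_
        rw [abs_sub_comm, abs_sub_comm (G.hi w k)]
        exact G.branchDeriv_holder_left ⟨hyh.le, hyr⟩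
      · apply weaken
        apply G.branchDeriv_far hx hy
        have := G.le_child w ⟨k + 1, by omega⟩
        have e : G.right (⟨k + 1, by omega⟩ :: w) = G.hi w k + G.L (⟨k + 1, by omega⟩ :: w) :=
          rfl
        rw [hab]
        linarith [hk.2]

lemma branchDeriv_holder : HolderBoundOn01 ε (2 * G.H) (G.branchDeriv i) := by
  intro x hx y hy
  rcases lt_trichotomy x y with h | h | h
  · exact G.branchDeriv_holder_of_lt hx hy h
  · subst h
    simpa using mul_nonneg (by linarith [G.H_pos]) (Real.rpow_nonneg le_rfl _)
  · rw [abs_sub_comm, abs_sub_comm x]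
    exact G.branchDeriv_holder_of_lt hy hx h

variable (i)

/-- The derivative of the `i`-th branch, extended to the line by constants. -/
def extDeriv (x : ℝ) : ℝ := G.branchDeriv i (projIcc 0 1 zero_le_one x)

variable {i}

lemma extDeriv_of_mem {x : ℝ} (hx : x ∈ I01) : G.extDeriv i x = G.branchDeriv i x := by
  rw [extDeriv, projIcc_of_mem zero_le_one hx]

lemma extDeriv_mem (x : ℝ) : G.extDeriv i x ∈ Ioo (0:ℝ) 1 :=
  G.branchDeriv_mem (projIcc 0 1 zero_le_one x).2

lemma continuous_extDeriv : Continuous (G.extDeriv i) := by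
  rw [continuous_iff_continuousAt]
  intro x
  have hp : ∀ y : ℝ, ((projIcc (0:ℝ) 1 zero_le_one y : Icc (0:ℝ) 1) : ℝ) ∈ I01 :=
    fun y => (projIcc 0 1 zero_le_one y).2
  have h : ∀ y, |G.extDeriv i y - G.extDeriv i x| ≤
      2 * G.H * |(projIcc (0:ℝ) 1 zero_le_one y : ℝ) - projIcc (0:ℝ) 1 zero_le_one x| ^ ε :=
    fun y => G.branchDeriv_holder _ (hp y) _ (hp x)
  have hc : Continuous fun y : ℝ =>
      2 * G.H * |(projIcc (0:ℝ) 1 zero_le_one y : ℝ) - projIcc 0 1 zero_le_one x| ^ ε := by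
    have : Continuous fun y : ℝ => (projIcc (0:ℝ) 1 zero_le_one y : ℝ) :=
      continuous_subtype_val.comp continuous_projIcc
    refine continuous_const.mul (Continuous.rpow_const (this.sub continuous_const).abs ?_)
    exact fun _ => Or.inr G.ε_pos.le
  have h0 := hc.tendsto x
  rw [sub_self, abs_zero, Real.zero_rpow G.ε_pos.ne', mul_zero] at h0
  rw [ContinuousAt, tendsto_iff_dist_tendsto_zero]
  exact squeeze_zero (fun _ => dist_nonneg) h h0

lemma intervalIntegrable_extDeriv (x y : ℝ) :
    IntervalIntegrable (G.extDeriv i) MeasureTheory.volume x y :=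
  G.continuous_extDeriv.intervalIntegrable x y

variable (i)

/-- The `i`-th branch of the Cantor system realizing the geometry `G`. -/
def branch (x : ℝ) : ℝ := G.a [i] + ∫ t in (0:ℝ)..x, G.extDeriv i t

variable {i}

lemma branch_sub (x y : ℝ) : G.branch i y - G.branch i x = ∫ t in x..y, G.extDeriv i t := by
  unfold branch
  rw [← intervalIntegral.integral_interval_sub_left (G.intervalIntegrable_extDeriv 0 y)
    (G.intervalIntegrable_extDeriv 0 x)]
  ring

lemma hasDerivAt_branch (x : ℝ) : HasDerivAt (G.branch i) (G.extDeriv i x) x :=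
  (intervalIntegral.integral_hasDerivAt_right (G.intervalIntegrable_extDeriv 0 x)
    (G.continuous_extDeriv.stronglyMeasurableAtFilter _ _)
    G.continuous_extDeriv.continuousAt).const_add _

lemma branch_sub_mem {x y : ℝ} (hxy : x ≤ y) : G.branch i y - G.branch i x ∈ Icc 0 (y - x) := by
  rw [branch_sub]
  constructor
  · exact intervalIntegral.integral_nonneg hxy fun t _ => (G.extDeriv_mem t).1.le
  · have := intervalIntegral.integral_mono_on hxy (G.intervalIntegrable_extDeriv (i := i) x y)
      (intervalIntegrable_const (c := (1:ℝ))) fun t _ => (G.extDeriv_mem t).2.le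
    simpa using this

lemma branch_gap (w : List (Fin d)) (k : Fin (d - 1)) :
    G.branch i (G.hi w k) - G.branch i (G.lo w k) = G.hi (w ++ [i]) k - G.lo (w ++ [i]) k := by
  rw [branch_sub, ← G.integral_gapDeriv]
  apply intervalIntegral.integral_congr
  intro x hx
  rw [uIcc_of_le (G.lo_lt_hi w k).le] at hx
  have hx' : x ∈ I01 := G.interval_subset w (G.gap_subset w k hx)
  change G.extDeriv i x = _
  rw [G.extDeriv_of_mem hx', G.branchDeriv_of_gap_closed hx]

lemma L_append_singleton_le (w : List (Fin d)) : G.L (w ++ [i]) ≤ G.L w := by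
  have h := G.ratio_le w i
  rw [div_le_iff₀ (G.L_pos w)] at h
  nlinarith [G.L_pos w, G.θ_lt]

/-- The error of the branch on `I_w` decays geometrically in the number of levels used. -/
lemma branch_error_le (n : ℕ) (w : List (Fin d)) :
    |(G.branch i (G.right w) - G.branch i (G.a w)) - G.L (w ++ [i])| ≤
      (1 - G.c) ^ n * G.L w := by
  have hd := G.two_le
  have hc1 : 0 < 1 - G.c := by linarith [G.c_lt_one]
  induction n generalizing w with
  | zero =>
    have h1 := G.branch_sub_mem (i := i) (G.a_lt_right w).le
    have h2 := G.L_pos (w ++ [i])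
    have h3 := G.L_append_singleton_le (i := i) w
    have h4 : G.right w - G.a w = G.L w := by unfold right; ring
    rw [h4] at h1
    rw [pow_zero, one_mul, abs_le]
    constructor <;> linarith [h1.1, h1.2]
  | succ n ih =>
    have key : ∀ (k : ℕ) (hk : k < d),
        |(G.branch i (G.right (⟨k, hk⟩ :: w)) - G.branch i (G.a w)) -
          (G.right (⟨k, hk⟩ :: (w ++ [i])) - G.a (w ++ [i]))| ≤
        (1 - G.c) ^ n * (G.right (⟨k, hk⟩ :: w) - G.a w - k * (G.c * G.L w)) := by
      intro k
      induction k with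
      | zero =>
        intro hk
        have h := ih (⟨0, hk⟩ :: w)
        rw [List.cons_append] at h
        have e1 : G.right (⟨0, hk⟩ :: (w ++ [i])) - G.a (w ++ [i])
            = G.L (⟨0, hk⟩ :: (w ++ [i])) := by
          rw [right, G.a_first]; ring
        have e2 : G.right (⟨0, hk⟩ :: w) - G.a w = G.L (⟨0, hk⟩ :: w) := by
          rw [right, G.a_first]; ring
        rw [G.a_first] at h
        rw [e1, e2]
        simpa using h
      | succ k ihk =>
        intro hk
        have h1 := ihk (by omega)
        have h2 := ih (⟨k + 1, hk⟩ :: w)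
        rw [List.cons_append] at h2
        have h3 : G.branch i (G.a (⟨k + 1, hk⟩ :: w)) - G.branch i (G.right (⟨k, by omega⟩ :: w))
            = G.a (⟨k + 1, hk⟩ :: (w ++ [i])) - G.right (⟨k, by omega⟩ :: (w ++ [i])) :=
          G.branch_gap w ⟨k, by omega⟩
        have h4 : G.c * G.L w ≤ G.a (⟨k + 1, hk⟩ :: w) - G.right (⟨k, by omega⟩ :: w) :=
          G.le_hi_sub_lo w ⟨k, by omega⟩
        have e1 : G.right (⟨k + 1, hk⟩ :: (w ++ [i])) = G.a (⟨k + 1, hk⟩ :: (w ++ [i]))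
          + G.L (⟨k + 1, hk⟩ :: (w ++ [i])) := rfl
        have e2 : G.right (⟨k + 1, hk⟩ :: w) = G.a (⟨k + 1, hk⟩ :: w)
          + G.L (⟨k + 1, hk⟩ :: w) := rfl
        have h5 := mul_le_mul_of_nonneg_left h4 (pow_pos hc1 n).le
        rw [e2] at h2
        rw [e1, e2]
        generalize (1 - G.c) ^ n = t at *
        rw [abs_le] at *
        push_cast
        constructor <;> linarith [h1.1, h1.2, h2.1, h2.2]
    have h := key (d - 1) (by omega)
    have r1 : G.right (⟨d - 1, by omega⟩ :: w) = G.right w := G.right_last w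
    have r2 : G.right (⟨d - 1, by omega⟩ :: (w ++ [i])) = G.right (w ++ [i]) :=
      G.right_last (w ++ [i])
    have e1 : G.right w - G.a w = G.L w := by unfold right; ring
    have e2 : G.right (w ++ [i]) - G.a (w ++ [i]) = G.L (w ++ [i]) := by unfold right; ring
    rw [r1, r2, e1, e2] at h
    refine h.trans ?_
    have h1 : (1:ℝ) ≤ ((d - 1 : ℕ) : ℝ) := by
      exact_mod_cast (show 1 ≤ d - 1 by omega)
    have h2 := mul_pos G.c_pos (G.L_pos w)
    rw [pow_succ, mul_assoc]
    apply mul_le_mul_of_nonneg_left _ (pow_pos hc1 n).le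
    nlinarith

lemma branch_right_sub (w : List (Fin d)) :
    G.branch i (G.right w) - G.branch i (G.a w) = G.L (w ++ [i]) := by
  have h : Tendsto (fun n : ℕ => (1 - G.c) ^ n * G.L w) atTop (nhds (0 * G.L w)) :=
    (tendsto_pow_atTop_nhds_zero_of_lt_one (by linarith [G.c_lt_one])
      (by linarith [G.c_pos])).mul_const _
  rw [zero_mul] at h
  have := ge_of_tendsto' h fun n => G.branch_error_le (i := i) n w
  exact sub_eq_zero.mp (abs_nonpos_iff.mp this)

lemma branch_a (w : List (Fin d)) : G.branch i (G.a w) = G.a (w ++ [i]) := by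
  have hd := G.two_le
  induction w with
  | nil => simp [branch, G.a_nil]
  | cons j w ih =>
    obtain ⟨k, hk⟩ := j
    induction k with
    | zero => rw [List.cons_append, G.a_first, G.a_first, ih]
    | succ k ihk =>
      have h1 := ihk (by omega)
      have h2 := G.branch_right_sub (i := i) (⟨k, by omega⟩ :: w)
      have h3 : G.branch i (G.a (⟨k + 1, hk⟩ :: w)) - G.branch i (G.right (⟨k, by omega⟩ :: w))
          = G.a (⟨k + 1, hk⟩ :: (w ++ [i])) -
            (G.a (⟨k, by omega⟩ :: (w ++ [i])) + G.L (⟨k, by omega⟩ :: (w ++ [i]))) :=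
        G.branch_gap w ⟨k, by omega⟩
      simp only [List.cons_append] at *
      linarith

lemma branch_right (w : List (Fin d)) : G.branch i (G.right w) = G.right (w ++ [i]) := by
  have h1 := G.branch_right_sub (i := i) w
  have h2 := G.branch_a (i := i) w
  unfold right at *
  linarith

lemma branch_zero (i : Fin d) : G.branch i 0 = G.a [i] := by
  simp [branch]

lemma branch_one (i : Fin d) : G.branch i 1 = G.right [i] := by
  have h := G.branch_right (i := i) []
  have e : G.right [] = 1 := by simp [right, G.a_nil, G.L_nil]
  rwa [e] at h

lemma wordMap_a (w v : List (Fin d)) : wordMap G.branch w (G.a v) = G.a (v ++ w) := by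
  induction w generalizing v with
  | nil => simp [wordMap]
  | cons i w ih =>
    change wordMap G.branch w (G.branch i (G.a v)) = _
    rw [branch_a, ih]
    simp

lemma wordMap_right (w v : List (Fin d)) :
    wordMap G.branch w (G.right v) = G.right (v ++ w) := by
  induction w generalizing v with
  | nil => simp [wordMap]
  | cons i w ih =>
    change wordMap G.branch w (G.branch i (G.right v)) = _
    rw [branch_right, ih]
    simp

lemma wordLen_branch (w : List (Fin d)) : wordLen G.branch w = G.L w := by
  have e : G.right [] = 1 := by simp [right, G.a_nil, G.L_nil]
  have h1 := G.wordMap_a w []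
  have h2 := G.wordMap_right w []
  rw [G.a_nil] at h1
  rw [e] at h2
  rw [wordLen, h1, h2, right]
  simp

lemma derivWithin_branch {x : ℝ} (hx : x ∈ I01) :
    derivWithin (G.branch i) I01 x = G.branchDeriv i x := by
  rw [(G.hasDerivAt_branch x).hasDerivWithinAt.derivWithin
    (uniqueDiffOn_Icc zero_lt_one x hx), G.extDeriv_of_mem hx]

lemma isCantorSystem_branch : IsCantorSystem 1 ε G.branch where
  maps i x hx := by
    have h1 := (G.branch_sub_mem (i := i) hx.1).1
    have h2 := (G.branch_sub_mem (i := i) hx.2).1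
    have h3 := (G.interval_subset [i] (G.a_mem [i])).1
    have h4 := (G.interval_subset [i] (G.right_mem [i])).2
    rw [G.branch_zero] at h1
    rw [G.branch_one] at h2
    exact ⟨by linarith, by linarith⟩
  smooth i := by
    have h : deriv (G.branch i) = G.extDeriv i := funext fun x => (G.hasDerivAt_branch x).deriv
    refine ContDiff.contDiffOn ?_
    rw [Nat.cast_one, contDiff_one_iff_deriv, h]
    exact ⟨fun x => (G.hasDerivAt_branch x).differentiableAt, G.continuous_extDeriv⟩
  holder i := by
    refine ⟨2 * G.H, by linarith [G.H_pos], fun x hx y hy => ?_⟩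
    rw [iteratedDerivWithin_one, G.derivWithin_branch hx, G.derivWithin_branch hy]
    exact G.branchDeriv_holder x hx y hy
  deriv_pos i x hx := by
    rw [G.derivWithin_branch hx]
    exact (G.branchDeriv_mem hx).1
  deriv_lt_one i x hx := by
    rw [G.derivWithin_branch hx]
    exact (G.branchDeriv_mem hx).2
  ordered i j hij := by
    rw [G.branch_one, G.branch_zero]
    exact G.right_lt_a [] hij
  first i hi := by
    have : i = ⟨0, by omega⟩ := Fin.ext hi
    rw [G.branch_zero, this, G.a_first, G.a_nil]
  last i hi := by
    have : i = ⟨d - 1, by omega⟩ := Fin.ext hi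
    rw [G.branch_one, this, right, G.right_last, G.a_nil, G.L_nil, zero_add]

end CantorGeometry

section Words

variable {d : ℕ}

/-- The concatenation of a finite word and a sequence. -/
def appendSeq : List (Fin d) → (ℕ → Fin d) → ℕ → Fin d
  | [], η => η
  | i :: w, η => consSeq i (appendSeq w η)

lemma appendSeq_append (v w : List (Fin d)) (η : ℕ → Fin d) :
    appendSeq (v ++ w) η = appendSeq v (appendSeq w η) := by
  induction v with
  | nil => rfl
  | cons i v ih => rw [List.cons_append, appendSeq, ih, appendSeq]

lemma appendSeq_concat (w : List (Fin d)) (i : Fin d) (η : ℕ → Fin d) :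
    appendSeq (w ++ [i]) η = appendSeq w (consSeq i η) :=
  appendSeq_append w [i] η

lemma appendSeq_apply_of_lt (w : List (Fin d)) (η η' : ℕ → Fin d) {m : ℕ} (h : m < w.length) :
    appendSeq w η m = appendSeq w η' m := by
  induction w generalizing m with
  | nil => simp at h
  | cons i w ih =>
    cases m with
    | zero => simp [appendSeq, consSeq]
    | succ m => simpa [appendSeq, consSeq] using ih (by simpa using h)

lemma dword_succ (j : ℕ → Fin d) (n : ℕ) :
    dword j (n + 1) = j 0 :: dword (fun m => j (m + 1)) n := by
  simp [dword, List.ofFn_succ]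

lemma length_dword (j : ℕ → Fin d) (n : ℕ) : (dword j n).length = n := by
  simp [dword]

lemma appendSeq_dword (j : ℕ → Fin d) (n : ℕ) (η : ℕ → Fin d) :
    appendSeq (dword j n) η = fun m => if m < n then j m else η (m - n) := by
  induction n generalizing j with
  | zero => simp [dword, appendSeq]
  | succ n ih =>
    rw [dword_succ, appendSeq, ih]
    funext m
    cases m with
    | zero => simp [consSeq]
    | succ m => simp [consSeq]

lemma appendSeq_dword_tail (j : ℕ → Fin d) (n : ℕ) :
    appendSeq (dword j n) (fun m => j (n + m)) = j := by
  rw [appendSeq_dword]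
  funext m
  split_ifs with h
  · rfl
  · exact congrArg j (by omega)

lemma dword_appendSeq (w : List (Fin d)) (η : ℕ → Fin d) (n : ℕ) :
    dword (appendSeq w η) (w.length + n) = w ++ dword η n := by
  induction w with
  | nil => simp [appendSeq]
  | cons i w ih =>
    rw [List.length_cons, Nat.add_right_comm, dword_succ, List.cons_append, ← ih]
    simp [appendSeq, consSeq]

/-- The coordinate of a scaling vector belonging to the `i`-th child. -/
def childIndex (i : Fin d) : Fin (2 * d - 1) := ⟨i, by omega⟩

/-- The coordinate of a scaling vector belonging to the `k`-th gap. -/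
def gapIndex (k : Fin (d - 1)) : Fin (2 * d - 1) := ⟨d + k, by omega⟩

lemma childLeft_eq_sum_range (s : Fin (2 * d - 1) → ℝ) (i : Fin d) :
    childLeft s i = ∑ n ∈ Finset.range i,
      ((if h : n < 2 * d - 1 then s ⟨n, h⟩ else 0) +
        if h : d + n < 2 * d - 1 then s ⟨d + n, h⟩ else 0) := by
  rw [childLeft, ← Finset.sum_attach (Finset.range i)]
  refine Finset.sum_congr rfl fun m _ => ?_
  have h := Finset.mem_range.mp m.2
  rw [dif_pos (by omega), dif_pos (by omega)]

lemma childLeft_zero (s : Fin (2 * d - 1) → ℝ) (h : 0 < d) : childLeft s ⟨0, h⟩ = 0 := by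
  simp [childLeft]

lemma childLeft_succ (s : Fin (2 * d - 1) → ℝ) (k : Fin (d - 1)) :
    childLeft s ⟨k + 1, by omega⟩ =
      childLeft s ⟨k, by omega⟩ + s (childIndex ⟨k, by omega⟩) + s (gapIndex k) := by
  rw [childLeft_eq_sum_range, childLeft_eq_sum_range, Finset.sum_range_succ,
    dif_pos (by omega), dif_pos (by omega), add_assoc]
  rfl

lemma sum_eq_sum_child_add_sum_gap (s : Fin (2 * d - 1) → ℝ) :
    ∑ m, s m = ∑ i, s (childIndex i) + ∑ k, s (gapIndex k) := by
  have h : d + (d - 1) = 2 * d - 1 := by omega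
  rw [← (finCongr h).sum_comp, Fin.sum_univ_add]
  rfl

lemma childLeft_last_add (s : Fin (2 * d - 1) → ℝ) (h : 0 < d) :
    childLeft s ⟨d - 1, by omega⟩ + s (childIndex ⟨d - 1, by omega⟩) = ∑ m, s m := by
  set f : ℕ → ℝ := fun n => if h : n < 2 * d - 1 then s ⟨n, h⟩ else 0 with hf
  have e1 : ∑ m, s m = ∑ n ∈ Finset.range (2 * d - 1), f n := by
    rw [Finset.sum_range]
    exact Finset.sum_congr rfl fun m _ => by simp [hf]
  have e2 : s (childIndex ⟨d - 1, by omega⟩) = f (d - 1) := by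
    simp only [hf]
    rw [dif_pos (by omega)]
    rfl
  have e3 : 2 * d - 1 = (d - 1 + 1) + (d - 1) := by omega
  have e4 : d - 1 + 1 = d := by omega
  rw [congrArg Finset.range e3, Finset.sum_range_add, Finset.sum_range_succ, e4] at e1
  rw [childLeft_eq_sum_range, e1, e2, Finset.sum_add_distrib]
  simp only [hf]
  ring

end Words

/-- A continuous map `S` on sequences with values in the simplex, which is Hölder with respect to
the distance `rhoS S`. -/
structure HolderScaling (d : ℕ) (ε : ℝ) where
  S : (ℕ → Fin d) → Fin (2 * d - 1) → ℝ
  K : ℝ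
  two_le : 2 ≤ d
  ε_pos : 0 < ε
  ε_le : ε ≤ 1
  mem_simp : ∀ j, S j ∈ Simp d
  continuous_S : Continuous S
  K_pos : 0 < K
  holder : ∀ j j' : ℕ → Fin d, ∀ p : ℕ, (∀ t < p, j t = j' t) → j p ≠ j' p →
    ∀ m, |S j m - S j' m| ≤ K * rhoS S j p ^ ε

namespace HolderScaling

variable {d : ℕ} {ε : ℝ} (D : HolderScaling d ε)

lemma nonempty_seq (D : HolderScaling d ε) : Nonempty (ℕ → Fin d) :=
  ⟨fun _ => ⟨0, by have := D.two_le; omega⟩⟩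

lemma exists_le_S : ∃ c > 0, ∀ j m, c ≤ D.S j m := by
  have hd := D.two_le
  have := D.nonempty_seq
  have h : ∀ m, ∃ j₀, ∀ j, D.S j₀ m ≤ D.S j m := fun m => by
    obtain ⟨j₀, -, h⟩ := isCompact_univ.exists_isMinOn univ_nonempty
      ((continuous_apply m).comp D.continuous_S).continuousOn
    exact ⟨j₀, fun j => h (mem_univ j)⟩
  choose J hJ using h
  have : Nonempty (Fin (2 * d - 1)) := ⟨⟨0, by omega⟩⟩
  obtain ⟨m₀, hm₀⟩ := Finite.exists_min fun m => D.S (J m) m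
  exact ⟨_, ((D.mem_simp (J m₀)).1 m₀).1, fun j m => (hm₀ m).trans (hJ m j)⟩

/-- A positive lower bound for all the coordinates of `S`. -/
def c : ℝ := D.exists_le_S.choose

lemma c_pos : 0 < D.c := D.exists_le_S.choose_spec.1

lemma c_le (j : ℕ → Fin d) (m : Fin (2 * d - 1)) : D.c ≤ D.S j m :=
  D.exists_le_S.choose_spec.2 j m

lemma S_pos (j : ℕ → Fin d) (m : Fin (2 * d - 1)) : 0 < D.S j m := ((D.mem_simp j).1 m).1

lemma S_lt_one (j : ℕ → Fin d) (m : Fin (2 * d - 1)) : D.S j m < 1 := ((D.mem_simp j).1 m).2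

lemma sum_S (j : ℕ → Fin d) : ∑ m, D.S j m = 1 := (D.mem_simp j).2

lemma S_le (j : ℕ → Fin d) (m : Fin (2 * d - 1)) : D.S j m ≤ 1 - D.c := by
  have hd := D.two_le
  have : Nontrivial (Fin (2 * d - 1)) := Fin.nontrivial_iff_two_le.mpr (by omega)
  obtain ⟨m', hm'⟩ := exists_ne m
  have h := Finset.add_le_sum (fun m _ => (D.S_pos j m).le) (Finset.mem_univ m')
    (Finset.mem_univ m) hm'
  linarith [D.sum_S j, D.c_le j m']

lemma sum_child_le (j : ℕ → Fin d) : ∑ i, D.S j (childIndex i) ≤ 1 - D.c := by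
  have hd := D.two_le
  have h1 := sum_eq_sum_child_add_sum_gap (D.S j)
  have h2 := Finset.single_le_sum (f := fun k => D.S j (gapIndex k))
    (fun k _ => (D.S_pos j _).le) (Finset.mem_univ ⟨0, by omega⟩)
  have h3 := D.c_le j (gapIndex ⟨0, by omega⟩)
  linarith [D.sum_S j]

lemma c_lt_one : D.c < 1 := by
  obtain ⟨j⟩ := D.nonempty_seq
  have hd := D.two_le
  exact (D.c_le j ⟨0, by omega⟩).trans_lt (D.S_lt_one _ _)

/-- The product of the scalings of the successive suffixes of `w` extended by `η`. -/
def P : List (Fin d) → (ℕ → Fin d) → ℝ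
  | [], _ => 1
  | i :: w, η => D.S (appendSeq w η) (childIndex i) * P w η

lemma P_append (v w : List (Fin d)) (η : ℕ → Fin d) :
    D.P (v ++ w) η = D.P v (appendSeq w η) * D.P w η := by
  induction v with
  | nil => simp [P]
  | cons i v ih => rw [List.cons_append, P, P, ih, appendSeq_append, mul_assoc]

lemma P_concat (w : List (Fin d)) (i : Fin d) (η : ℕ → Fin d) :
    D.P (w ++ [i]) η = D.S η (childIndex i) * D.P w (consSeq i η) := by
  rw [P_append]
  simp [P, appendSeq, mul_comm]

lemma P_pos (w : List (Fin d)) (η : ℕ → Fin d) : 0 < D.P w η := by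
  induction w with
  | nil => exact one_pos
  | cons i w ih => exact mul_pos (D.S_pos _ _) ih

lemma P_le_one (w : List (Fin d)) (η : ℕ → Fin d) : D.P w η ≤ 1 := by
  induction w with
  | nil => exact le_rfl
  | cons i w ih => exact mul_le_one₀ (D.S_lt_one _ _).le (D.P_pos _ _).le ih

/-- The supremum of `P w`. -/
def R (w : List (Fin d)) : ℝ := ⨆ η, D.P w η

lemma P_le_R (w : List (Fin d)) (η : ℕ → Fin d) : D.P w η ≤ D.R w :=
  le_ciSup ⟨1, by rintro _ ⟨η, rfl⟩; exact D.P_le_one w η⟩ η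

lemma R_le {w : List (Fin d)} {x : ℝ} (h : ∀ η, D.P w η ≤ x) : D.R w ≤ x :=
  have := D.nonempty_seq
  ciSup_le h

lemma R_pos (w : List (Fin d)) : 0 < D.R w := by
  obtain ⟨η⟩ := D.nonempty_seq
  exact (D.P_pos w η).trans_le (D.P_le_R w η)

lemma R_le_one (w : List (Fin d)) : D.R w ≤ 1 := D.R_le (D.P_le_one w)

lemma R_cons_le (i : Fin d) (w : List (Fin d)) : D.R (i :: w) ≤ (1 - D.c) * D.R w :=
  D.R_le fun η => mul_le_mul (D.S_le _ _) (D.P_le_R w η) (D.P_pos w η).le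
    (by linarith [D.c_lt_one])

lemma R_append_le (v w : List (Fin d)) : D.R (v ++ w) ≤ D.R v := by
  refine D.R_le fun η => ?_
  rw [P_append]
  nlinarith [D.P_le_R v (appendSeq w η), D.P_le_one w η, D.P_pos v (appendSeq w η)]

lemma R_le_pow (w : List (Fin d)) : D.R w ≤ (1 - D.c) ^ w.length := by
  induction w with
  | nil => simpa using D.R_le_one []
  | cons i w ih =>
    rw [List.length_cons, pow_succ']
    exact (D.R_cons_le i w).trans
      (mul_le_mul_of_nonneg_left ih (by linarith [D.c_lt_one]))

lemma prod_eq_P (j : ℕ → Fin d) (n : ℕ) (η : ℕ → Fin d) :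
    ∏ t ∈ Finset.range n,
      D.S (fun m => if t + 1 + m < n then j (t + 1 + m) else η (t + 1 + m - n))
        (childIndex (j t)) = D.P (dword j n) η := by
  induction n generalizing j with
  | zero => simp [dword, P]
  | succ n ih =>
    rw [Finset.prod_range_succ', dword_succ, P, ← ih, mul_comm, appendSeq_dword]
    congr 1
    · congr 1
      funext m
      simp [Nat.add_comm 1 m]
    · refine Finset.prod_congr rfl fun t _ => ?_
      congr 1
      funext m
      have e1 : t + 1 + 1 + m = t + 1 + m + 1 := by omega
      simp [e1]

lemma rhoS_eq_R (j : ℕ → Fin d) (n : ℕ) : rhoS D.S j n = D.R (dword j n) :=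
  iSup_congr fun η => D.prod_eq_P j n η

lemma abs_S_sub_le (w : List (Fin d)) (η η' : ℕ → Fin d) (m : Fin (2 * d - 1)) :
    |D.S (appendSeq w η) m - D.S (appendSeq w η') m| ≤ D.K * D.R w ^ ε := by
  classical
  by_cases h : appendSeq w η = appendSeq w η'
  · rw [h, sub_self, abs_zero]
    exact mul_nonneg D.K_pos.le (Real.rpow_nonneg (D.R_pos w).le _)
  · have h' : ∃ p, appendSeq w η p ≠ appendSeq w η' p := Function.ne_iff.mp h
    have hp : w.length ≤ Nat.find h' := by
      by_contra! hlt
      exact Nat.find_spec h' (appendSeq_apply_of_lt w η η' hlt)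
    obtain ⟨n, hn⟩ := Nat.exists_eq_add_of_le hp
    refine (D.holder _ _ (Nat.find h') (fun t ht => not_not.mp (Nat.find_min h' ht))
      (Nat.find_spec h') m).trans (mul_le_mul_of_nonneg_left ?_ D.K_pos.le)
    rw [rhoS_eq_R, hn, dword_appendSeq]
    exact Real.rpow_le_rpow (D.R_pos _).le (D.R_append_le _ _) D.ε_pos.le

/-- The exponent of the distortion constant. -/
def distExp : ℝ := D.K / (D.c * (1 - (1 - D.c) ^ ε))

lemma one_sub_rpow_pos : 0 < 1 - (1 - D.c) ^ ε := by
  have := Real.rpow_lt_one (x := 1 - D.c) (by linarith [D.c_lt_one]) (by linarith [D.c_pos])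
    D.ε_pos
  linarith

lemma distExp_pos : 0 < D.distExp :=
  div_pos D.K_pos (mul_pos D.c_pos D.one_sub_rpow_pos)

lemma P_le_exp_mul (w : List (Fin d)) (η η' : ℕ → Fin d) :
    D.P w η ≤ Real.exp (D.distExp * (1 - D.R w ^ ε)) * D.P w η' := by
  induction w with
  | nil =>
    have h : D.R [] ^ ε ≤ 1 := Real.rpow_le_one (D.R_pos _).le (D.R_le_one _) D.ε_pos.le
    have := Real.one_le_exp (mul_nonneg D.distExp_pos.le (sub_nonneg.mpr h))
    simpa [P] using this
  | cons i w ih =>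
    set r := D.R w ^ ε with hr
    have hr0 : 0 < r := Real.rpow_pos_of_pos (D.R_pos w) _
    have h1 : D.R (i :: w) ^ ε ≤ (1 - D.c) ^ ε * r := by
      rw [hr, ← Real.mul_rpow (by linarith [D.c_lt_one]) (D.R_pos w).le]
      exact Real.rpow_le_rpow (D.R_pos _).le (D.R_cons_le i w) D.ε_pos.le
    have h2 : D.S (appendSeq w η) (childIndex i) ≤
        Real.exp (D.K / D.c * r) * D.S (appendSeq w η') (childIndex i) := by
      have h3 := (abs_le.mp (D.abs_S_sub_le w η η' (childIndex i))).2
      have h4 := D.c_le (appendSeq w η') (childIndex i)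
      have h5 := Real.add_one_le_exp (D.K / D.c * r)
      have h6 : D.K * r ≤ D.K / D.c * r * D.S (appendSeq w η') (childIndex i) := by
        rw [div_mul_eq_mul_div, div_mul_eq_mul_div, le_div_iff₀ D.c_pos]
        exact mul_le_mul_of_nonneg_left h4 (mul_pos D.K_pos hr0).le
      have h7 := mul_le_mul_of_nonneg_right h5 (D.S_pos (appendSeq w η') (childIndex i)).le
      linarith
    have h8 : D.distExp * (1 - (1 - D.c) ^ ε) = D.K / D.c := by
      have := D.one_sub_rpow_pos.ne'
      have := D.c_pos.ne'
      unfold distExp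
      field_simp
    have h9 : D.K / D.c * r + D.distExp * (1 - r) ≤ D.distExp * (1 - D.R (i :: w) ^ ε) := by
      have := mul_le_mul_of_nonneg_left h1 D.distExp_pos.le
      rw [← h8]
      linarith
    have h10 := Real.exp_le_exp.mpr h9
    rw [Real.exp_add] at h10
    calc D.P (i :: w) η
        ≤ (Real.exp (D.K / D.c * r) * D.S (appendSeq w η') (childIndex i)) *
          (Real.exp (D.distExp * (1 - r)) * D.P w η') :=
          mul_le_mul h2 ih (D.P_pos w η).le
            (mul_pos (Real.exp_pos _) (D.S_pos _ _)).le
      _ = (Real.exp (D.K / D.c * r) * Real.exp (D.distExp * (1 - r))) * D.P (i :: w) η' := by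
          rw [P]; ring
      _ ≤ _ := mul_le_mul_of_nonneg_right h10 (D.P_pos _ _).le

/-- The distortion constant. -/
def dist : ℝ := Real.exp D.distExp

lemma dist_pos : 0 < D.dist := Real.exp_pos _

lemma P_le_dist_mul (w : List (Fin d)) (η η' : ℕ → Fin d) : D.P w η ≤ D.dist * D.P w η' := by
  refine (D.P_le_exp_mul w η η').trans
    (mul_le_mul_of_nonneg_right (Real.exp_le_exp.mpr ?_) (D.P_pos _ _).le)
  have := Real.rpow_nonneg (D.R_pos w).le ε
  nlinarith [D.distExp_pos]

/-- The transfer operator of the children: the average of `F` over the one-letter extensions. -/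
def transfer : ((ℕ → Fin d) → ℝ) →ₗ[ℝ] ((ℕ → Fin d) → ℝ) where
  toFun F η := ∑ i, D.S η (childIndex i) * F (consSeq i η)
  map_add' F F' := by
    funext η
    simp [mul_add, Finset.sum_add_distrib]
  map_smul' a F := by
    funext η
    simp [Finset.mul_sum, mul_left_comm]

lemma transfer_apply (F : (ℕ → Fin d) → ℝ) (η : ℕ → Fin d) :
    D.transfer F η = ∑ i, D.S η (childIndex i) * F (consSeq i η) := rfl

lemma transfer_pow_mem {F : (ℕ → Fin d) → ℝ} {M : ℝ} (hF : ∀ η, F η ∈ Icc 0 M) (n : ℕ)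
    (η : ℕ → Fin d) : (D.transfer ^ n) F η ∈ Icc 0 ((1 - D.c) ^ n * M) := by
  have hM : 0 ≤ M := (hF η).1.trans (hF η).2
  have hc : 0 ≤ 1 - D.c := by linarith [D.c_lt_one]
  induction n generalizing η with
  | zero => simpa using hF η
  | succ n ih =>
    rw [pow_succ' D.transfer, Module.End.mul_apply, transfer_apply]
    refine ⟨Finset.sum_nonneg fun i _ => mul_nonneg (D.S_pos _ _).le (ih _).1, ?_⟩
    calc _ ≤ ∑ i, D.S η (childIndex i) * ((1 - D.c) ^ n * M) :=
          Finset.sum_le_sum fun i _ => mul_le_mul_of_nonneg_left (ih _).2 (D.S_pos _ _).le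
      _ ≤ (1 - D.c) * ((1 - D.c) ^ n * M) := by
          rw [← Finset.sum_mul]
          exact mul_le_mul_of_nonneg_right (D.sum_child_le η) (mul_nonneg (pow_nonneg hc n) hM)
      _ = _ := by ring

/-- The contraction rate of `transfer` with respect to the functional `mean`. -/
def θ : ℝ := 1 - D.c / 2

lemma θ_pos : 0 < D.θ := by unfold θ; linarith [D.c_lt_one]

lemma θ_lt_one : D.θ < 1 := by unfold θ; linarith [D.c_pos]

/-- A normalized positive functional which is almost subinvariant under the transfer operator. -/
lemma exists_mean (B : ℝ) : ∃ E : ((ℕ → Fin d) → ℝ) →ₗ[ℝ] ℝ,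
    (∀ F, (∀ η, 0 ≤ F η) → 0 ≤ E F) ∧ E (fun _ => 1) = 1 ∧
    ∀ F, (∀ η, 0 ≤ F η) → (∀ η η', F η ≤ B * F η') → E (D.transfer F) ≤ D.θ * E F := by
  obtain ⟨ω⟩ := D.nonempty_seq
  have hθ := D.θ_pos
  have hc : 0 < 1 - D.c := by linarith [D.c_lt_one]
  have hcθ : (1 - D.c) / D.θ < 1 := by
    rw [div_lt_one hθ]
    unfold θ
    linarith [D.c_pos]
  obtain ⟨N, hN⟩ : ∃ N : ℕ, B * ((1 - D.c) / D.θ) ^ (N + 1) < 1 := by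
    have h := ((tendsto_pow_atTop_nhds_zero_of_lt_one (div_pos hc hθ).le hcθ).comp
      (tendsto_add_atTop_nat 1)).const_mul B
    rw [mul_zero] at h
    exact (h.eventually_lt_const one_pos).exists
  have hN' : B * (1 - D.c) ^ (N + 1) ≤ D.θ ^ (N + 1) := by
    rw [div_pow, mul_div_assoc', div_lt_one (pow_pos hθ _)] at hN
    exact hN.le
  set E₀ : ((ℕ → Fin d) → ℝ) →ₗ[ℝ] ℝ :=
    ∑ k ∈ Finset.range (N + 1), (D.θ ^ k)⁻¹ • (LinearMap.proj ω ∘ₗ (D.transfer ^ k)) with hE₀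
  have E₀_apply : ∀ F, E₀ F =
      ∑ k ∈ Finset.range (N + 1), (D.θ ^ k)⁻¹ * (D.transfer ^ k) F ω := by
    intro F
    simp [hE₀, LinearMap.sum_apply]
  have nonneg : ∀ F : (ℕ → Fin d) → ℝ, (∀ η, 0 ≤ F η) → ∀ k η, 0 ≤ (D.transfer ^ k) F η := by
    intro F hF k
    induction k with
    | zero => simpa using hF
    | succ k ih =>
      intro η
      rw [pow_succ', Module.End.mul_apply, transfer_apply]
      exact Finset.sum_nonneg fun i _ => mul_nonneg (D.S_pos _ _).le (ih _)
  have E₀_ge : ∀ F : (ℕ → Fin d) → ℝ, (∀ η, 0 ≤ F η) → F ω ≤ E₀ F := by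
    intro F hF
    rw [E₀_apply, Finset.sum_range_succ']
    have : 0 ≤ ∑ k ∈ Finset.range N, (D.θ ^ (k + 1))⁻¹ * (D.transfer ^ (k + 1)) F ω :=
      Finset.sum_nonneg fun k _ => mul_nonneg (inv_pos.mpr (pow_pos hθ _)).le (nonneg F hF _ _)
    simpa using this
  have hZ : 0 < E₀ fun _ => 1 := one_pos.trans_le (E₀_ge _ fun _ => zero_le_one)
  refine ⟨(E₀ fun _ => 1)⁻¹ • E₀, fun F hF => ?_, ?_, fun F hF hB => ?_⟩
  · exact mul_nonneg (inv_pos.mpr hZ).le ((hF ω).trans (E₀_ge F hF))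
  · exact inv_mul_cancel₀ hZ.ne'
  · have hM := (D.transfer_pow_mem (fun η => ⟨hF η, hB η ω⟩) (N + 1) ω).2
    have hlast : (D.θ ^ (N + 1))⁻¹ * (D.transfer ^ (N + 1)) F ω ≤ F ω := by
      rw [inv_mul_le_iff₀ (pow_pos hθ _)]
      nlinarith [mul_le_mul_of_nonneg_right hN' (hF ω)]
    have hshift : E₀ (D.transfer F) =
        D.θ * (E₀ F - F ω + (D.θ ^ (N + 1))⁻¹ * (D.transfer ^ (N + 1)) F ω) := by
      have e : E₀ F + (D.θ ^ (N + 1))⁻¹ * (D.transfer ^ (N + 1)) F ω =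
          ∑ k ∈ Finset.range (N + 1), (D.θ ^ (k + 1))⁻¹ * (D.transfer ^ (k + 1)) F ω + F ω := by
        rw [E₀_apply, ← Finset.sum_range_succ, Finset.sum_range_succ']
        simp
      rw [show E₀ F - F ω + (D.θ ^ (N + 1))⁻¹ * (D.transfer ^ (N + 1)) F ω =
        ∑ k ∈ Finset.range (N + 1), (D.θ ^ (k + 1))⁻¹ * (D.transfer ^ (k + 1)) F ω by linarith,
        E₀_apply, Finset.mul_sum]
      refine Finset.sum_congr rfl fun k _ => ?_
      rw [pow_succ D.transfer, Module.End.mul_apply, pow_succ D.θ]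
      field_simp
    have hle : E₀ (D.transfer F) ≤ D.θ * E₀ F := by
      rw [hshift]
      exact mul_le_mul_of_nonneg_left (by linarith) hθ.le
    have := mul_le_mul_of_nonneg_left hle (inv_pos.mpr hZ).le
    simp only [LinearMap.smul_apply, smul_eq_mul]
    linarith

/-- A mean on functions of sequences that is contracted by the transfer operator on functions of
distortion at most `dist / c`. -/
def mean : ((ℕ → Fin d) → ℝ) →ₗ[ℝ] ℝ := (D.exists_mean (D.dist / D.c)).choose

lemma mean_nonneg {F : (ℕ → Fin d) → ℝ} (h : ∀ η, 0 ≤ F η) : 0 ≤ D.mean F :=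
  (D.exists_mean (D.dist / D.c)).choose_spec.1 F h

lemma mean_mono {F F' : (ℕ → Fin d) → ℝ} (h : ∀ η, F η ≤ F' η) : D.mean F ≤ D.mean F' := by
  have := D.mean_nonneg (F := F' - F) fun η => sub_nonneg.mpr (h η)
  rwa [map_sub, sub_nonneg] at this

lemma mean_const_mul (a : ℝ) (F : (ℕ → Fin d) → ℝ) : D.mean (fun η => a * F η) = a * D.mean F :=
  map_smul D.mean a F

lemma mean_const (a : ℝ) : D.mean (fun _ => a) = a := by
  have h : D.mean (fun _ => 1) = 1 := (D.exists_mean (D.dist / D.c)).choose_spec.2.1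
  simpa [h] using D.mean_const_mul a fun _ => 1

lemma mean_child_le {F : (ℕ → Fin d) → ℝ} (h : ∀ η, 0 ≤ F η)
    (h' : ∀ η η', F η ≤ D.dist / D.c * F η') (i : Fin d) :
    D.mean (fun η => D.S η (childIndex i) * F (consSeq i η)) ≤ D.θ * D.mean F :=
  (D.mean_mono fun η => Finset.single_le_sum
    (f := fun k => D.S η (childIndex k) * F (consSeq k η))
    (fun _ _ => mul_nonneg (D.S_pos _ _).le (h _)) (Finset.mem_univ i)).trans
    ((D.exists_mean (D.dist / D.c)).choose_spec.2.2 F h h')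

/-- The length of the interval of the word `w`. -/
def len (w : List (Fin d)) : ℝ := D.mean (D.P w)

/-- The length of the `m`-th piece (child or gap) of the interval of the word `w`. -/
def piece (w : List (Fin d)) (m : Fin (2 * d - 1)) : ℝ :=
  D.mean fun η => D.S (appendSeq w η) m * D.P w η

lemma len_nil : D.len [] = 1 := D.mean_const 1

lemma len_cons (i : Fin d) (w : List (Fin d)) : D.len (i :: w) = D.piece w (childIndex i) := rfl

lemma sum_piece (w : List (Fin d)) : ∑ m, D.piece w m = D.len w := by
  unfold piece len
  rw [← map_sum]
  congr 1
  funext η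
  rw [Finset.sum_apply, ← Finset.sum_mul, sum_S, one_mul]

lemma P_le_dist_mul_len (w : List (Fin d)) (η : ℕ → Fin d) : D.P w η ≤ D.dist * D.len w := by
  rw [len, ← mean_const_mul]
  exact (D.mean_const _).symm.le.trans (D.mean_mono fun η' => D.P_le_dist_mul w η η')

lemma R_le_dist_mul_len (w : List (Fin d)) : D.R w ≤ D.dist * D.len w :=
  D.R_le (D.P_le_dist_mul_len w)

lemma len_pos (w : List (Fin d)) : 0 < D.len w :=
  pos_of_mul_pos_right ((D.R_pos w).trans_le (D.R_le_dist_mul_len w)) D.dist_pos.le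

lemma c_mul_len_le (w : List (Fin d)) (m : Fin (2 * d - 1)) : D.c * D.len w ≤ D.piece w m := by
  rw [len, ← mean_const_mul]
  exact D.mean_mono fun η => mul_le_mul_of_nonneg_right (D.c_le _ _) (D.P_pos _ _).le

lemma piece_le (w : List (Fin d)) (m : Fin (2 * d - 1)) :
    D.piece w m ≤ (1 - D.c) * D.len w := by
  rw [len, ← mean_const_mul]
  exact D.mean_mono fun η => mul_le_mul_of_nonneg_right (D.S_le _ _) (D.P_pos _ _).le

lemma piece_pos (w : List (Fin d)) (m : Fin (2 * d - 1)) : 0 < D.piece w m :=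
  (mul_pos D.c_pos (D.len_pos w)).trans_le (D.c_mul_len_le w m)

lemma len_concat_le (w : List (Fin d)) (i : Fin d) : D.len (w ++ [i]) ≤ D.θ * D.len w := by
  rw [len, funext (D.P_concat w i)]
  refine D.mean_child_le (fun η => (D.P_pos w η).le) (fun η η' => ?_) i
  refine (D.P_le_dist_mul w η η').trans (mul_le_mul_of_nonneg_right ?_ (D.P_pos _ _).le)
  rw [le_div_iff₀ D.c_pos]
  nlinarith [D.dist_pos, D.c_lt_one]

lemma piece_concat_le (w : List (Fin d)) (i : Fin d) (m : Fin (2 * d - 1)) :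
    D.piece (w ++ [i]) m ≤ D.θ * D.piece w m := by
  have e : (fun η => D.S (appendSeq (w ++ [i]) η) m * D.P (w ++ [i]) η) = fun η =>
      D.S η (childIndex i) * (D.S (appendSeq w (consSeq i η)) m * D.P w (consSeq i η)) := by
    funext η
    rw [P_concat, appendSeq_concat]
    ring
  rw [piece, e]
  refine D.mean_child_le (F := fun η => D.S (appendSeq w η) m * D.P w η)
    (fun η => (mul_pos (D.S_pos _ _) (D.P_pos w η)).le) (fun η η' => ?_) i
  have h1 := D.P_le_dist_mul w η η'
  have h2 := D.c_le (appendSeq w η') m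
  have h3 := mul_le_mul (D.S_lt_one (appendSeq w η) m).le h1 (D.P_pos w η).le zero_le_one
  refine h3.trans ?_
  rw [div_mul_eq_mul_div, le_div_iff₀ D.c_pos]
  nlinarith [mul_le_mul_of_nonneg_right h2 (mul_pos D.dist_pos (D.P_pos w η')).le]

lemma le_len_concat (w : List (Fin d)) (i : Fin d) :
    D.c / D.dist * D.len w ≤ D.len (w ++ [i]) := by
  rw [len, ← mean_const_mul, len]
  refine D.mean_mono fun η => ?_
  rw [P_concat, div_mul_eq_mul_div, div_le_iff₀ D.dist_pos]
  have h1 := D.P_le_dist_mul w η (consSeq i η)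
  have h2 := mul_le_mul (D.c_le η (childIndex i)) h1 (D.P_pos w η).le (D.S_pos _ _).le
  linarith

lemma abs_piece_sub_le (w : List (Fin d)) (m : Fin (2 * d - 1)) (η : ℕ → Fin d) :
    |D.piece w m - D.S (appendSeq w η) m * D.len w| ≤ D.K * D.R w ^ ε * D.len w := by
  have h : ∀ η', |D.S (appendSeq w η') m - D.S (appendSeq w η) m| ≤ D.K * D.R w ^ ε :=
    fun η' => D.abs_S_sub_le w η' η m
  rw [abs_le, neg_le_sub_iff_le_add, sub_le_iff_le_add, ← add_mul, ← sub_le_iff_le_add, ← sub_mul,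
    len, ← mean_const_mul, ← mean_const_mul]
  constructor
  · refine D.mean_mono fun η' => mul_le_mul_of_nonneg_right ?_ (D.P_pos _ _).le
    linarith [(abs_le.mp (h η')).1]
  · refine D.mean_mono fun η' => mul_le_mul_of_nonneg_right ?_ (D.P_pos _ _).le
    linarith [(abs_le.mp (h η')).2]

lemma abs_piece_div_sub_le (w : List (Fin d)) (m : Fin (2 * d - 1)) (η : ℕ → Fin d) :
    |D.piece w m / D.len w - D.S (appendSeq w η) m| ≤ D.K * D.R w ^ ε := by
  have h := D.len_pos w
  rw [div_sub' h.ne', abs_div, abs_of_pos h, div_le_iff₀ h, mul_comm (D.len w)]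
  exact D.abs_piece_sub_le w m η

lemma abs_piece_ratio_sub_le (w : List (Fin d)) (i : Fin d) (m : Fin (2 * d - 1)) :
    |D.piece (w ++ [i]) m / D.piece w m - D.len (w ++ [i]) / D.len w| ≤
      2 * D.K / D.c * D.dist ^ ε * D.len w ^ ε := by
  obtain ⟨η⟩ := D.nonempty_seq
  have hL := D.len_pos w
  have hL' := D.len_pos (w ++ [i])
  have hp := D.piece_pos w m
  have h1 := D.abs_piece_div_sub_le (w ++ [i]) m η
  have h2 := D.abs_piece_div_sub_le w m (consSeq i η)
  rw [appendSeq_concat] at h1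
  have h3 : D.R (w ++ [i]) ^ ε ≤ D.R w ^ ε :=
    Real.rpow_le_rpow (D.R_pos _).le (D.R_append_le _ _) D.ε_pos.le
  have h4 : |D.piece (w ++ [i]) m / D.len (w ++ [i]) - D.piece w m / D.len w| ≤
      2 * D.K * D.R w ^ ε := by
    have := mul_le_mul_of_nonneg_left h3 D.K_pos.le
    rw [abs_le] at *
    constructor <;> linarith [h1.1, h1.2, h2.1, h2.2]
  have h5 : D.R w ^ ε ≤ D.dist ^ ε * D.len w ^ ε := by
    rw [← Real.mul_rpow D.dist_pos.le hL.le]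
    exact Real.rpow_le_rpow (D.R_pos w).le (D.R_le_dist_mul_len w) D.ε_pos.le
  have h6 : D.len (w ++ [i]) / D.piece w m ≤ 1 / D.c := by
    rw [div_le_div_iff₀ hp D.c_pos, one_mul]
    have h7 := D.len_concat_le w i
    have h8 := D.c_mul_len_le w m
    have h9 : D.len (w ++ [i]) ≤ D.len w := by nlinarith [D.θ_lt_one]
    nlinarith [D.c_pos]
  have e : D.piece (w ++ [i]) m / D.piece w m - D.len (w ++ [i]) / D.len w =
      D.len (w ++ [i]) / D.piece w m *
        (D.piece (w ++ [i]) m / D.len (w ++ [i]) - D.piece w m / D.len w) := by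
    field_simp
  rw [e, abs_mul, abs_of_pos (div_pos hL' hp)]
  calc _ ≤ 1 / D.c * (2 * D.K * D.R w ^ ε) :=
        mul_le_mul h6 h4 (abs_nonneg _) (div_pos one_pos D.c_pos).le
    _ ≤ 1 / D.c * (2 * D.K * (D.dist ^ ε * D.len w ^ ε)) := by
        have := D.K_pos
        have := D.c_pos
        gcongr
    _ = _ := by ring

/-- The left endpoint of the interval of the word `w`. -/
def left : List (Fin d) → ℝ
  | [] => 0
  | i :: w => left w + childLeft (D.piece w) i

lemma left_sub_right (w : List (Fin d)) (k : Fin (d - 1)) :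
    D.left (⟨k + 1, by omega⟩ :: w) - (D.left (⟨k, by omega⟩ :: w) + D.len (⟨k, by omega⟩ :: w)) =
      D.piece w (gapIndex k) := by
  rw [left, left, childLeft_succ, len_cons]
  ring

/-- The geometry of intervals determined by the Hölder scaling `D`. -/
def geometry : CantorGeometry d ε where
  a := D.left
  L := D.len
  c := D.c
  b := D.c ^ 2 / D.dist
  θ := D.θ
  C := 2 * D.K / D.c * D.dist ^ ε
  two_le := D.two_le
  ε_pos := D.ε_pos
  ε_le := D.ε_le
  a_nil := rfl
  L_nil := D.len_nil
  L_pos := D.len_pos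
  a_first w := by rw [left, childLeft_zero, add_zero]
  right_last w := by
    have hd := D.two_le
    rw [left, len_cons, add_assoc, childLeft_last_add _ (by omega), sum_piece]
  c_pos := D.c_pos
  le_child w j := D.c_mul_len_le w _
  child_le w j := D.piece_le w _
  le_gap w k := (D.c_mul_len_le w _).trans_eq (D.left_sub_right w k).symm
  b_pos := div_pos (pow_pos D.c_pos 2) D.dist_pos
  θ_lt := D.θ_lt_one
  C_pos := mul_pos (div_pos (mul_pos two_pos D.K_pos) D.c_pos) (Real.rpow_pos_of_pos D.dist_pos _)
  le_ratio w i := by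
    rw [le_div_iff₀ (D.len_pos w)]
    refine (mul_le_mul_of_nonneg_right ?_ (D.len_pos w).le).trans (D.le_len_concat w i)
    rw [div_le_div_iff_of_pos_right D.dist_pos]
    nlinarith [D.c_pos, D.c_lt_one]
  ratio_le w i := by
    rw [div_le_iff₀ (D.len_pos w)]
    exact D.len_concat_le w i
  le_gapRatio w i k := by
    rw [left_sub_right, left_sub_right, le_div_iff₀ (D.piece_pos w _)]
    have h1 := D.c_mul_len_le (w ++ [i]) (gapIndex k)
    have h2 := mul_le_mul_of_nonneg_left (D.le_len_concat w i) D.c_pos.le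
    have h3 : D.c ^ 2 / D.dist * D.piece w (gapIndex k) ≤ D.c ^ 2 / D.dist * D.len w := by
      refine mul_le_mul_of_nonneg_left ?_ (div_pos (pow_pos D.c_pos 2) D.dist_pos).le
      nlinarith [D.piece_le w (gapIndex k), D.c_pos, D.len_pos w]
    calc _ ≤ _ := h3
      _ = D.c * (D.c / D.dist * D.len w) := by ring
      _ ≤ _ := h2.trans h1
  gapRatio_le w i k := by
    rw [left_sub_right, left_sub_right, div_le_iff₀ (D.piece_pos w _)]
    exact D.piece_concat_le w i _
  ratio_holder w i j := D.abs_piece_ratio_sub_le w i _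
  gapRatio_holder w i k := by
    rw [left_sub_right, left_sub_right]
    exact D.abs_piece_ratio_sub_le w i _

lemma scalingData_eq (w : List (Fin d)) (m : Fin (2 * d - 1)) :
    scalingData D.geometry.branch w m = D.piece w m / D.len w := by
  have hL : ∀ v, wordLen D.geometry.branch v = D.len v := D.geometry.wordLen_branch
  unfold scalingData
  split_ifs with h
  · rw [hL, hL, len_cons]
    rfl
  · have hk : (m : ℕ) - d < d - 1 := by omega
    rw [D.geometry.branch_zero, D.geometry.branch_one, D.geometry.wordMap_a,
      D.geometry.wordMap_right, hL]
    have e : D.piece w m = D.piece w (gapIndex ⟨m - d, hk⟩) :=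
      congrArg _ (Fin.ext (show (m : ℕ) = d + (m - d) by omega))
    rw [e, ← left_sub_right]
    rfl

lemma hasScalingFunction_branch : HasScalingFunction D.geometry.branch D.S := by
  intro j
  rw [tendsto_pi_nhds]
  intro m
  have hc : 0 < 1 - D.c := by linarith [D.c_lt_one]
  have h1 : ∀ n, Dist.dist (scalingData D.geometry.branch (dword j n) m) (D.S j m) ≤
      D.K * ((1 - D.c) ^ n) ^ ε := by
    intro n
    have h := D.abs_piece_div_sub_le (dword j n) m fun m => j (n + m)
    rw [appendSeq_dword_tail] at h
    rw [Real.dist_eq, scalingData_eq]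
    refine h.trans (mul_le_mul_of_nonneg_left ?_ D.K_pos.le)
    refine Real.rpow_le_rpow (D.R_pos _).le ?_ D.ε_pos.le
    simpa [length_dword] using D.R_le_pow (dword j n)
  have h2 : Tendsto (fun n : ℕ => D.K * ((1 - D.c) ^ n) ^ ε) atTop (nhds 0) := by
    have := ((tendsto_pow_atTop_nhds_zero_of_lt_one hc.le
      (by linarith [D.c_pos])).rpow_const (Or.inr D.ε_pos.le)).const_mul D.K
    rwa [Real.zero_rpow D.ε_pos.ne', mul_zero] at this
  rw [tendsto_iff_dist_tendsto_zero]
  exact squeeze_zero (fun _ => dist_nonneg) h1 h2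

end HolderScaling

end

/-- Theorem 1, sufficiency: every continuous `S : Σ_d^dual → Simp_{2d-2}`
which is `C^ε` with respect to `ρ_S` is the scaling function of a `C^{1+ε}` Cantor system. -/
theorem stmt10 (d : ℕ) (hd : 2 ≤ d) (ε : ℝ) (hε : ε ∈ Set.Ioc (0:ℝ) 1)
    (S : (ℕ → Fin d) → Fin (2*d-1) → ℝ) (hSsimp : ∀ j, S j ∈ Simp d)
    (hScont : Continuous S)
    (K : ℝ) (hK : 0 < K)
    (hhold : ∀ j j' : ℕ → Fin d, ∀ p : ℕ, (∀ t < p, j t = j' t) → j p ≠ j' p →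
      ∀ m, |S j m - S j' m| ≤ K * rhoS S j p ^ ε) :
    ∃ g : Fin d → ℝ → ℝ, IsCantorSystem 1 ε g ∧ HasScalingFunction g S := by
  let D : HolderScaling d ε :=
    { S := S, K := K, two_le := hd, ε_pos := hε.1, ε_le := hε.2, mem_simp := hSsimp,
      continuous_S := hScont, K_pos := hK, holder := hhold }
  exact ⟨D.geometry.branch, D.geometry.isCantorSystem_branch, D.hasScalingFunction_branch⟩
end

section
/- Let g_1,…,g_d be a C^{k+ε} Cantor system on [0,1]. Then there exists C > 0 such that for every finite word w and every integer t with 1 ≤ t ≤ k, sup_{x∈[0,1]} |D^t G_w(x)| ≤ C · sup_{x∈[0,1]} |D G_w(x)|, and moreover the ε-Hölder seminorm of D^k G_w on [0,1], sup_{x≠y} |D^k G_w(x) − D^k G_w(y)|/|x−y|^ε, is at most C · sup_{x∈[0,1]} |D G_w(x)|. That is, all derivatives up to order k+ε of an arbitrary composition of the contractions are controlled by its first derivative, uniformly over all compositions. -/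
open Set Filter

/-- `f` is `m` times differentiable on `[0,1]`, its derivatives of order `≤ m` are bounded
by `K` there, and the `m`-th one is `ε`-Hölder with constant `K`. -/
def HolderNormLE (ε : ℝ) : ℕ → ℝ → (ℝ → ℝ) → Prop
  | 0, K, f => (∀ x ∈ I01, |f x| ≤ K) ∧ HolderBoundOn01 ε K f
  | m + 1, K, f => (∀ x ∈ I01, |f x| ≤ K) ∧ DifferentiableOn ℝ f I01 ∧
      HolderNormLE ε m K (derivWithin f I01)

theorem uniqueDiffOn_I01 : UniqueDiffOn ℝ I01 := uniqueDiffOn_Icc_zero_one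

theorem zero_mem_I01 : (0 : ℝ) ∈ I01 := ⟨le_rfl, zero_le_one⟩

theorem abs_sub_le_of_abs_derivWithin_le {f : ℝ → ℝ} {L : ℝ} (hf : DifferentiableOn ℝ f I01)
    (hL : ∀ x ∈ I01, |derivWithin f I01 x| ≤ L) {x y : ℝ} (hx : x ∈ I01) (hy : y ∈ I01) :
    |f x - f y| ≤ L * |x - y| :=
  Convex.norm_image_sub_le_of_norm_derivWithin_le hf hL (convex_Icc 0 1) hy hx

theorem abs_sub_le_rpow {ε : ℝ} (hε : 0 < ε) (hε1 : ε ≤ 1) {x y : ℝ} (hx : x ∈ I01)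
    (hy : y ∈ I01) : |x - y| ≤ |x - y| ^ ε := by
  have h1 : |x - y| ≤ 1 := by
    rw [abs_le]
    constructor <;> linarith [hx.1, hx.2, hy.1, hy.2]
  rcases (abs_nonneg (x - y)).eq_or_lt with h | h
  · rw [← h, Real.zero_rpow hε.ne']
  · simpa using Real.rpow_le_rpow_of_exponent_ge h h1 hε1

theorem HolderBoundOn01.of_derivWithin {ε K : ℝ} (hε : 0 < ε) (hε1 : ε ≤ 1) {f : ℝ → ℝ}
    (hf : DifferentiableOn ℝ f I01) (hK : ∀ x ∈ I01, |derivWithin f I01 x| ≤ K) :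
    HolderBoundOn01 ε K f := by
  intro x hx y hy
  have hK0 : 0 ≤ K := (abs_nonneg _).trans (hK 0 zero_mem_I01)
  exact (abs_sub_le_of_abs_derivWithin_le hf hK hx hy).trans
    (mul_le_mul_of_nonneg_left (abs_sub_le_rpow hε hε1 hx hy) hK0)

namespace HolderNormLE

variable {ε : ℝ} {m : ℕ} {K L : ℝ} {f h : ℝ → ℝ}

theorem abs_le (hf : HolderNormLE ε m K f) : ∀ x ∈ I01, |f x| ≤ K := by
  cases m <;> exact hf.1

theorem nonneg (hf : HolderNormLE ε m K f) : 0 ≤ K :=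
  (abs_nonneg _).trans (hf.abs_le 0 zero_mem_I01)

theorem congr (hf : HolderNormLE ε m K f) (hfh : EqOn h f I01) : HolderNormLE ε m K h := by
  induction m generalizing f h with
  | zero =>
    refine ⟨fun x hx => by rw [hfh hx]; exact hf.1 x hx, fun x hx y hy => ?_⟩
    rw [hfh hx, hfh hy]
    exact hf.2 x hx y hy
  | succ m ih =>
    exact ⟨fun x hx => by rw [hfh hx]; exact hf.1 x hx, hf.2.1.congr hfh,
      ih hf.2.2 fun x hx => derivWithin_congr hfh (hfh hx)⟩

theorem mono (hf : HolderNormLE ε m K f) (hKL : K ≤ L) : HolderNormLE ε m L f := by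
  induction m generalizing f with
  | zero =>
    exact ⟨fun x hx => (hf.1 x hx).trans hKL, fun x hx y hy => (hf.2 x hx y hy).trans
      (mul_le_mul_of_nonneg_right hKL (Real.rpow_nonneg (abs_nonneg _) _))⟩
  | succ m ih => exact ⟨fun x hx => (hf.1 x hx).trans hKL, hf.2.1, ih hf.2.2⟩

theorem const (ε : ℝ) (m : ℕ) (c : ℝ) : HolderNormLE ε m |c| (fun _ => c) := by
  induction m generalizing c with
  | zero =>
    refine ⟨fun _ _ => le_rfl, fun x _ y _ => ?_⟩
    rw [sub_self, abs_zero]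
    positivity
  | succ m ih =>
    refine ⟨fun _ _ => le_rfl, differentiableOn_const _, ((ih 0).mono ?_).congr fun x _ => ?_⟩
    · simp
    · simp

theorem of_succ (hε : 0 < ε) (hε1 : ε ≤ 1) (hf : HolderNormLE ε (m + 1) K f) :
    HolderNormLE ε m K f := by
  induction m generalizing f with
  | zero => exact ⟨hf.1, .of_derivWithin hε hε1 hf.2.1 hf.2.2.abs_le⟩
  | succ m ih => exact ⟨hf.1, hf.2.1, ih hf.2.2⟩

theorem of_le (hε : 0 < ε) (hε1 : ε ≤ 1) {n : ℕ} (hmn : m ≤ n) (hf : HolderNormLE ε n K f) :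
    HolderNormLE ε m K f := by
  induction n, hmn using Nat.le_induction with
  | base => exact hf
  | succ n _ ih => exact ih (hf.of_succ hε hε1)

theorem add (hf : HolderNormLE ε m K f) (hh : HolderNormLE ε m L h) :
    HolderNormLE ε m (K + L) (fun x => f x + h x) := by
  have hb : ∀ x ∈ I01, |f x + h x| ≤ K + L := fun x hx =>
    (abs_add_le _ _).trans (add_le_add (hf.abs_le x hx) (hh.abs_le x hx))
  induction m generalizing f h with
  | zero =>
    refine ⟨hb, fun x hx y hy => ?_⟩
    calc |f x + h x - (f y + h y)| = |(f x - f y) + (h x - h y)| := by ring_nf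
      _ ≤ |f x - f y| + |h x - h y| := abs_add_le _ _
      _ ≤ K * |x - y| ^ ε + L * |x - y| ^ ε := add_le_add (hf.2 x hx y hy) (hh.2 x hx y hy)
      _ = (K + L) * |x - y| ^ ε := by ring
  | succ m ih =>
    refine ⟨hb, hf.2.1.add hh.2.1, (ih hf.2.2 hh.2.2 fun x hx => (abs_add_le _ _).trans
      (add_le_add (hf.2.2.abs_le x hx) (hh.2.2.abs_le x hx))).congr fun x hx => ?_⟩
    exact derivWithin_fun_add (hf.2.1 x hx) (hh.2.1 x hx)

theorem mul (hε : 0 < ε) (hε1 : ε ≤ 1) (hf : HolderNormLE ε m K f)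
    (hh : HolderNormLE ε m L h) :
    HolderNormLE ε m (2 ^ (m + 1) * (K * L)) (fun x => f x * h x) := by
  have hK := hf.nonneg
  have hL := hh.nonneg
  have hb : ∀ x ∈ I01, |f x * h x| ≤ 2 ^ (m + 1) * (K * L) := fun x hx => by
    rw [abs_mul]
    calc |f x| * |h x| ≤ K * L := mul_le_mul (hf.abs_le x hx) (hh.abs_le x hx) (abs_nonneg _) hK
      _ ≤ 2 ^ (m + 1) * (K * L) :=
        le_mul_of_one_le_left (mul_nonneg hK hL) (one_le_pow₀ one_le_two)
  induction m generalizing f h with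
  | zero =>
    refine ⟨hb, fun x hx y hy => ?_⟩
    calc |f x * h x - f y * h y| = |f x * (h x - h y) + (f x - f y) * h y| := by ring_nf
      _ ≤ |f x| * |h x - h y| + |f x - f y| * |h y| := by
        rw [← abs_mul, ← abs_mul]; exact abs_add_le _ _
      _ ≤ K * (L * |x - y| ^ ε) + (K * |x - y| ^ ε) * L :=
        add_le_add (mul_le_mul (hf.1 x hx) (hh.2 x hx y hy) (abs_nonneg _) hK)
          (mul_le_mul (hf.2 x hx y hy) (hh.1 y hy) (abs_nonneg _) (by positivity))
      _ = 2 ^ (0 + 1) * (K * L) * |x - y| ^ ε := by ring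
  | succ m ih =>
    refine ⟨hb, hf.2.1.mul hh.2.1, ?_⟩
    have hbound : ∀ {u v : ℝ → ℝ}, HolderNormLE ε m K u → HolderNormLE ε m L v →
        HolderNormLE ε m (2 ^ (m + 1) * (K * L)) (fun x => u x * v x) := fun hu hv =>
      ih hu hv fun x hx => by
        rw [abs_mul]
        exact (mul_le_mul (hu.abs_le x hx) (hv.abs_le x hx) (abs_nonneg _) hK).trans
          (le_mul_of_one_le_left (mul_nonneg hK hL) (one_le_pow₀ one_le_two))
    refine (((hbound hf.2.2 (hh.of_succ hε hε1)).add
      (hbound (hf.of_succ hε hε1) hh.2.2)).mono (le_of_eq (by ring))).congr fun x hx => ?_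
    exact derivWithin_fun_mul (hf.2.1 x hx) (hh.2.1 x hx)

theorem exists_comp (hε : 0 < ε) (hε1 : ε ≤ 1) (m : ℕ) (hL : 1 ≤ L) :
    ∃ c ≥ 1, ∀ K f h, HolderNormLE ε m K f → HolderNormLE ε (m + 1) L h → MapsTo h I01 I01 →
      HolderNormLE ε m (c * K) (fun x => f (h x)) := by
  induction m with
  | zero =>
    refine ⟨L, hL, fun K f h hf hh hI =>
      ⟨fun x hx => (hf.1 _ (hI hx)).trans (le_mul_of_one_le_left hf.nonneg hL),
        fun x hx y hy => ?_⟩⟩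
    have hL0 : 0 ≤ L := zero_le_one.trans hL
    have hK := hf.nonneg
    calc |f (h x) - f (h y)| ≤ K * |h x - h y| ^ ε := hf.2 _ (hI hx) _ (hI hy)
      _ ≤ K * (L * |x - y|) ^ ε := by
        gcongr
        exact abs_sub_le_of_abs_derivWithin_le hh.2.1 hh.2.2.abs_le hx hy
      _ = K * (L ^ ε * |x - y| ^ ε) := by rw [Real.mul_rpow hL0 (abs_nonneg _)]
      _ ≤ K * (L * |x - y| ^ ε) := by
        gcongr
        simpa using Real.rpow_le_rpow_of_exponent_le hL hε1
      _ = L * K * |x - y| ^ ε := by ring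
  | succ m ih =>
    obtain ⟨c, hc, ih⟩ := ih
    have hc' : 1 ≤ 2 ^ (m + 1) * (c * L) :=
      one_le_mul_of_one_le_of_one_le (one_le_pow₀ one_le_two)
        (one_le_mul_of_one_le_of_one_le hc hL)
    refine ⟨2 ^ (m + 1) * (c * L), hc', fun K f h hf hh hI =>
      ⟨fun x hx => (hf.1 _ (hI hx)).trans (le_mul_of_one_le_left hf.nonneg hc'),
        hf.2.1.comp hh.2.1 hI, ?_⟩⟩
    refine (((ih K _ h hf.2.2 (hh.of_succ hε hε1) hI).mul hε hε1
      (hh.2.2.of_succ hε hε1)).mono (le_of_eq (by ring))).congr fun x hx => ?_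
    exact derivWithin_comp x (hf.2.1 _ (hI hx)) (hh.2.1 x hx) hI

theorem exists_inv (hε : 0 < ε) (hε1 : ε ≤ 1) {a : ℝ} (ha : 0 < a)
    (hf : HolderNormLE ε m K f) (haf : ∀ x ∈ I01, a ≤ f x) :
    ∃ L, HolderNormLE ε m L (fun x => (f x)⁻¹) := by
  have hb : ∀ x ∈ I01, |(f x)⁻¹| ≤ a⁻¹ := fun x hx => by
    rw [abs_of_pos (inv_pos.2 (ha.trans_le (haf x hx)))]
    exact inv_anti₀ ha (haf x hx)
  induction m with
  | zero =>
    have hK := hf.nonneg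
    refine ⟨max a⁻¹ (a⁻¹ * K * a⁻¹), fun x hx => (hb x hx).trans (le_max_left _ _),
      fun x hx y hy => ?_⟩
    have hx0 := (ha.trans_le (haf x hx)).ne'
    have hy0 := (ha.trans_le (haf y hy)).ne'
    calc |(f x)⁻¹ - (f y)⁻¹| = |(f x)⁻¹| * |f x - f y| * |(f y)⁻¹| := by
          rw [inv_sub_inv' hx0 hy0, abs_mul, abs_mul, abs_sub_comm (f y)]
      _ ≤ a⁻¹ * (K * |x - y| ^ ε) * a⁻¹ := by
        gcongr
        · exact hb x hx
        · exact hf.2 x hx y hy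
        · exact hb y hy
      _ = (a⁻¹ * K * a⁻¹) * |x - y| ^ ε := by ring
      _ ≤ max a⁻¹ (a⁻¹ * K * a⁻¹) * |x - y| ^ ε := by
        gcongr
        exact le_max_right _ _
  | succ m ih =>
    obtain ⟨L, hL⟩ := ih (hf.of_succ hε hε1)
    have hd := ((const ε m (-1)).mul hε hε1 hf.2.2).mul hε hε1 (hL.mul hε hε1 hL)
    refine ⟨_, fun x hx => (hb x hx).trans (le_max_left _ _),
      fun x hx => (hf.2.1 x hx).inv (ha.trans_le (haf x hx)).ne',
      (hd.mono (le_max_right a⁻¹ _)).congr fun x hx => ?_⟩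
    rw [derivWithin_fun_inv' (hf.2.1 x hx) (ha.trans_le (haf x hx)).ne']
    field_simp

theorem exists_of_contDiffOn (hf : ContDiffOn ℝ m f I01) {H : ℝ}
    (hH : HolderBoundOn01 ε H (iteratedDerivWithin m f I01)) : ∃ K, HolderNormLE ε m K f := by
  obtain ⟨B, hB⟩ := isCompact_Icc.exists_bound_of_continuousOn hf.continuousOn
  induction m generalizing f B with
  | zero =>
    refine ⟨max B H, fun x hx => (hB x hx).trans (le_max_left _ _), fun x hx y hy => ?_⟩
    have := hH x hx y hy
    rw [iteratedDerivWithin_zero] at this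
    exact this.trans (mul_le_mul_of_nonneg_right (le_max_right _ _)
      (Real.rpow_nonneg (abs_nonneg _) _))
  | succ m ih =>
    obtain ⟨hd, -, hf'⟩ := (contDiffOn_succ_iff_derivWithin uniqueDiffOn_I01).1
      (by exact_mod_cast hf : ContDiffOn ℝ ((m : WithTop ℕ∞) + 1) f I01)
    obtain ⟨B', hB'⟩ := isCompact_Icc.exists_bound_of_continuousOn hf'.continuousOn
    rw [iteratedDerivWithin_succ'] at hH
    obtain ⟨K, hK⟩ := ih hf' hH B' hB'
    exact ⟨max B K, fun x hx => (hB x hx).trans (le_max_left _ _), hd, hK.mono (le_max_right _ _)⟩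

theorem abs_iteratedDerivWithin_le (hf : HolderNormLE ε m K f) {t : ℕ} (ht : t ≤ m) :
    ∀ x ∈ I01, |iteratedDerivWithin t f I01 x| ≤ K := by
  induction m generalizing f t with
  | zero =>
    obtain rfl : t = 0 := by omega
    simpa only [iteratedDerivWithin_zero] using hf.1
  | succ m ih =>
    cases t with
    | zero => simpa only [iteratedDerivWithin_zero] using hf.1
    | succ t =>
      rw [iteratedDerivWithin_succ']
      exact ih hf.2.2 (by omega)

theorem holder_iteratedDerivWithin (hf : HolderNormLE ε m K f) :
    HolderBoundOn01 ε K (iteratedDerivWithin m f I01) := by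
  induction m generalizing f with
  | zero => simpa only [iteratedDerivWithin_zero] using hf.2
  | succ m ih =>
    rw [iteratedDerivWithin_succ']
    exact ih hf.2.2

end HolderNormLE

theorem abs_log_sub_log_le {a b c : ℝ} (hc : 0 < c) (ha : c ≤ a) (hb : c ≤ b) :
    |Real.log a - Real.log b| ≤ |a - b| / c := by
  have key : ∀ {u v : ℝ}, c ≤ u → c ≤ v → Real.log u - Real.log v ≤ |u - v| / c := by
    intro u v hu hv
    have hu0 := hc.trans_le hu
    have hv0 := hc.trans_le hv
    rw [← Real.log_div hu0.ne' hv0.ne']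
    calc Real.log (u / v) ≤ u / v - 1 := Real.log_le_sub_one_of_pos (div_pos hu0 hv0)
      _ = (u - v) / v := by field_simp
      _ ≤ |u - v| / v := by gcongr; exact le_abs_self _
      _ ≤ |u - v| / c := by gcongr
  rw [abs_le]
  have := key hb ha
  rw [abs_sub_comm b a] at this
  exact ⟨by linarith, key ha hb⟩

theorem abs_sub_le_mul_abs_log_sub_log {a b s : ℝ} (ha : 0 < a) (hb : 0 < b) (has : a ≤ s)
    (hbs : b ≤ s) : |a - b| ≤ s * |Real.log a - Real.log b| := by
  have key : ∀ {u v : ℝ}, 0 < u → 0 < v → u ≤ s → u - v ≤ s * |Real.log u - Real.log v| := by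
    intro u v hu hv hus
    have h := Real.log_le_sub_one_of_pos (div_pos hv hu)
    rw [Real.log_div hv.ne' hu.ne'] at h
    calc u - v = u * (1 - v / u) := by field_simp
      _ ≤ u * |Real.log u - Real.log v| := by
        gcongr
        exact le_trans (by linarith) (le_abs_self _)
      _ ≤ s * |Real.log u - Real.log v| := by gcongr
  rw [abs_le]
  have := key hb ha hbs
  rw [abs_sub_comm] at this
  exact ⟨by linarith, key ha hb has⟩

section WordMap

variable {d : ℕ} {g : Fin d → ℝ → ℝ} {θ : ℝ}

theorem wordMap_append_singleton (g : Fin d → ℝ → ℝ) (w : List (Fin d)) (i : Fin d) :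
    wordMap g (w ++ [i]) = g i ∘ wordMap g w := by
  induction w with
  | nil => rfl
  | cons j w ih =>
    funext x
    exact congrFun ih (g j x)

theorem mapsTo_wordMap (hmaps : ∀ i, MapsTo (g i) I01 I01) (w : List (Fin d)) :
    MapsTo (wordMap g w) I01 I01 := by
  induction w with
  | nil => exact mapsTo_id _
  | cons j w ih => exact fun x hx => ih (hmaps j hx)

theorem differentiableOn_wordMap (hmaps : ∀ i, MapsTo (g i) I01 I01)
    (hdiff : ∀ i, DifferentiableOn ℝ (g i) I01) (w : List (Fin d)) :
    DifferentiableOn ℝ (wordMap g w) I01 := by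
  induction w with
  | nil => exact differentiableOn_id
  | cons j w ih => exact ih.comp (hdiff j) (hmaps j)

theorem derivWithin_wordMap_append_singleton (hmaps : ∀ i, MapsTo (g i) I01 I01)
    (hdiff : ∀ i, DifferentiableOn ℝ (g i) I01) (w : List (Fin d)) (i : Fin d) {x : ℝ}
    (hx : x ∈ I01) : derivWithin (wordMap g (w ++ [i])) I01 x =
      derivWithin (g i) I01 (wordMap g w x) * derivWithin (wordMap g w) I01 x := by
  rw [wordMap_append_singleton]
  exact derivWithin_comp x (hdiff i _ (mapsTo_wordMap hmaps w hx))
    (differentiableOn_wordMap hmaps hdiff w x hx) (mapsTo_wordMap hmaps w)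

theorem derivWithin_wordMap_nil {x : ℝ} (hx : x ∈ I01) :
    derivWithin (wordMap g []) I01 x = 1 :=
  derivWithin_id x I01 (uniqueDiffOn_I01 x hx)

theorem derivWithin_wordMap_mem_Ioc (hmaps : ∀ i, MapsTo (g i) I01 I01)
    (hdiff : ∀ i, DifferentiableOn ℝ (g i) I01)
    (hg' : ∀ i, ∀ x ∈ I01, derivWithin (g i) I01 x ∈ Ioc 0 θ) (w : List (Fin d)) :
    ∀ x ∈ I01, derivWithin (wordMap g w) I01 x ∈ Ioc 0 (θ ^ w.length) := by
  induction w using List.reverseRecOn with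
  | nil => exact fun x hx => by simp [derivWithin_wordMap_nil hx]
  | append_singleton w i ih =>
    intro x hx
    rw [derivWithin_wordMap_append_singleton hmaps hdiff w i hx, List.length_append,
      List.length_singleton, pow_succ']
    have h1 := hg' i _ (mapsTo_wordMap hmaps w hx)
    have h2 := ih x hx
    exact ⟨mul_pos h1.1 h2.1, mul_le_mul h1.2 h2.2 h2.1.le (h1.1.le.trans h1.2)⟩

/-- Bounded distortion. -/
theorem exists_holder_log_derivWithin_wordMap {ε a K : ℝ} (hε : 0 < ε)
    (hmaps : ∀ i, MapsTo (g i) I01 I01) (hdiff : ∀ i, DifferentiableOn ℝ (g i) I01)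
    (hθ0 : 0 < θ) (hθ1 : θ < 1) (hg' : ∀ i, ∀ x ∈ I01, derivWithin (g i) I01 x ∈ Ioc 0 θ)
    (ha : 0 < a) (hga : ∀ i, ∀ x ∈ I01, a ≤ derivWithin (g i) I01 x) (hK : 0 ≤ K)
    (hgK : ∀ i, HolderBoundOn01 ε K (derivWithin (g i) I01)) :
    ∃ A ≥ 0, ∀ w : List (Fin d),
      HolderBoundOn01 ε A (fun x => Real.log (derivWithin (wordMap g w) I01 x)) := by
  have hr1 : θ ^ ε < 1 := Real.rpow_lt_one hθ0.le hθ1 hε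
  have hr0 : 0 < θ ^ ε := Real.rpow_pos_of_pos hθ0 ε
  set r := θ ^ ε with hr
  set A := K / a / (1 - r)
  have hA0 : 0 ≤ A := div_nonneg (div_nonneg hK ha.le) (by linarith)
  have hAr : A * (1 - r) = K / a := div_mul_cancel₀ _ (by linarith)
  have key : ∀ w : List (Fin d), HolderBoundOn01 ε (A * (1 - r ^ w.length))
      (fun x => Real.log (derivWithin (wordMap g w) I01 x)) := by
    intro w
    induction w using List.reverseRecOn with
    | nil =>
      intro x hx y hy
      simp [derivWithin_wordMap_nil hx, derivWithin_wordMap_nil hy]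
    | append_singleton w i ih =>
      intro x hx y hy
      have hGx := mapsTo_wordMap hmaps w hx
      have hGy := mapsTo_wordMap hmaps w hy
      have hG' := derivWithin_wordMap_mem_Ioc hmaps hdiff hg' w
      have hlip : |wordMap g w x - wordMap g w y| ≤ θ ^ w.length * |x - y| :=
        abs_sub_le_of_abs_derivWithin_le (differentiableOn_wordMap hmaps hdiff w)
          (fun z hz => by rw [abs_of_pos (hG' z hz).1]; exact (hG' z hz).2) hx hy
      have hlog : |Real.log (derivWithin (g i) I01 (wordMap g w x)) -
          Real.log (derivWithin (g i) I01 (wordMap g w y))| ≤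
            K / a * r ^ w.length * |x - y| ^ ε := by
        calc _ ≤ |derivWithin (g i) I01 (wordMap g w x) -
              derivWithin (g i) I01 (wordMap g w y)| / a :=
              abs_log_sub_log_le ha (hga i _ hGx) (hga i _ hGy)
          _ ≤ K * (θ ^ w.length * |x - y|) ^ ε / a := by
            gcongr
            refine (hgK i _ hGx _ hGy).trans ?_
            gcongr
          _ = K / a * r ^ w.length * |x - y| ^ ε := by
            rw [Real.mul_rpow (by positivity) (abs_nonneg _), hr, ← Real.rpow_natCast_mul hθ0.le,
              mul_comm (_ : ℝ) ε, Real.rpow_mul_natCast hθ0.le]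
            ring
      have hold := ih x hx y hy
      simp only [derivWithin_wordMap_append_singleton hmaps hdiff w i hx,
        derivWithin_wordMap_append_singleton hmaps hdiff w i hy, List.length_append,
        List.length_singleton] at hold ⊢
      rw [Real.log_mul (hg' i _ hGx).1.ne' (hG' x hx).1.ne',
        Real.log_mul (hg' i _ hGy).1.ne' (hG' y hy).1.ne', add_sub_add_comm]
      refine (abs_add_le _ _).trans ((add_le_add hlog hold).trans (le_of_eq ?_))
      rw [← hAr]
      ring
  refine ⟨A, hA0, fun w x hx y hy => (key w x hx y hy).trans ?_⟩
  gcongr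
  exact mul_le_of_le_one_right hA0 (by linarith [pow_pos hr0 w.length])

/-- The nonlinearities (second derivative over first derivative) of the `wordMap g w` are uniformly
bounded in `C^{m+ε}` as soon as the first derivatives are bounded in `C^{m+ε}` by a multiple of
`θ ^ w.length`. -/
theorem exists_nonlinearity_wordMap {ε K C : ℝ} (hε : 0 < ε) (hε1 : ε ≤ 1) (m : ℕ)
    (hmaps : ∀ i, MapsTo (g i) I01 I01) (hdiff : ∀ i, DifferentiableOn ℝ (g i) I01)
    (hdiff2 : ∀ i, DifferentiableOn ℝ (derivWithin (g i) I01) I01)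
    (hθ0 : 0 < θ) (hθ1 : θ < 1) (hg' : ∀ i, ∀ x ∈ I01, derivWithin (g i) I01 x ∈ Ioc 0 θ)
    (hK : 0 ≤ K)
    (hgK : ∀ i, HolderNormLE ε m K
      (fun x => derivWithin (derivWithin (g i) I01) I01 x * (derivWithin (g i) I01 x)⁻¹))
    (hC : 1 ≤ C)
    (hw : ∀ w : List (Fin d), HolderNormLE ε m (C * θ ^ w.length)
      (derivWithin (wordMap g w) I01)) :
    ∃ A ≥ 0, ∀ w : List (Fin d), ∃ N : ℝ → ℝ, HolderNormLE ε m A N ∧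
      DifferentiableOn ℝ (derivWithin (wordMap g w) I01) I01 ∧
      ∀ x ∈ I01, derivWithin (derivWithin (wordMap g w) I01) I01 x =
        derivWithin (wordMap g w) I01 x * N x := by
  obtain ⟨c, hc, hcomp⟩ := HolderNormLE.exists_comp hε hε1 m hC
  have hC0 : 0 ≤ C := zero_le_one.trans hC
  have hG : ∀ w : List (Fin d), HolderNormLE ε (m + 1) C (wordMap g w) := fun w =>
    ⟨fun x hx => by
      have := mapsTo_wordMap hmaps w hx
      rw [abs_of_nonneg this.1]
      exact this.2.trans hC,
    differentiableOn_wordMap hmaps hdiff w,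
    (hw w).mono (mul_le_of_le_one_right hC0 (pow_le_one₀ hθ0.le hθ1.le))⟩
  set B := 2 ^ (m + 1) * (c * K * C) with hB
  have hB0 : 0 ≤ B := by positivity
  set A := B / (1 - θ)
  have hA0 : 0 ≤ A := div_nonneg hB0 (by linarith)
  have hAB : A * (1 - θ) = B := div_mul_cancel₀ _ (by linarith)
  refine ⟨A, hA0, fun w => ?_⟩
  suffices h : ∃ N : ℝ → ℝ, HolderNormLE ε m (A * (1 - θ ^ w.length)) N ∧
      DifferentiableOn ℝ (derivWithin (wordMap g w) I01) I01 ∧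
      ∀ x ∈ I01, derivWithin (derivWithin (wordMap g w) I01) I01 x =
        derivWithin (wordMap g w) I01 x * N x by
    obtain ⟨N, hN, h⟩ := h
    exact ⟨N, hN.mono (mul_le_of_le_one_right hA0 (by linarith [pow_pos hθ0 w.length])), h⟩
  induction w using List.reverseRecOn with
  | nil =>
    have hone : EqOn (derivWithin (wordMap g []) I01) (fun _ => (1 : ℝ)) I01 :=
      fun x hx => derivWithin_wordMap_nil hx
    refine ⟨fun _ => 0, ?_, (differentiableOn_const 1).congr hone, fun x hx => ?_⟩
    · simpa using HolderNormLE.const ε m 0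
    · rw [derivWithin_congr hone (hone hx)]
      simp
  | append_singleton w i ih =>
    obtain ⟨N, hN, hd, hNw⟩ := ih
    have hGI := mapsTo_wordMap hmaps w
    have hGd := differentiableOn_wordMap hmaps hdiff w
    have heq : EqOn (derivWithin (wordMap g (w ++ [i])) I01)
        (fun x => derivWithin (g i) I01 (wordMap g w x) * derivWithin (wordMap g w) I01 x) I01 :=
      fun x hx => derivWithin_wordMap_append_singleton hmaps hdiff w i hx
    have hcd : DifferentiableOn ℝ (fun x => derivWithin (g i) I01 (wordMap g w x)) I01 :=
      (hdiff2 i).comp hGd hGI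
    have hnew := (hcomp K _ _ (hgK i) (hG w) hGI).mul hε hε1 (hw w)
    refine ⟨_, (hnew.add hN).mono (le_of_eq ?_), (hcd.mul hd).congr heq, fun x hx => ?_⟩
    · rw [List.length_append, List.length_singleton, pow_succ]
      calc _ = B * θ ^ w.length + A * (1 - θ ^ w.length) := by rw [hB]; ring
        _ = _ := by rw [← hAB]; ring
    · rw [derivWithin_congr heq (heq hx), heq hx,
        derivWithin_fun_mul (hcd x hx) (hd x hx), hNw x hx]
      have hcx : derivWithin (fun x => derivWithin (g i) I01 (wordMap g w x)) I01 x =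
          derivWithin (derivWithin (g i) I01) I01 (wordMap g w x) *
            derivWithin (wordMap g w) I01 x :=
        derivWithin_comp x (hdiff2 i _ (hGI hx)) (hGd x hx) hGI
      have hne := (hg' i _ (hGI hx)).1.ne'
      rw [hcx]
      field_simp

theorem exists_holderNormLE_derivWithin_wordMap {ε a K : ℝ} {q : ℕ} (hε : 0 < ε) (hε1 : ε ≤ 1)
    (hmaps : ∀ i, MapsTo (g i) I01 I01) (hdiff : ∀ i, DifferentiableOn ℝ (g i) I01)
    (hθ0 : 0 < θ) (hθ1 : θ < 1) (hg' : ∀ i, ∀ x ∈ I01, derivWithin (g i) I01 x ∈ Ioc 0 θ)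
    (ha : 0 < a) (hga : ∀ i, ∀ x ∈ I01, a ≤ derivWithin (g i) I01 x) (hK : 0 ≤ K)
    (hgK : ∀ i, HolderNormLE ε q K (derivWithin (g i) I01)) :
    ∃ C ≥ 1, ∀ (w : List (Fin d)) (s : ℝ), (∀ x ∈ I01, derivWithin (wordMap g w) I01 x ≤ s) →
      HolderNormLE ε q (C * s) (derivWithin (wordMap g w) I01) := by
  induction q with
  | zero =>
    obtain ⟨A, hA0, hA⟩ := exists_holder_log_derivWithin_wordMap hε hmaps hdiff hθ0 hθ1 hg' ha hga
      hK fun i => (hgK i).2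
    refine ⟨max 1 A, le_max_left _ _, fun w s hs => ?_⟩
    have hG' := derivWithin_wordMap_mem_Ioc hmaps hdiff hg' w
    have hs0 : 0 ≤ s := (hG' 0 zero_mem_I01).1.le.trans (hs 0 zero_mem_I01)
    refine ⟨fun x hx => ?_, fun x hx y hy => ?_⟩
    · rw [abs_of_pos (hG' x hx).1]
      exact (hs x hx).trans (le_mul_of_one_le_left hs0 (le_max_left _ _))
    · calc _ ≤ s * |Real.log (derivWithin (wordMap g w) I01 x) -
            Real.log (derivWithin (wordMap g w) I01 y)| :=
            abs_sub_le_mul_abs_log_sub_log (hG' x hx).1 (hG' y hy).1 (hs x hx) (hs y hy)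
        _ ≤ s * (A * |x - y| ^ ε) := by
          gcongr
          exact hA w x hx y hy
        _ ≤ s * (max 1 A * |x - y| ^ ε) := by
          gcongr
          exact le_max_right _ _
        _ = max 1 A * s * |x - y| ^ ε := by ring
  | succ m ih =>
    obtain ⟨C, hC, hCw⟩ := ih fun i => (hgK i).of_succ hε hε1
    have hψ : ∀ i, ∃ L, HolderNormLE ε m L
        (fun x => derivWithin (derivWithin (g i) I01) I01 x * (derivWithin (g i) I01 x)⁻¹) := by
      intro i
      obtain ⟨L, hL⟩ := ((hgK i).of_succ hε hε1).exists_inv hε hε1 ha (hga i)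
      exact ⟨_, (hgK i).2.2.mul hε hε1 hL⟩
    choose L hL using hψ
    obtain ⟨M, hM⟩ := Finite.exists_le L
    obtain ⟨A, hA0, hA⟩ := exists_nonlinearity_wordMap hε hε1 m hmaps hdiff
      (fun i => (hgK i).2.1) hθ0 hθ1 hg' (le_max_left 0 M)
      (fun i => (hL i).mono ((hM i).trans (le_max_right _ _))) hC
      (fun w => hCw w _ fun x hx => (derivWithin_wordMap_mem_Ioc hmaps hdiff hg' w x hx).2)
    refine ⟨max C (2 ^ (m + 1) * (C * A)), hC.trans (le_max_left _ _), fun w s hs => ?_⟩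
    have hG' := derivWithin_wordMap_mem_Ioc hmaps hdiff hg' w
    have hs0 : 0 ≤ s := (hG' 0 zero_mem_I01).1.le.trans (hs 0 zero_mem_I01)
    obtain ⟨N, hN, hd, hNw⟩ := hA w
    refine ⟨fun x hx => ((hCw w s hs).abs_le x hx).trans
      (mul_le_mul_of_nonneg_right (le_max_left _ _) hs0), hd,
      (((hCw w s hs).mul hε hε1 hN).mono ?_).congr hNw⟩
    calc _ = 2 ^ (m + 1) * (C * A) * s := by ring
      _ ≤ _ := mul_le_mul_of_nonneg_right (le_max_right _ _) hs0

end WordMap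

/-- for a `C^{k+ε}` Cantor system, all derivatives of a composition `G_w` up
to order `k+ε` are controlled by its first derivative, uniformly over all words `w`. -/
theorem stmt11 (d k : ℕ) (hd : 2 ≤ d) (hk : 1 ≤ k) (ε : ℝ) (hε : ε ∈ Set.Ioc (0:ℝ) 1)
    (g : Fin d → ℝ → ℝ) (hg : IsCantorSystem k ε g) :
    ∃ C > 0, ∀ w : List (Fin d),
      (∀ t : ℕ, 1 ≤ t → t ≤ k → ∀ x ∈ I01,
        |iteratedDerivWithin t (wordMap g w) I01 x|
          ≤ C * ⨆ y : I01, |derivWithin (wordMap g w) I01 (y : ℝ)|) ∧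
      (∀ x ∈ I01, ∀ y ∈ I01,
        |iteratedDerivWithin k (wordMap g w) I01 x - iteratedDerivWithin k (wordMap g w) I01 y|
          ≤ (C * ⨆ z : I01, |derivWithin (wordMap g w) I01 (z : ℝ)|) * |x - y| ^ ε) := by
  obtain ⟨hε0, hε1⟩ := hε
  obtain ⟨q, rfl⟩ : ∃ q, k = q + 1 := ⟨k - 1, by omega⟩
  have : Nonempty (Fin d) := ⟨⟨0, by omega⟩⟩
  have hsmooth : ∀ i, DifferentiableOn ℝ (g i) I01 ∧
      ContDiffOn ℝ q (derivWithin (g i) I01) I01 := fun i => by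
    obtain ⟨h1, -, h2⟩ := (contDiffOn_succ_iff_derivWithin uniqueDiffOn_I01).1
      (by exact_mod_cast hg.smooth i : ContDiffOn ℝ ((q : WithTop ℕ∞) + 1) (g i) I01)
    exact ⟨h1, h2⟩
  choose u huI hu using fun i => isCompact_Icc.exists_isMaxOn ⟨0, zero_mem_I01⟩
    (hsmooth i).2.continuousOn
  choose l hlI hl using fun i => isCompact_Icc.exists_isMinOn ⟨0, zero_mem_I01⟩
    (hsmooth i).2.continuousOn
  obtain ⟨i₁, hi₁⟩ := Finite.exists_max fun i => derivWithin (g i) I01 (u i)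
  obtain ⟨i₀, hi₀⟩ := Finite.exists_min fun i => derivWithin (g i) I01 (l i)
  have hgK : ∀ i, ∃ K, HolderNormLE ε q K (derivWithin (g i) I01) := fun i => by
    obtain ⟨H, -, hH⟩ := hg.holder i
    rw [iteratedDerivWithin_succ'] at hH
    exact HolderNormLE.exists_of_contDiffOn (hsmooth i).2 hH
  choose K hK using hgK
  obtain ⟨M, hM⟩ := Finite.exists_le K
  have hg' : ∀ i, ∀ x ∈ I01,
      derivWithin (g i) I01 x ∈ Ioc 0 (derivWithin (g i₁) I01 (u i₁)) :=
    fun i x hx => ⟨hg.deriv_pos i x hx, (hu i hx).trans (hi₁ i)⟩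
  obtain ⟨C, hC, hCw⟩ := exists_holderNormLE_derivWithin_wordMap hε0 hε1 hg.maps
    (fun i => (hsmooth i).1) (hg.deriv_pos _ _ (huI i₁)) (hg.deriv_lt_one _ _ (huI i₁)) hg'
    (hg.deriv_pos _ _ (hlI i₀)) (fun i x hx => (hi₀ i).trans (hl i hx)) (le_max_left 0 M)
    (fun i => (hK i).mono ((hM i).trans (le_max_right _ _)))
  refine ⟨C, zero_lt_one.trans_le hC, fun w => ?_⟩
  have hG' := derivWithin_wordMap_mem_Ioc hg.maps (fun i => (hsmooth i).1) hg' w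
  have hbdd : BddAbove (range fun y : I01 => |derivWithin (wordMap g w) I01 (y : ℝ)|) := by
    refine ⟨derivWithin (g i₁) I01 (u i₁) ^ w.length, ?_⟩
    rintro _ ⟨y, rfl⟩
    exact (abs_of_pos (hG' y y.2).1).trans_le (hG' y y.2).2
  have hw := hCw w _ fun x hx => (le_abs_self _).trans (le_ciSup hbdd ⟨x, hx⟩)
  refine ⟨fun t ht htk => ?_, ?_⟩
  · obtain ⟨t, rfl⟩ : ∃ t', t = t' + 1 := ⟨t - 1, by omega⟩
    rw [iteratedDerivWithin_succ']
    exact hw.abs_iteratedDerivWithin_le (by omega)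
  · rw [iteratedDerivWithin_succ']
    exact hw.holder_iteratedDerivWithin
end

section
/- Let g_1,…,g_d be a C^{k+ε} Cantor system on [0,1]. Fix j ∈ Σ_d^dual and n ≥ 0, and set u := j|_n. For m > n let H_m := g_{j_m} ∘ ⋯ ∘ g_{j_{n+1}} and let F_m : [0,1] → [0,1] be the renormalization F_m := (L_m)⁻¹ ∘ H_m ∘ L, where L and L_m are the increasing affine bijections from [0,1] onto I_u and onto I_{j|_m} respectively. Then the sequence (F_m) converges in C^k norm: for every integer t with 0 ≤ t ≤ k the functions D^t F_m converge uniformly on [0,1] as m → ∞; and the limit F is an increasing C^k diffeomorphism of [0,1] whose k-th derivative is ε-Hölder continuous. -/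
open Set Filter

/-- `C^{k+ε}` bound on `[0,1]`: `f` has `k` successive derivatives there, all of them and `f`
bounded by `B`, and the `k`-th one satisfies an `ε`-Hölder bound with constant `B`. -/
def HolderCk (ε : ℝ) : ℕ → (ℝ → ℝ) → ℝ → Prop
  | 0, f, B => (∀ x ∈ I01, |f x| ≤ B) ∧ HolderBoundOn01 ε B f
  | k + 1, f, B => (∀ x ∈ I01, |f x| ≤ B) ∧
      ∃ f' : ℝ → ℝ, (∀ x ∈ I01, HasDerivWithinAt f (f' x) I01 x) ∧ HolderCk ε k f' B

theorem HasDerivWithinAt.comp_affine {f : ℝ → ℝ} {f' a l x : ℝ}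
    (h : HasDerivWithinAt f f' I01 (a + l * x)) (hm : MapsTo (fun x => a + l * x) I01 I01) :
    HasDerivWithinAt (fun x => f (a + l * x)) (l * f') I01 x := by
  have hA : HasDerivWithinAt (fun x => a + l * x) l I01 x := by
    simpa using ((hasDerivWithinAt_id x I01).const_mul l).const_add a
  rw [mul_comm]
  exact h.comp x hA hm

namespace HolderCk

variable {ε : ℝ}

theorem abs_apply_le {k : ℕ} {f : ℝ → ℝ} {B : ℝ} (h : HolderCk ε k f B) : ∀ x ∈ I01, |f x| ≤ B := by
  cases k <;> exact h.1

theorem nonneg {k : ℕ} {f : ℝ → ℝ} {B : ℝ} (h : HolderCk ε k f B) : 0 ≤ B :=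
  (abs_nonneg _).trans (h.abs_apply_le 0 ⟨le_rfl, zero_le_one⟩)

theorem congr {k : ℕ} {f g : ℝ → ℝ} {B : ℝ} (h : HolderCk ε k f B) (hfg : EqOn g f I01) :
    HolderCk ε k g B := by
  cases k with
  | zero =>
    refine ⟨fun x hx => ?_, fun x hx y hy => ?_⟩
    · rw [hfg hx]; exact h.1 x hx
    · rw [hfg hx, hfg hy]; exact h.2 x hx y hy
  | succ k =>
    obtain ⟨h0, f', hd, hf'⟩ := h
    refine ⟨fun x hx => ?_, f', fun x hx => (hd x hx).congr hfg (hfg hx), hf'⟩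
    rw [hfg hx]; exact h0 x hx

theorem mono {k : ℕ} {f : ℝ → ℝ} {A B : ℝ} (h : HolderCk ε k f A) (hAB : A ≤ B) :
    HolderCk ε k f B := by
  induction k generalizing f with
  | zero =>
    refine ⟨fun x hx => (h.1 x hx).trans hAB, fun x hx y hy => (h.2 x hx y hy).trans ?_⟩
    gcongr
  | succ k ih =>
    obtain ⟨h0, f', hd, hf'⟩ := h
    exact ⟨fun x hx => (h0 x hx).trans hAB, f', hd, ih hf'⟩

theorem const (k : ℕ) {c B : ℝ} (hc : |c| ≤ B) : HolderCk ε k (fun _ => c) B := by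
  have hB : 0 ≤ B := (abs_nonneg c).trans hc
  induction k generalizing c with
  | zero =>
    refine ⟨fun _ _ => hc, fun x _ y _ => ?_⟩
    simp only [sub_self, abs_zero]
    positivity
  | succ k ih =>
    exact ⟨fun _ _ => hc, fun _ => 0, fun x _ => hasDerivWithinAt_const x _ c, ih (by simpa)⟩

theorem id (hε : ε ∈ Ioc (0 : ℝ) 1) (k : ℕ) : HolderCk ε k (fun x => x) 1 := by
  have h0 : ∀ x ∈ I01, |x| ≤ 1 := fun x hx => abs_le.2 ⟨by linarith [hx.1], hx.2⟩
  cases k with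
  | zero =>
    refine ⟨h0, fun x hx y hy => ?_⟩
    rw [one_mul]
    exact Real.self_le_rpow_of_le_one (abs_nonneg _)
      (abs_le.2 ⟨by linarith [hx.1, hy.2], by linarith [hx.2, hy.1]⟩) hε.2
  | succ k =>
    exact ⟨h0, fun _ => 1, fun x _ => hasDerivWithinAt_id x _, const k (by simp)⟩

theorem add {k : ℕ} {f g : ℝ → ℝ} {A B : ℝ} (hf : HolderCk ε k f A) (hg : HolderCk ε k g B) :
    HolderCk ε k (fun x => f x + g x) (A + B) := by
  induction k generalizing f g with
  | zero =>
    refine ⟨fun x hx => (abs_add_le _ _).trans (add_le_add (hf.1 x hx) (hg.1 x hx)),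
      fun x hx y hy => ?_⟩
    rw [add_sub_add_comm, add_mul]
    exact (abs_add_le _ _).trans (add_le_add (hf.2 x hx y hy) (hg.2 x hx y hy))
  | succ k ih =>
    obtain ⟨hf0, f', hfd, hf'⟩ := hf
    obtain ⟨hg0, g', hgd, hg'⟩ := hg
    exact ⟨fun x hx => (abs_add_le _ _).trans (add_le_add (hf0 x hx) (hg0 x hx)), _,
      fun x hx => (hfd x hx).add (hgd x hx), ih hf' hg'⟩

theorem const_mul {k : ℕ} {f : ℝ → ℝ} {A : ℝ} (c : ℝ) (hf : HolderCk ε k f A) :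
    HolderCk ε k (fun x => c * f x) (|c| * A) := by
  induction k generalizing f with
  | zero =>
    refine ⟨fun x hx => ?_, fun x hx y hy => ?_⟩
    · rw [abs_mul]
      exact mul_le_mul_of_nonneg_left (hf.1 x hx) (abs_nonneg c)
    · rw [← mul_sub, abs_mul, mul_assoc]
      exact mul_le_mul_of_nonneg_left (hf.2 x hx y hy) (abs_nonneg c)
  | succ k ih =>
    obtain ⟨hf0, f', hfd, hf'⟩ := hf
    refine ⟨fun x hx => ?_, _, fun x hx => (hfd x hx).const_mul c, ih hf'⟩
    rw [abs_mul]
    exact mul_le_mul_of_nonneg_left (hf0 x hx) (abs_nonneg c)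

theorem lipschitz {k : ℕ} {f : ℝ → ℝ} {B : ℝ} (h : HolderCk ε (k + 1) f B) :
    ∀ x ∈ I01, ∀ y ∈ I01, |f x - f y| ≤ B * |x - y| := by
  obtain ⟨-, f', hd, hf'⟩ := h
  exact fun x hx y hy =>
    (convex_Icc (0 : ℝ) 1).norm_image_sub_le_of_norm_hasDerivWithin_le hd hf'.abs_apply_le hy hx

theorem of_succ (hε : ε ∈ Ioc (0 : ℝ) 1) {k : ℕ} {f : ℝ → ℝ} {B : ℝ}
    (h : HolderCk ε (k + 1) f B) : HolderCk ε k f B := by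
  induction k generalizing f with
  | zero =>
    refine ⟨h.1, fun x hx y hy => (h.lipschitz x hx y hy).trans ?_⟩
    have := (id hε 0).2 x hx y hy
    rw [one_mul] at this
    exact mul_le_mul_of_nonneg_left this h.nonneg
  | succ k ih =>
    obtain ⟨h0, f', hd, hf'⟩ := h
    exact ⟨h0, f', hd, ih hf'⟩

theorem holderBoundOn01_self (hε : ε ∈ Ioc (0 : ℝ) 1) {k : ℕ} {f : ℝ → ℝ} {B : ℝ}
    (h : HolderCk ε k f B) : HolderBoundOn01 ε B f := by
  induction k with
  | zero => exact h.2
  | succ k ih => exact ih (h.of_succ hε)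

theorem mul (hε : ε ∈ Ioc (0 : ℝ) 1) {k : ℕ} {f g : ℝ → ℝ} {A B : ℝ} (hf : HolderCk ε k f A)
    (hg : HolderCk ε k g B) : HolderCk ε k (fun x => f x * g x) (2 ^ (k + 1) * (A * B)) := by
  have hA := hf.nonneg
  have hB := hg.nonneg
  have h0 : ∀ x ∈ I01, |f x * g x| ≤ A * B := fun x hx => by
    rw [abs_mul]
    exact mul_le_mul (hf.abs_apply_le x hx) (hg.abs_apply_le x hx) (abs_nonneg _) hA
  have h1 : ∀ x ∈ I01, |f x * g x| ≤ 2 ^ (k + 1) * (A * B) := fun x hx =>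
    (h0 x hx).trans (le_mul_of_one_le_left (mul_nonneg hA hB) (one_le_pow₀ one_le_two))
  induction k generalizing f g with
  | zero =>
    refine ⟨h1, fun x hx y hy => ?_⟩
    have e : f x * g x - f y * g y = f x * (g x - g y) + (f x - f y) * g y := by ring
    have h2 : |f x * (g x - g y)| ≤ A * (B * |x - y| ^ ε) := by
      rw [abs_mul]
      exact mul_le_mul (hf.1 x hx) (hg.2 x hx y hy) (abs_nonneg _) hA
    have h3 : |(f x - f y) * g y| ≤ (A * |x - y| ^ ε) * B := by
      rw [abs_mul]
      exact mul_le_mul (hf.2 x hx y hy) (hg.1 y hy) (abs_nonneg _) (by positivity)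
    rw [e]
    refine (abs_add_le _ _).trans ((add_le_add h2 h3).trans (le_of_eq ?_))
    ring
  | succ k ih =>
    have hf1 := hf.of_succ hε
    have hg1 := hg.of_succ hε
    obtain ⟨hf0, f', hfd, hf'⟩ := hf
    obtain ⟨hg0, g', hgd, hg'⟩ := hg
    have bound : ∀ {u v : ℝ → ℝ}, HolderCk ε k u A → HolderCk ε k v B →
        HolderCk ε k (fun x => u x * v x) (2 ^ (k + 1) * (A * B)) := fun {u v} hu hv => by
      have h2 : ∀ x ∈ I01, |u x * v x| ≤ A * B := fun x hx => by
        rw [abs_mul]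
        exact mul_le_mul (hu.abs_apply_le x hx) (hv.abs_apply_le x hx) (abs_nonneg _) hA
      exact ih hu hv h2 fun x hx =>
        (h2 x hx).trans (le_mul_of_one_le_left (mul_nonneg hA hB) (one_le_pow₀ one_le_two))
    refine ⟨h1, _, fun x hx => (hfd x hx).mul (hgd x hx), ?_⟩
    exact ((bound hf' hg1).add (bound hf1 hg')).mono (le_of_eq (by ring))

theorem exists_comp_bound (hε : ε ∈ Ioc (0 : ℝ) 1) (k : ℕ) {D : ℝ} (hD : 1 ≤ D) :
    ∃ C ≥ (1 : ℝ), ∀ (h f : ℝ → ℝ) (δ : ℝ), HolderCk ε k h δ → HolderCk ε k f D →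
      MapsTo f I01 I01 → (∀ x ∈ I01, ∀ y ∈ I01, |f x - f y| ≤ D * |x - y|) →
      HolderCk ε k (fun x => h (f x)) (C * δ) := by
  have hD0 : 0 ≤ D := zero_le_one.trans hD
  induction k with
  | zero =>
    refine ⟨D, hD, fun h f δ hh _ hm hL => ⟨fun x hx => (hh.1 _ (hm hx)).trans
      (le_mul_of_one_le_left hh.nonneg hD), fun x hx y hy => ?_⟩⟩
    have hδ := hh.nonneg
    calc |h (f x) - h (f y)| ≤ δ * |f x - f y| ^ ε := hh.2 _ (hm hx) _ (hm hy)
      _ ≤ δ * (D * |x - y|) ^ ε := by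
        gcongr
        · exact hε.1.le
        · exact hL x hx y hy
      _ = δ * (D ^ ε * |x - y| ^ ε) := by rw [Real.mul_rpow hD0 (abs_nonneg _)]
      _ ≤ δ * (D * |x - y| ^ ε) := by
        gcongr
        exact Real.rpow_le_self_of_one_le hD hε.2
      _ = D * δ * |x - y| ^ ε := by ring
  | succ k ih =>
    obtain ⟨C, hC, ih⟩ := ih
    have hE : 1 ≤ 2 ^ (k + 1) * (C * D) :=
      one_le_mul_of_one_le_of_one_le (one_le_pow₀ one_le_two)
        (one_le_mul_of_one_le_of_one_le hC hD)
    refine ⟨2 ^ (k + 1) * (C * D), hE, fun h f δ hh hf hm hL => ?_⟩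
    have hδ := hh.nonneg
    have hf1 := hf.of_succ hε
    obtain ⟨hh0, h', hhd, hh'⟩ := hh
    obtain ⟨hf0, f', hfd, hf'⟩ := hf
    refine ⟨fun x hx => (hh0 _ (hm hx)).trans (le_mul_of_one_le_left hδ hE), _,
      fun x hx => (hhd _ (hm hx)).comp x (hfd x hx) hm, ?_⟩
    exact ((ih h' f δ hh' hf1 hm hL).mul hε hf').mono (le_of_eq (by ring))

theorem tsum {k : ℕ} {h : ℕ → ℝ → ℝ} {a : ℕ → ℝ} (ha : Summable a)
    (hh : ∀ m, HolderCk ε k (h m) (a m)) :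
    HolderCk ε k (fun x => ∑' m, h m x) (∑' m, a m) := by
  have hs : ∀ x ∈ I01, Summable fun m => h m x := fun x hx =>
    ha.of_norm_bounded fun m => (hh m).abs_apply_le x hx
  have h0 : ∀ x ∈ I01, |∑' m, h m x| ≤ ∑' m, a m := fun x hx =>
    tsum_of_norm_bounded (E := ℝ) ha.hasSum fun m => (hh m).abs_apply_le x hx
  induction k generalizing h with
  | zero =>
    refine ⟨h0, fun x hx y hy => ?_⟩
    rw [← (hs x hx).tsum_sub (hs y hy)]
    exact tsum_of_norm_bounded (E := ℝ) (ha.hasSum.mul_right _) fun m => (hh m).2 x hx y hy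
  | succ k ih =>
    choose h' hd hh' using fun m => (hh m).2
    have hs' : ∀ x ∈ I01, Summable fun m => h' m x := fun x hx =>
      ha.of_norm_bounded fun m => (hh' m).abs_apply_le x hx
    have h0' : ∀ x ∈ I01, |∑' m, h' m x| ≤ ∑' m, a m := fun x hx =>
      tsum_of_norm_bounded (E := ℝ) ha.hasSum fun m => (hh' m).abs_apply_le x hx
    refine ⟨h0, fun x => ∑' m, h' m x, fun x hx => ?_, ih hh' hs' h0'⟩
    rw [hasDerivWithinAt_iff_tendsto_slope]
    have key := tendsto_tsum_of_dominated_convergence (𝓕 := nhdsWithin x (I01 \ {x}))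
      (f := fun y m => slope (h m) x y) (g := fun m => h' m x) ha
      (fun m => hasDerivWithinAt_iff_tendsto_slope.1 (hd m x hx)) (by
        filter_upwards [self_mem_nhdsWithin] with y hy m
        have hxy : 0 < |y - x| := abs_pos.2 (sub_ne_zero.2 hy.2)
        rw [slope_def_field, norm_div, Real.norm_eq_abs, Real.norm_eq_abs, div_le_iff₀ hxy]
        exact (hh m).lipschitz y hy.1 x hx)
    refine key.congr' ?_
    filter_upwards [self_mem_nhdsWithin] with y hy
    simp only [slope_def_field]
    rw [tsum_div_const, (hs y hy.1).tsum_sub (hs x hx)]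

theorem continuousOn (hε : ε ∈ Ioc (0 : ℝ) 1) {k : ℕ} {f : ℝ → ℝ} {B : ℝ}
    (h : HolderCk ε k f B) : ContinuousOn f I01 := by
  cases k with
  | zero =>
    intro x hx
    rw [ContinuousWithinAt, tendsto_iff_norm_sub_tendsto_zero]
    have hc : Tendsto (fun y => B * |y - x| ^ ε) (nhdsWithin x I01) (nhds 0) := by
      have : Continuous fun y => B * |y - x| ^ ε :=
        continuous_const.mul ((continuous_id.sub continuous_const).abs.rpow_const
          fun _ => Or.inr hε.1.le)
      have h0 := this.tendsto x
      rw [sub_self, abs_zero, Real.zero_rpow hε.1.ne', mul_zero] at h0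
      exact h0.mono_left nhdsWithin_le_nhds
    refine squeeze_zero' (Eventually.of_forall fun _ => norm_nonneg _) ?_ hc
    filter_upwards [self_mem_nhdsWithin] with y hy
    exact h.2 y hy x hx
  | succ k =>
    obtain ⟨-, f', hd, -⟩ := h
    exact fun x hx => (hd x hx).continuousWithinAt

theorem eqOn_derivWithin {f f' : ℝ → ℝ} (hd : ∀ x ∈ I01, HasDerivWithinAt f (f' x) I01 x) :
    EqOn (derivWithin f I01) f' I01 :=
  fun x hx => (hd x hx).derivWithin (uniqueDiffOn_Icc_zero_one x hx)

theorem contDiffOn (hε : ε ∈ Ioc (0 : ℝ) 1) {k : ℕ} {f : ℝ → ℝ} {B : ℝ}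
    (h : HolderCk ε k f B) : ContDiffOn ℝ k f I01 := by
  induction k generalizing f with
  | zero => exact contDiffOn_zero.2 (h.continuousOn hε)
  | succ k ih =>
    obtain ⟨-, f', hd, hf'⟩ := h
    rw [Nat.cast_succ, contDiffOn_succ_iff_derivWithin uniqueDiffOn_Icc_zero_one]
    exact ⟨fun x hx => (hd x hx).differentiableWithinAt, fun h => by simp at h,
      (ih hf').congr (eqOn_derivWithin hd)⟩

theorem abs_iteratedDerivWithin_le {k : ℕ} {f : ℝ → ℝ} {B : ℝ} (h : HolderCk ε k f B) {t : ℕ}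
    (ht : t ≤ k) : ∀ x ∈ I01, |iteratedDerivWithin t f I01 x| ≤ B := by
  induction t generalizing k f with
  | zero => simpa using h.abs_apply_le
  | succ t ih =>
    obtain ⟨k, rfl⟩ : ∃ l, k = l + 1 := ⟨k - 1, by omega⟩
    obtain ⟨-, f', hd, hf'⟩ := h
    intro x hx
    rw [iteratedDerivWithin_succ']
    exact ih (hf'.congr (eqOn_derivWithin hd)) (by omega) x hx

theorem holderBoundOn01 {k : ℕ} {f : ℝ → ℝ} {B : ℝ} (h : HolderCk ε k f B) :
    HolderBoundOn01 ε B (iteratedDerivWithin k f I01) := by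
  induction k generalizing f with
  | zero => simpa using h.2
  | succ k ih =>
    obtain ⟨-, f', hd, hf'⟩ := h
    rw [iteratedDerivWithin_succ']
    exact ih (hf'.congr (eqOn_derivWithin hd))

theorem exists_of_contDiffOn {k : ℕ} {f : ℝ → ℝ} {H : ℝ} (hf : ContDiffOn ℝ k f I01)
    (hH : HolderBoundOn01 ε H (iteratedDerivWithin k f I01)) : ∃ B, HolderCk ε k f B := by
  obtain ⟨C, hC⟩ := isCompact_Icc.exists_bound_of_continuousOn hf.continuousOn
  induction k generalizing f C with
  | zero =>
    refine ⟨max C H, fun x hx => (hC x hx).trans (le_max_left _ _), fun x hx y hy => ?_⟩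
    have h := hH x hx y hy
    simp only [iteratedDerivWithin_zero] at h
    refine h.trans ?_
    gcongr
    exact le_max_right _ _
  | succ k ih =>
    rw [Nat.cast_succ, contDiffOn_succ_iff_derivWithin uniqueDiffOn_Icc_zero_one] at hf
    rw [iteratedDerivWithin_succ'] at hH
    obtain ⟨C', hC'⟩ := isCompact_Icc.exists_bound_of_continuousOn hf.2.2.continuousOn
    obtain ⟨B, hB⟩ := ih hf.2.2 hH C' hC'
    exact ⟨max C B, fun x hx => (hC x hx).trans (le_max_left _ _), _,
      fun x hx => (hf.1 x hx).hasDerivWithinAt, hB.mono (le_max_right _ _)⟩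

theorem comp_affine {k : ℕ} {u : ℝ → ℝ} {B a l : ℝ} (hε : 0 ≤ ε) (hu : HolderCk ε k u B)
    (hl : 0 ≤ l) (hl1 : l ≤ 1) (hm : MapsTo (fun x => a + l * x) I01 I01) :
    HolderCk ε k (fun x => u (a + l * x)) B := by
  have hB := hu.nonneg
  induction k generalizing u with
  | zero =>
    refine ⟨fun x hx => hu.1 _ (hm hx), fun x hx y hy => (hu.2 _ (hm hx) _ (hm hy)).trans ?_⟩
    have h : |a + l * x - (a + l * y)| ≤ |x - y| := by
      rw [add_sub_add_left_eq_sub, ← mul_sub, abs_mul, abs_of_nonneg hl]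
      exact mul_le_of_le_one_left (abs_nonneg _) hl1
    gcongr
  | succ k ih =>
    obtain ⟨h0, u', hd, hu'⟩ := hu
    refine ⟨fun x hx => h0 _ (hm hx), fun x => l * u' (a + l * x), fun x hx => ?_,
      ((ih hu').const_mul l).mono ?_⟩
    · exact (hd _ (hm hx)).comp_affine hm
    · rw [abs_of_nonneg hl]
      exact mul_le_of_le_one_left hB hl1

/-- Zooming in on an interval of length `l` brings a function within `O(l ^ ε)` of a constant. -/
theorem comp_affine_sub_const {k : ℕ} {u : ℝ → ℝ} {B a l c : ℝ} (hε : ε ∈ Ioc (0 : ℝ) 1)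
    (hu : HolderCk ε k u B) (hl : 0 ≤ l) (hl1 : l ≤ 1)
    (hm : MapsTo (fun x => a + l * x) I01 I01)
    (hc : ∀ x ∈ I01, |u (a + l * x) - c| ≤ B * l ^ ε) :
    HolderCk ε k (fun x => u (a + l * x) - c) (B * l ^ ε) := by
  have hB := hu.nonneg
  cases k with
  | zero =>
    refine ⟨hc, fun x hx y hy => ?_⟩
    rw [sub_sub_sub_cancel_right]
    refine (hu.2 _ (hm hx) _ (hm hy)).trans (le_of_eq ?_)
    rw [add_sub_add_left_eq_sub, ← mul_sub, abs_mul, abs_of_nonneg hl,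
      Real.mul_rpow hl (abs_nonneg _), mul_assoc]
  | succ k =>
    obtain ⟨h0, u', hd, hu'⟩ := hu
    refine ⟨hc, fun x => l * u' (a + l * x), fun x hx => ?_,
      ((hu'.comp_affine hε.1.le hl hl1 hm).const_mul l).mono ?_⟩
    · exact ((hd _ (hm hx)).comp_affine hm).sub_const c
    · rw [abs_of_nonneg hl, mul_comm]
      gcongr
      exact Real.self_le_rpow_of_le_one hl hl1 hε.2

end HolderCk

theorem bijOn_of_strictMonoOn {f : ℝ → ℝ} (hf : ContinuousOn f I01) (hmono : StrictMonoOn f I01)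
    (h0 : f 0 = 0) (h1 : f 1 = 1) : BijOn f I01 I01 := by
  have m0 : (0 : ℝ) ∈ I01 := ⟨le_rfl, zero_le_one⟩
  have m1 : (1 : ℝ) ∈ I01 := ⟨zero_le_one, le_rfl⟩
  refine ⟨fun x hx => ⟨?_, ?_⟩, hmono.injOn, ?_⟩
  · rw [← h0]; exact hmono.monotoneOn m0 hx hx.1
  · rw [← h1]; exact hmono.monotoneOn hx m1 hx.2
  · have := intermediate_value_Icc zero_le_one hf
    rwa [h0, h1] at this

/-- Renormalizing a branch on the interval `[a, b]` brings it within `O((b - a) ^ ε)` of the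
identity. -/
theorem HolderCk.renorm_sub_id {ε : ℝ} (hε : ε ∈ Ioc (0 : ℝ) 1) {k : ℕ} {f f' : ℝ → ℝ}
    {B c a b : ℝ} (hd : ∀ x ∈ I01, HasDerivWithinAt f (f' x) I01 x) (hf' : HolderCk ε k f' B)
    (hc : 0 < c) (hfc : ∀ x ∈ I01, c ≤ f' x) (ha : 0 ≤ a) (hab : a < b) (hb : b ≤ 1) :
    HolderCk ε (k + 1) (fun x => renorm a b (f a) (f b) f x - x) (B / c * (b - a) ^ ε) ∧
      ∃ r : ℝ → ℝ, (∀ x ∈ I01, HasDerivWithinAt (renorm a b (f a) (f b) f) (r x) I01 x) ∧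
        ∀ x ∈ I01, 0 < r x := by
  have hB := hf'.nonneg
  set l := b - a with hl_def
  have hl : 0 < l := sub_pos.2 hab
  have hl1 : l ≤ 1 := by linarith
  have hm : MapsTo (fun x => a + l * x) I01 I01 := fun x hx =>
    ⟨by have := mul_nonneg hl.le hx.1; dsimp only; linarith,
      by have := mul_le_of_le_one_right hl.le hx.2; dsimp only; linarith⟩
  obtain ⟨ξ, hξ, hslope⟩ := exists_hasDerivAt_eq_slope f f' hab
    (fun x hx => ((hd x ⟨ha.trans hx.1, hx.2.trans hb⟩).continuousWithinAt).mono
      (Icc_subset_Icc ha hb))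
    fun x hx => (hd x ⟨ha.trans hx.1.le, hx.2.le.trans hb⟩).hasDerivAt
      (Icc_mem_nhds (ha.trans_lt hx.1) (hx.2.trans_le hb))
  have hξI : ξ ∈ I01 := ⟨ha.trans hξ.1.le, hξ.2.le.trans hb⟩
  have hξc := hfc ξ hξI
  have hξ0 : 0 < f' ξ := hc.trans_le hξc
  have hlen : f b - f a = f' ξ * l := by rw [hslope, div_mul_cancel₀ _ hl.ne']
  have hK : ∀ x ∈ I01, HasDerivWithinAt (renorm a b (f a) (f b) f)
      (f' (a + l * x) / f' ξ) I01 x := fun x hx => by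
    have := (((hd _ (hm hx)).comp_affine hm).sub_const (f a)).div_const (f b - f a)
    rw [hlen, mul_comm l, mul_div_mul_right _ _ hl.ne', ← hlen] at this
    exact this
  have hosc : ∀ x ∈ I01, |f' (a + l * x) - f' ξ| ≤ B * l ^ ε := fun x hx => by
    refine (hf'.holderBoundOn01_self hε _ (hm hx) _ hξI).trans ?_
    have := mul_nonneg hl.le hx.1
    have := mul_le_of_le_one_right hl.le hx.2
    have h1 : |a + l * x - ξ| ≤ l := abs_le.2 ⟨by linarith [hξ.2], by linarith [hξ.1]⟩
    have := hε.1.le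
    gcongr
  have hder := ((hf'.comp_affine_sub_const hε hl.le hl1 hm hosc).const_mul (f' ξ)⁻¹).mono
    (B := B / c * l ^ ε) (by
      rw [abs_of_pos (inv_pos.2 hξ0), div_mul_eq_mul_div, div_eq_inv_mul]
      gcongr)
  have hd1 : ∀ x ∈ I01, HasDerivWithinAt (fun x => renorm a b (f a) (f b) f x - x)
      ((f' ξ)⁻¹ * (f' (a + l * x) - f' ξ)) I01 x := fun x hx => by
    rw [mul_sub, inv_mul_cancel₀ hξ0.ne', ← div_eq_inv_mul]
    exact (hK x hx).sub (hasDerivWithinAt_id x I01)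
  refine ⟨⟨fun x hx => ?_, _, hd1, hder⟩, _, hK, fun x hx =>
    div_pos (hc.trans_le (hfc _ (hm hx))) hξ0⟩
  have h := (convex_Icc (0 : ℝ) 1).norm_image_sub_le_of_norm_hasDerivWithin_le hd1
    hder.abs_apply_le ⟨le_rfl, zero_le_one⟩ hx
  have h0 : renorm a b (f a) (f b) f 0 = 0 := by simp [renorm]
  simp only [h0, sub_zero, Real.norm_eq_abs] at h
  exact h.trans (mul_le_of_le_one_right (by positivity) (abs_le.2 ⟨by linarith [hx.1], hx.2⟩))

/-- `K` is an increasing `C^k` diffeomorphism of `[0,1]` that is `δ`-close to the identity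
in the `C^{k+ε}` sense. -/
structure IsNearIdDiffeo (ε : ℝ) (k : ℕ) (K : ℝ → ℝ) (δ : ℝ) : Prop where
  sub_id : HolderCk ε k (fun x => K x - x) δ
  map_zero : K 0 = 0
  map_one : K 1 = 1
  exists_deriv : ∃ r : ℝ → ℝ, (∀ x ∈ I01, HasDerivWithinAt K (r x) I01 x) ∧ ∀ x ∈ I01, 0 < r x

theorem strictMonoOn_I01_of_hasDerivWithinAt_pos {f f' : ℝ → ℝ}
    (hd : ∀ x ∈ I01, HasDerivWithinAt f (f' x) I01 x) (hpos : ∀ x ∈ I01, 0 < f' x) :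
    StrictMonoOn f I01 :=
  strictMonoOn_of_hasDerivWithinAt_pos (convex_Icc 0 1) (fun x hx => (hd x hx).continuousWithinAt)
    (fun x hx => (hd x (interior_subset hx)).mono interior_subset)
    fun x hx => hpos x (interior_subset hx)

theorem IsNearIdDiffeo.mapsTo {ε : ℝ} {k : ℕ} {K : ℝ → ℝ} {δ : ℝ}
    (h : IsNearIdDiffeo ε k K δ) : MapsTo K I01 I01 := by
  obtain ⟨r, hd, hr⟩ := h.exists_deriv
  exact (bijOn_of_strictMonoOn (fun x hx => (hd x hx).continuousWithinAt)
    (strictMonoOn_I01_of_hasDerivWithinAt_pos hd hr) h.map_zero h.map_one).mapsTo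

/-- The composition `K (m - 1) ∘ ⋯ ∘ K 0`. -/
def compSeq (K : ℕ → ℝ → ℝ) : ℕ → ℝ → ℝ
  | 0 => fun x => x
  | m + 1 => fun x => K m (compSeq K m x)

theorem compSeq_add (K : ℕ → ℝ → ℝ) (N i : ℕ) (x : ℝ) :
    compSeq K (N + i) x = compSeq (fun i => K (N + i)) i (compSeq K N x) := by
  induction i with
  | zero => rfl
  | succ i ih => exact congrArg (K (N + i)) ih

section compSeq

variable {ε : ℝ} {k : ℕ} {K : ℕ → ℝ → ℝ} {δ : ℕ → ℝ}

theorem compSeq_mapsTo (hK : ∀ i, IsNearIdDiffeo ε k (K i) (δ i)) (m : ℕ) :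
    MapsTo (compSeq K m) I01 I01 := by
  induction m with
  | zero => exact fun _ hx => hx
  | succ m ih => exact (hK m).mapsTo.comp ih

theorem compSeq_zero (hK : ∀ i, IsNearIdDiffeo ε k (K i) (δ i)) (m : ℕ) :
    compSeq K m 0 = 0 := by
  induction m with
  | zero => rfl
  | succ m ih => simp only [compSeq, ih, (hK m).map_zero]

theorem compSeq_one (hK : ∀ i, IsNearIdDiffeo ε k (K i) (δ i)) (m : ℕ) :
    compSeq K m 1 = 1 := by
  induction m with
  | zero => rfl
  | succ m ih => simp only [compSeq, ih, (hK m).map_one]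

theorem compSeq_exists_deriv (hK : ∀ i, IsNearIdDiffeo ε k (K i) (δ i)) (m : ℕ) :
    ∃ r : ℝ → ℝ, (∀ x ∈ I01, HasDerivWithinAt (compSeq K m) (r x) I01 x) ∧
      ∀ x ∈ I01, 0 < r x := by
  induction m with
  | zero => exact ⟨fun _ => 1, fun x _ => hasDerivWithinAt_id x _, fun _ _ => one_pos⟩
  | succ m ih =>
    obtain ⟨r, hr, hr0⟩ := ih
    obtain ⟨s, hs, hs0⟩ := (hK m).exists_deriv
    have hm := compSeq_mapsTo hK m
    exact ⟨_, fun x hx => (hs _ (hm hx)).comp x (hr x hx) hm,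
      fun x hx => mul_pos (hs0 _ (hm hx)) (hr0 x hx)⟩

theorem HolderCk.exists_bound_comp (hε : ε ∈ Ioc (0 : ℝ) 1) {f : ℝ → ℝ} {B : ℝ}
    (hf : HolderCk ε (k + 1) f B) (hm : MapsTo f I01 I01) :
    ∃ C : ℝ, ∀ (h : ℝ → ℝ) (δ : ℝ), HolderCk ε (k + 1) h δ →
      HolderCk ε (k + 1) (fun x => h (f x)) (C * δ) := by
  obtain ⟨C, -, hC⟩ := HolderCk.exists_comp_bound hε (k + 1) (le_max_right B 1)
  have hf' := hf.mono (le_max_left B 1)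
  exact ⟨C, fun h δ hh => hC h f δ hh hf' hm hf'.lipschitz⟩

theorem compSeq_exists_bound (hε : ε ∈ Ioc (0 : ℝ) 1)
    (hK : ∀ i, IsNearIdDiffeo ε (k + 1) (K i) (δ i)) (m : ℕ) :
    ∃ B, HolderCk ε (k + 1) (compSeq K m) B := by
  induction m with
  | zero => exact ⟨1, HolderCk.id hε _⟩
  | succ m ih =>
    obtain ⟨B, hB⟩ := ih
    obtain ⟨C, hC⟩ := hB.exists_bound_comp hε (compSeq_mapsTo hK m)
    exact ⟨_, ((hC _ _ (hK m).sub_id).add hB).congr fun x _ => (sub_add_cancel _ _).symm⟩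

/-- A composition of diffeomorphisms with small total distance to the identity converges, with
limit close to the identity. -/
theorem exists_limit_compSeq_of_small (hε : ε ∈ Ioc (0 : ℝ) 1) (k : ℕ) :
    ∃ η > (0 : ℝ), ∀ (K : ℕ → ℝ → ℝ) (δ : ℕ → ℝ),
      (∀ i, IsNearIdDiffeo ε (k + 1) (K i) (δ i)) → Summable δ → ∑' i, δ i ≤ η →
      ∃ (G : ℝ → ℝ) (r : ℕ → ℝ), HolderCk ε (k + 1) (fun x => G x - x) (1 / 2) ∧
        G 0 = 0 ∧ G 1 = 1 ∧ Tendsto r atTop (nhds 0) ∧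
        ∀ i, HolderCk ε (k + 1) (fun x => G x - compSeq K i x) (r i) := by
  obtain ⟨C, hC1, hC⟩ := HolderCk.exists_comp_bound hε (k + 1) one_le_two
  have hC0 : 0 < C := zero_lt_one.trans_le hC1
  refine ⟨1 / (2 * C), by positivity, fun K δ hK hδ hsmall => ?_⟩
  have hδ0 : ∀ i, 0 ≤ δ i := fun i => (hK i).sub_id.nonneg
  have hCδ : Summable fun i => C * δ i := hδ.mul_left C
  have htot : ∑' i, C * δ i ≤ 1 / 2 := by
    rw [tsum_mul_left]
    calc C * ∑' i, δ i ≤ C * (1 / (2 * C)) := by gcongr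
      _ = 1 / 2 := by field_simp
  have hstep : ∀ m, HolderCk ε (k + 1) (fun x => compSeq K m x - x)
      (∑ i ∈ Finset.range m, C * δ i) →
      HolderCk ε (k + 1) (fun x => compSeq K (m + 1) x - compSeq K m x) (C * δ m) :=
    fun m hm => by
      have hle : ∑ i ∈ Finset.range m, C * δ i ≤ 1 / 2 :=
        (hCδ.sum_le_tsum _ fun i _ => mul_nonneg hC0.le (hδ0 i)).trans htot
      have h2 : HolderCk ε (k + 1) (compSeq K m) 2 :=
        ((hm.add (HolderCk.id hε (k + 1))).congr fun x _ => (sub_add_cancel _ _).symm).mono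
          (by linarith)
      exact hC _ _ _ (hK m).sub_id h2 (compSeq_mapsTo hK m) h2.lipschitz
  have hsum : ∀ m, HolderCk ε (k + 1) (fun x => compSeq K m x - x)
      (∑ i ∈ Finset.range m, C * δ i) := fun m => by
    induction m with
    | zero => exact (HolderCk.const (k + 1) (c := 0) (by simp)).congr fun x _ => sub_self x
    | succ m ih =>
      rw [Finset.sum_range_succ]
      exact (ih.add (hstep m ih)).congr fun x _ => by ring
  have hdiff := fun m => hstep m (hsum m)
  have hs : ∀ x ∈ I01, Summable fun m => compSeq K (m + 1) x - compSeq K m x := fun x hx =>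
    hCδ.of_norm_bounded fun m => (hdiff m).abs_apply_le x hx
  refine ⟨fun x => x + ∑' m, (compSeq K (m + 1) x - compSeq K m x),
    fun i => ∑' m, C * δ (m + i), ?_, ?_, ?_, tendsto_sum_nat_add fun i => C * δ i, fun i => ?_⟩
  · exact ((HolderCk.tsum hCδ hdiff).mono htot).congr fun x _ => add_sub_cancel_left _ _
  · simp [compSeq_zero hK]
  · simp [compSeq_one hK]
  · have hCδi : Summable fun m => C * δ (m + i) := (summable_nat_add_iff i).2 hCδ
    refine (HolderCk.tsum hCδi fun m => hdiff (m + i)).congr fun x hx => ?_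
    have h1 := (hs x hx).sum_add_tsum_nat_add i
    rw [Finset.sum_range_sub (fun m => compSeq K m x)] at h1
    change x + ∑' m, (compSeq K (m + 1) x - compSeq K m x) - compSeq K i x = _
    rw [← h1]
    simp only [compSeq]
    ring

/-- A composition of diffeomorphisms with summable distances to the identity converges. -/
theorem exists_limit_compSeq (hε : ε ∈ Ioc (0 : ℝ) 1)
    (hK : ∀ i, IsNearIdDiffeo ε (k + 1) (K i) (δ i)) (hδ : Summable δ) :
    ∃ (F : ℝ → ℝ) (r : ℕ → ℝ) (B : ℝ) (N : ℕ), HolderCk ε (k + 1) F B ∧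
      F 0 = 0 ∧ F 1 = 1 ∧
      (∃ F' : ℝ → ℝ, (∀ x ∈ I01, HasDerivWithinAt F (F' x) I01 x) ∧ ∀ x ∈ I01, 0 < F' x) ∧
      Tendsto r atTop (nhds 0) ∧
      ∀ i, HolderCk ε (k + 1) (fun x => F x - compSeq K (i + N) x) (r i) := by
  obtain ⟨η, hη, H⟩ := exists_limit_compSeq_of_small hε k
  obtain ⟨N, hN⟩ := ((tendsto_sum_nat_add δ).eventually (Iic_mem_nhds hη)).exists
  obtain ⟨G, r, hG, hG0, hG1, hr, hGr⟩ := H (fun i => K (N + i)) (fun i => δ (N + i))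
    (fun i => hK _) (by simpa only [add_comm] using (summable_nat_add_iff N).2 hδ)
    (by simpa only [add_comm] using hN)
  have hm := compSeq_mapsTo hK N
  obtain ⟨B, hB⟩ := compSeq_exists_bound hε hK N
  obtain ⟨C, hC⟩ := hB.exists_bound_comp hε hm
  obtain ⟨s, hs, hs0⟩ := compSeq_exists_deriv hK N
  have hGid : HolderCk ε (k + 1) G (1 / 2 + 1) :=
    (hG.add (HolderCk.id hε (k + 1))).congr fun x _ => (sub_add_cancel _ _).symm
  obtain ⟨-, e, he, hek⟩ := hG
  have hGd : ∀ x ∈ I01, HasDerivWithinAt G (e x + 1) I01 x := fun x hx =>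
    ((he x hx).add (hasDerivWithinAt_id x I01)).congr (fun y _ => (sub_add_cancel _ _).symm)
      (sub_add_cancel _ _).symm
  refine ⟨fun x => G (compSeq K N x), fun i => C * r i, _, N, hC _ _ hGid, ?_, ?_,
    ⟨_, fun x hx => (hGd _ (hm hx)).comp x (hs x hx) hm, fun x hx => mul_pos ?_ (hs0 x hx)⟩, ?_,
    fun i => ?_⟩
  · simp only [compSeq_zero hK, hG0]
  · simp only [compSeq_one hK, hG1]
  · linarith [(abs_le.1 (hek.abs_apply_le _ (hm hx))).1]
  · simpa using hr.const_mul C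
  · refine (hC _ _ (hGr i)).congr fun x _ => ?_
    simp only [add_comm i N, compSeq_add K N i]

end compSeq

theorem wordMap_append {d : ℕ} (g : Fin d → ℝ → ℝ) (u v : List (Fin d)) (x : ℝ) :
    wordMap g (u ++ v) x = wordMap g v (wordMap g u x) := by
  induction u generalizing x with
  | nil => rfl
  | cons i u ih => exact ih (g i x)

theorem wordMap_dword_succ {d : ℕ} (g : Fin d → ℝ → ℝ) (j : ℕ → Fin d) (i : ℕ) (x : ℝ) :
    wordMap g (dword j (i + 1)) x = g (j i) (wordMap g (dword j i) x) := by
  rw [dword, List.ofFn_succ_last, wordMap_append]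
  rfl

/-- Renormalizations of successive branches compose to the renormalization of the composite. -/
theorem renorm_wordMap_eq_compSeq {d : ℕ} (g : Fin d → ℝ → ℝ) (j : ℕ → Fin d) {a b : ℕ → ℝ}
    (hab : ∀ i, a i < b i) (n i : ℕ) :
    renorm (a n) (b n) (a (n + i)) (b (n + i))
        (wordMap g (List.ofFn fun t : Fin i => j (n + (t : ℕ)))) =
      compSeq (fun i => renorm (a (n + i)) (b (n + i)) (a (n + i + 1)) (b (n + i + 1))
        (g (j (n + i)))) i := by
  induction i with
  | zero =>
    funext x
    have := (sub_pos.2 (hab n)).ne'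
    simp only [renorm, compSeq, List.ofFn_zero, wordMap, add_zero, id_eq]
    field_simp
    ring
  | succ i ih =>
    funext x
    rw [compSeq, ← ih, List.ofFn_succ_last]
    have := (sub_pos.2 (hab (n + i))).ne'
    simp only [renorm, wordMap_append, Fin.val_castSucc, Fin.val_last, wordMap, id_eq,
      mul_div_cancel₀ _ this, add_sub_cancel, ← add_assoc]

theorem IsCantorSystem.exists_uniform_bounds {d k : ℕ} [Nonempty (Fin d)] {ε : ℝ}
    {g : Fin d → ℝ → ℝ} (hg : IsCantorSystem (k + 1) ε g) :
    ∃ (g' : Fin d → ℝ → ℝ) (B c q : ℝ), 0 < c ∧ q < 1 ∧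
      ∀ i, HolderCk ε k (g' i) B ∧ ∀ x ∈ I01, HasDerivWithinAt (g i) (g' i x) I01 x ∧
        c ≤ g' i x ∧ g' i x ≤ q := by
  have hne : (I01 : Set ℝ).Nonempty := ⟨0, le_rfl, zero_le_one⟩
  have hcd := fun i => (contDiffOn_succ_iff_derivWithin uniqueDiffOn_Icc_zero_one).1
    (by simpa using hg.smooth i : ContDiffOn ℝ ((k : WithTop ℕ∞) + 1) (g i) I01)
  have hB : ∀ i, ∃ B, HolderCk ε k (derivWithin (g i) I01) B := fun i => by
    obtain ⟨H, -, hH⟩ := hg.holder i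
    rw [iteratedDerivWithin_succ'] at hH
    exact HolderCk.exists_of_contDiffOn (hcd i).2.2 hH
  choose B hB using hB
  choose p hp hpmin using fun i => isCompact_Icc.exists_isMinOn hne (hcd i).2.2.continuousOn
  choose r hr hrmax using fun i => isCompact_Icc.exists_isMaxOn hne (hcd i).2.2.continuousOn
  obtain ⟨iB, hiB⟩ := Finite.exists_max B
  obtain ⟨ip, hip⟩ := Finite.exists_min fun i => derivWithin (g i) I01 (p i)
  obtain ⟨ir, hir⟩ := Finite.exists_max fun i => derivWithin (g i) I01 (r i)
  exact ⟨_, B iB, _, _, hg.deriv_pos ip _ (hp ip), hg.deriv_lt_one ir _ (hr ir), fun i =>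
    ⟨(hB i).mono (hiB i), fun x hx => ⟨((hcd i).1 x hx).hasDerivWithinAt,
      (hip i).trans (hpmin i hx), (hrmax i hx : _ ≤ _).trans (hir i)⟩⟩⟩

/-- Renormalized branches along nested intervals `[a i, b i]` are summably close to the
identity. -/
theorem IsCantorSystem.exists_summable_isNearIdDiffeo {d k : ℕ} {ε : ℝ}
    (hε : ε ∈ Ioc (0 : ℝ) 1) {g : Fin d → ℝ → ℝ} (hg : IsCantorSystem (k + 1) ε g)
    {j : ℕ → Fin d} {a b : ℕ → ℝ} (ha0 : a 0 ∈ I01) (hb0 : b 0 ∈ I01) (hab0 : a 0 < b 0)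
    (ha : ∀ i, a (i + 1) = g (j i) (a i)) (hb : ∀ i, b (i + 1) = g (j i) (b i)) :
    (∀ i, a i < b i) ∧ ∃ δ : ℕ → ℝ, Summable δ ∧ ∀ i, IsNearIdDiffeo ε (k + 1)
      (renorm (a i) (b i) (a (i + 1)) (b (i + 1)) (g (j i))) (δ i) := by
  have : Nonempty (Fin d) := ⟨j 0⟩
  obtain ⟨g', B, c, q, hc, hq, hg'⟩ := hg.exists_uniform_bounds
  have hq0 : 0 < q := by
    have h := (hg' (j 0)).2 0 ⟨le_rfl, zero_le_one⟩
    linarith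
  have hB : 0 ≤ B := (hg' (j 0)).1.nonneg
  have haI : ∀ i, a i ∈ I01 := fun i => by
    induction i with
    | zero => exact ha0
    | succ i ih => rw [ha]; exact hg.maps _ ih
  have hbI : ∀ i, b i ∈ I01 := fun i => by
    induction i with
    | zero => exact hb0
    | succ i ih => rw [hb]; exact hg.maps _ ih
  have hab : ∀ i, a i < b i := fun i => by
    induction i with
    | zero => exact hab0
    | succ i ih =>
      rw [ha, hb]
      exact strictMonoOn_I01_of_hasDerivWithinAt_pos (fun x hx => ((hg' (j i)).2 x hx).1)
        (fun x hx => hc.trans_le ((hg' (j i)).2 x hx).2.1) (haI i) (hbI i) ih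
  have hlen : ∀ i, b i - a i ≤ q ^ i := fun i => by
    induction i with
    | zero => rw [pow_zero]; linarith [hb0.2, ha0.1]
    | succ i ih =>
      have h := (convex_Icc (0 : ℝ) 1).norm_image_sub_le_of_norm_hasDerivWithin_le (C := q)
        (fun x hx => ((hg' (j i)).2 x hx).1) (fun x hx => by
          have h := ((hg' (j i)).2 x hx).2
          rw [Real.norm_of_nonneg (hc.le.trans h.1)]
          exact h.2) (haI i) (hbI i)
      rw [← ha, ← hb, Real.norm_eq_abs, Real.norm_of_nonneg (sub_pos.2 (hab i)).le] at h
      rw [pow_succ']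
      exact (le_abs_self _).trans (h.trans (by gcongr))
  refine ⟨hab, fun i => B / c * (q ^ ε) ^ i, (summable_geometric_of_lt_one
    (Real.rpow_nonneg hq0.le ε) (Real.rpow_lt_one hq0.le hq hε.1)).mul_left _, fun i => ?_⟩
  have hne := (sub_pos.2 (hab (i + 1))).ne'
  obtain ⟨h1, h2⟩ := HolderCk.renorm_sub_id hε (fun x hx => ((hg' (j i)).2 x hx).1)
    (hg' (j i)).1 hc (fun x hx => ((hg' (j i)).2 x hx).2.1) (haI i).1 (hab i) (hbI i).2
  rw [ha, hb] at hne ⊢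
  refine ⟨h1.mono ?_, by simp [renorm], by simp [renorm, hne], h2⟩
  have hpow : (b i - a i) ^ ε ≤ (q ^ ε) ^ i := by
    rw [← Real.rpow_mul_natCast hq0.le, mul_comm, Real.rpow_natCast_mul hq0.le]
    exact Real.rpow_le_rpow (sub_pos.2 (hab i)).le (hlen i) hε.1.le
  exact mul_le_mul_of_nonneg_left hpow (by positivity)

/-- for a `C^{k+ε}` Cantor system, the renormalized identifications
`F_m = (L_m)⁻¹ ∘ (g_{j_m} ∘ ⋯ ∘ g_{j_{n+1}}) ∘ L` converge in `C^k` norm as `m → ∞`, and the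
limit is an increasing `C^k` diffeomorphism of `[0,1]` with `ε`-Hölder `k`-th derivative. -/
theorem stmt13 (d k : ℕ) (hd : 2 ≤ d) (hk : 1 ≤ k) (ε : ℝ) (hε : ε ∈ Set.Ioc (0:ℝ) 1)
    (g : Fin d → ℝ → ℝ) (hg : IsCantorSystem k ε g)
    (j : ℕ → Fin d) (n : ℕ) (F' : ℕ → ℝ → ℝ)
    (hF' : ∀ m, n < m →
      F' m = renorm (wordMap g (dword j n) 0) (wordMap g (dword j n) 1)
        (wordMap g (dword j m) 0) (wordMap g (dword j m) 1)
        (wordMap g (List.ofFn (fun i : Fin (m - n) => j (n + (i : ℕ)))))) :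
    ∃ F : ℝ → ℝ,
      (∀ t ≤ k, TendstoUniformlyOn (fun m => iteratedDerivWithin t (F' m) I01)
        (iteratedDerivWithin t F I01) Filter.atTop I01) ∧
      IsDiffeo01 k F ∧ ∃ H > 0, HolderBoundOn01 ε H (iteratedDerivWithin k F I01) := by
  obtain ⟨k, rfl⟩ : ∃ l, k = l + 1 := ⟨k - 1, by omega⟩
  obtain ⟨hab, δ, hδ, hK⟩ := hg.exists_summable_isNearIdDiffeo hε (j := j)
    (a := fun i => wordMap g (dword j i) 0) (b := fun i => wordMap g (dword j i) 1)
    ⟨le_rfl, zero_le_one⟩ ⟨zero_le_one, le_rfl⟩ zero_lt_one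
    (fun i => wordMap_dword_succ g j i 0) (fun i => wordMap_dword_succ g j i 1)
  have hKn := fun i => hK (n + i)
  obtain ⟨F, r, B, N, hF, hF0, hF1, ⟨f, hf, hf0⟩, hr, hFr⟩ := exists_limit_compSeq hε hKn
    (by simpa only [add_comm] using (summable_nat_add_iff n).2 hδ)
  have hFcomp := fun m (hm : n < m) => by
    have h := renorm_wordMap_eq_compSeq g j hab n (m - n)
    rw [Nat.add_sub_of_le hm.le] at h
    exact (hF' m hm).trans h
  have hmono := strictMonoOn_I01_of_hasDerivWithinAt_pos hf hf0
  refine ⟨F, fun t ht => ?_, ⟨hF.contDiffOn hε, hmono, fun x hx => ?_,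
    bijOn_of_strictMonoOn (hF.continuousOn hε) hmono hF0 hF1⟩, B + 1,
    by linarith [hF.nonneg], (hF.mono (by linarith)).holderBoundOn01⟩
  · rw [Metric.tendstoUniformlyOn_iff]
    intro η hη
    obtain ⟨M, hM⟩ := eventually_atTop.1 (hr.eventually (gt_mem_nhds hη))
    filter_upwards [eventually_gt_atTop (n + N + M)] with m hm x hx
    obtain ⟨i, hi⟩ : ∃ i, m - n = i + N := ⟨m - n - N, by omega⟩
    rw [hFcomp m (by omega), hi]
    obtain ⟨A, hA⟩ := compSeq_exists_bound hε hKn (i + N)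
    have htk : ((t : ℕ) : WithTop ℕ∞) ≤ ((k + 1 : ℕ) : WithTop ℕ∞) := by exact_mod_cast ht
    rw [Real.dist_eq, ← iteratedDerivWithin_sub hx uniqueDiffOn_Icc_zero_one
      (((hF.contDiffOn hε).of_le htk) x hx) (((hA.contDiffOn hε).of_le htk) x hx)]
    exact ((hFr i).abs_iteratedDerivWithin_le ht x hx).trans_lt (hM i (by omega))
  · rw [HolderCk.eqOn_derivWithin hf hx]
    exact hf0 x hx
end
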